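/- There are positive absolute constants C such that the following holds. For every ψ ∈ Ψ (modulo p) and every s = σ + it with |σ − 1/2| < 2α and |t − 2πt₀| < 𝓛₁ + 2, one has |L(s,ψ) − K(s,ψ) − Z(s,ψ)·N(1−s, ψ̄)| ≤ C·𝓛^{-68}·∫_{−𝓛^{20}}^{𝓛^{20}} |Σ_{n<T³} ψ(n)n^{-s-iv}|·exp(−v²/(4𝓛^{30})) dv + exp(−𝓛^{9}), where K(s,ψ) = Σ_n ψ(n)n^{-s}·g*(P₄/n) and N(1−s, ψ̄) = Σ_n conj(ψ(n))·n^{s−1}·g*(T²/n). -/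

import Mathlib

open scoped Classical

noncomputable section

/-- The Dirichlet L-function of `χ` (extended to modulus `0` by `0`, a case never used below). -/
def Lfun {N : ℕ} (χ : DirichletCharacter ℂ N) (s : ℂ) : ℂ :=
  if h : N = 0 then 0
  else
    haveI : NeZero N := ⟨h⟩
    DirichletCharacter.LFunction χ s

/-- A Dirichlet character is *real* if all of its values are real numbers. -/
def IsRealChar {N : ℕ} (χ : DirichletCharacter ℂ N) : Prop :=
  ∀ a : ZMod N, (χ a).im = 0

/-- `𝓛 = log D`. -/
def bigL (D : ℕ) : ℝ := Real.log D

/-- `P = exp (𝓛 ^ 9)`. -/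
def bigP (D : ℕ) : ℝ := Real.exp (bigL D ^ 9)

/-- Assumption (A): `L(1, χ) < 𝓛 ^ (-2022)`. -/
def AssumptionA (D : ℕ) (χ : DirichletCharacter ℂ D) : Prop :=
  (Lfun χ 1).re < bigL D ^ (-2022 : ℤ)

/-- `p ~ P`, i.e. `p` is a prime with `P < p < P * (1 + 𝓛 ^ (-68))`. -/
def SimP (D p : ℕ) : Prop :=
  p.Prime ∧ bigP D < (p : ℝ) ∧ (p : ℝ) < bigP D * (1 + bigL D ^ (-68 : ℤ))

/-- The finite set of primes `p ~ P`. -/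
def primesP (D : ℕ) : Finset ℕ :=
  (Finset.range ⌈2 * bigP D⌉₊).filter (SimP D)

/-- `𝒫 = ∑_{p ~ P} p`. -/
def calP (D : ℕ) : ℝ := ∑ p ∈ primesP D, (p : ℝ)

/-- `ν(n) = ∑_{d ∣ n} χ(d)`. -/
def nuF (D : ℕ) (χ : DirichletCharacter ℂ D) (n : ℕ) : ℂ :=
  ∑ d ∈ n.divisors, χ (d : ZMod D)

/-- `υ(n) = ∑_{ab = n} μ(a) μ(b) χ(b)`. -/
def upsF (D : ℕ) (χ : DirichletCharacter ℂ D) (n : ℕ) : ℂ :=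
  ∑ d ∈ n.divisors,
    ((ArithmeticFunction.moebius (n / d) : ℤ) : ℂ) * ((ArithmeticFunction.moebius d : ℤ) : ℂ) *
      χ (d : ZMod D)

/-- `t₀ = 𝓛 ^ 519`. -/
def t0 (D : ℕ) : ℝ := bigL D ^ 519

/-- `s₀ = 1/2 + 2 π i t₀`. -/
def s0 (D : ℕ) : ℂ := 1 / 2 + 2 * (Real.pi : ℂ) * Complex.I * (t0 D : ℂ)

/-- `𝓛₁ = 𝓛 ^ 405`. -/
def bigL1 (D : ℕ) : ℝ := bigL D ^ 405

/-- `ν` truncated to `n ≤ D ^ 4`, as an arithmetic function. -/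
def nuT (D : ℕ) (χ : DirichletCharacter ℂ D) : ArithmeticFunction ℂ :=
  ⟨fun n => if n = 0 then 0 else if n ≤ D ^ 4 then nuF D χ n else 0, by simp⟩

/-- `υ` truncated to `n ≤ D ^ 4`, as an arithmetic function. -/
def upsT (D : ℕ) (χ : DirichletCharacter ℂ D) : ArithmeticFunction ℂ :=
  ⟨fun n => if n = 0 then 0 else if n ≤ D ^ 4 then upsF D χ n else 0, by simp⟩

/-- `ν₂₀`, the 20-fold Dirichlet convolution of the truncation of `ν`. -/
def nu20 (D : ℕ) (χ : DirichletCharacter ℂ D) (n : ℕ) : ℂ := (nuT D χ ^ 20) n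

/-- `υ₂₀`, the 20-fold Dirichlet convolution of the truncation of `υ`. -/
def ups20 (D : ℕ) (χ : DirichletCharacter ℂ D) (n : ℕ) : ℂ := (upsT D χ ^ 20) n

/-- `ς(n) = ∑_{lm = n, l ≤ D⁴, m ≤ D⁴} ν(l) υ(m)`. -/
def sigF (D : ℕ) (χ : DirichletCharacter ℂ D) (n : ℕ) : ℂ :=
  ∑ d ∈ n.divisors,
    if d ≤ D ^ 4 ∧ n / d ≤ D ^ 4 then nuF D χ d * upsF D χ (n / d) else 0

/-- `X₁(x, ψ) = ∑_{n ≤ x} ν₂₀(n) ψ(n) n^{-s₀}`. -/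
def X1 (D : ℕ) (χ : DirichletCharacter ℂ D) {p : ℕ} (ψ : DirichletCharacter ℂ p) (x : ℝ) : ℂ :=
  ∑ n ∈ Finset.Icc 1 ⌊x⌋₊, nu20 D χ n * ψ (n : ZMod p) * (n : ℂ) ^ (-s0 D)

/-- `X₂(x, ψ) = ∑_{n ≤ x} υ₂₀(n) ψ(n) n^{-s₀}`. -/
def X2 (D : ℕ) (χ : DirichletCharacter ℂ D) {p : ℕ} (ψ : DirichletCharacter ℂ p) (x : ℝ) : ℂ :=
  ∑ n ∈ Finset.Icc 1 ⌊x⌋₊, ups20 D χ n * ψ (n : ZMod p) * (n : ℂ) ^ (-s0 D)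

/-- `X₃(x, ψ) = ∑_{D⁴ < n ≤ x} ν(n) ψ(n) n^{-s₀}`. -/
def X3 (D : ℕ) (χ : DirichletCharacter ℂ D) {p : ℕ} (ψ : DirichletCharacter ℂ p) (x : ℝ) : ℂ :=
  ∑ n ∈ Finset.Ioc (D ^ 4) ⌊x⌋₊, nuF D χ n * ψ (n : ZMod p) * (n : ℂ) ^ (-s0 D)

/-- `X₄(x, ψ) = ∑_{D⁴ < n ≤ x} ς(n) ψ(n) n^{-s₀}`. -/
def X4 (D : ℕ) (χ : DirichletCharacter ℂ D) {p : ℕ} (ψ : DirichletCharacter ℂ p) (x : ℝ) : ℂ :=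
  ∑ n ∈ Finset.Ioc (D ^ 4) ⌊x⌋₊, sigF D χ n * ψ (n : ZMod p) * (n : ℂ) ^ (-s0 D)

/-- Inequality (3.4). -/
def Ineq1 (D : ℕ) (χ : DirichletCharacter ℂ D) {p : ℕ} (ψ : DirichletCharacter ℂ p) : Prop :=
  ‖X1 D χ ψ ((D : ℝ) ^ 80)‖ + ‖X2 D χ ψ ((D : ℝ) ^ 80)‖ +
      (∫ x in (1 : ℝ)..((D : ℝ) ^ 80), (‖X1 D χ ψ x‖ + ‖X2 D χ ψ x‖) / x) <
    bigL D ^ 1171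

/-- Inequality (3.5). -/
def Ineq2 (D : ℕ) (χ : DirichletCharacter ℂ D) {p : ℕ} (ψ : DirichletCharacter ℂ p) : Prop :=
  ‖X3 D χ ψ (bigP D ^ 2)‖ + (∫ x in ((D : ℝ) ^ 4)..(bigP D ^ 2), ‖X3 D χ ψ x‖ / x) <
    bigL D ^ (-585 : ℤ)

/-- Inequality (3.6). -/
def Ineq3 (D : ℕ) (χ : DirichletCharacter ℂ D) {p : ℕ} (ψ : DirichletCharacter ℂ p) : Prop :=
  ‖X4 D χ ψ ((D : ℝ) ^ 8)‖ + (∫ x in ((D : ℝ) ^ 4)..((D : ℝ) ^ 8), ‖X4 D χ ψ x‖ / x) <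
    bigL D ^ (-633 : ℤ)

/-- Membership in `Ψ₁`: `ψ` is a primitive character mod `p` with `p ~ P` satisfying
(3.4), (3.5) and (3.6). -/
def MemPsi1 (D : ℕ) (χ : DirichletCharacter ℂ D) {p : ℕ} (ψ : DirichletCharacter ℂ p) : Prop :=
  SimP D p ∧ ψ.IsPrimitive ∧ Ineq1 D χ ψ ∧ Ineq2 D χ ψ ∧ Ineq3 D χ ψ

/-- `F(s, ψ) = ∑_{n ≤ D⁴} ν(n) ψ(n) n^{-s}`. -/
def Ffun (D : ℕ) (χ : DirichletCharacter ℂ D) {p : ℕ} (ψ : DirichletCharacter ℂ p) (s : ℂ) : ℂ :=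
  ∑ n ∈ Finset.Icc 1 (D ^ 4), nuF D χ n * ψ (n : ZMod p) * (n : ℂ) ^ (-s)

/-- `G(s, ψ) = ∑_{n ≤ D⁴} υ(n) ψ(n) n^{-s}`. -/
def Gfun (D : ℕ) (χ : DirichletCharacter ℂ D) {p : ℕ} (ψ : DirichletCharacter ℂ p) (s : ℂ) : ℂ :=
  ∑ n ∈ Finset.Icc 1 (D ^ 4), upsF D χ n * ψ (n : ZMod p) * (n : ℂ) ^ (-s)

/-- `F'(s, ψ) = -∑_{n ≤ D⁴} ν(n) ψ(n) (log n) n^{-s}`, the derivative of `F` in `s`. -/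
def Ffun' (D : ℕ) (χ : DirichletCharacter ℂ D) {p : ℕ} (ψ : DirichletCharacter ℂ p) (s : ℂ) : ℂ :=
  -∑ n ∈ Finset.Icc 1 (D ^ 4),
    nuF D χ n * ψ (n : ZMod p) * ((Real.log n : ℝ) : ℂ) * (n : ℂ) ^ (-s)

/-- `F(1 - s, ψ̄) = ∑_{n ≤ D⁴} ν(n) conj(ψ(n)) n^{s - 1}`, as a function of `s`. -/
def FfunBar (D : ℕ) (χ : DirichletCharacter ℂ D) {p : ℕ} (ψ : DirichletCharacter ℂ p)
    (s : ℂ) : ℂ :=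
  ∑ n ∈ Finset.Icc 1 (D ^ 4),
    nuF D χ n * (starRingEnd ℂ) (ψ (n : ZMod p)) * (n : ℂ) ^ (s - 1)

/-- The region `Ω`. -/
def InOmega (D : ℕ) (s : ℂ) : Prop :=
  |(s - s0 D).re| < 1 / 2 ∧ |(s - s0 D).im| < bigL1 D + 2

/-- The region `Ω₁`. -/
def InOmega1 (D : ℕ) (s : ℂ) : Prop :=
  1 / 2 - Real.log (bigL D) / (100 * bigL D) < s.re ∧
    s.re < 1 + Real.log (bigL D) / (100 * bigL D) ∧
    |s.im - 2 * Real.pi * t0 D| < bigL1 D + 5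

/-- The region `Ω₂`. -/
def InOmega2 (D : ℕ) (s : ℂ) : Prop :=
  1 / 2 - (bigL D)⁻¹ < s.re ∧ s.re < 1 + (bigL D)⁻¹ ∧
    |s.im - 2 * Real.pi * t0 D| < bigL1 D + 4

/-- `α = π / log P`. -/
def alphaD (D : ℕ) : ℝ := Real.pi / Real.log (bigP D)

/-- The region `Ω₃`. -/
def InOmega3 (D : ℕ) (s : ℂ) : Prop :=
  1 / 2 - alphaD D < s.re ∧ s.re < 1 + alphaD D ∧
    |s.im - 2 * Real.pi * t0 D| < bigL1 D + 3

/-- The Gauss sum `τ(θ) = ∑_{a mod k} θ(a) e(a/k)`. -/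
def tauSum {k : ℕ} (θ : DirichletCharacter ℂ k) : ℂ :=
  ∑ a ∈ Finset.range k,
    θ (a : ZMod k) * Complex.exp (2 * (Real.pi : ℂ) * Complex.I * (a : ℂ) / (k : ℂ))

/-- The factor `Z(s, θ)` from the functional equation. -/
def Zfun {k : ℕ} (θ : DirichletCharacter ℂ k) (s : ℂ) : ℂ :=
  if θ (-1) = 1 then
    tauSum θ * (Real.pi : ℂ) ^ (s - 1 / 2) * (k : ℂ) ^ (-s) *
      Complex.Gamma ((1 - s) / 2) / Complex.Gamma (s / 2)
  else
    -Complex.I * tauSum θ * (Real.pi : ℂ) ^ (s - 1 / 2) * (k : ℂ) ^ (-s) *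
      Complex.Gamma ((2 - s) / 2) / Complex.Gamma ((1 + s) / 2)

/-- The product character `χψ` modulo `D * p`, i.e. `n ↦ χ(n) ψ(n)`. -/
def chiPsi (D : ℕ) (χ : DirichletCharacter ℂ D) {p : ℕ} (ψ : DirichletCharacter ℂ p) :
    DirichletCharacter ℂ (D * p) :=
  DirichletCharacter.changeLevel (dvd_mul_right D p) χ *
    DirichletCharacter.changeLevel (dvd_mul_left p D) ψ

/-- `Z̃(s, ψ) = Z(s, ψ) Z(s, χψ)`. -/
def Ztilde (D : ℕ) (χ : DirichletCharacter ℂ D) {p : ℕ} (ψ : DirichletCharacter ℂ p)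
    (s : ℂ) : ℂ :=
  Zfun ψ s * Zfun (chiPsi D χ ψ) s

/-- `T = exp (𝓛 ^ 1.1)`. -/
def bigT (D : ℕ) : ℝ := Real.exp (bigL D ^ (1.1 : ℝ))

/-- `P₄ = P T⁻² t₀`. -/
def P4 (D : ℕ) : ℝ := bigP D * bigT D ^ (-2 : ℤ) * t0 D

/-- The smooth weight `g(x) = π^{-1/2} ∫_{-∞}^{𝓛^{15} log x} e^{-u²} du`. -/
def gfun (D : ℕ) (x : ℝ) : ℝ :=
  Real.pi ^ (-(1 : ℝ) / 2) * ∫ u in Set.Iio (bigL D ^ 15 * Real.log x), Real.exp (-u ^ 2)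

/-- `g*(y) = g(y)` for `y > 1/2`, and `0` otherwise. -/
def gstar (D : ℕ) (y : ℝ) : ℝ := if 1 / 2 < y then gfun D y else 0

/-- `K(s, ψ) = ∑_n ψ(n) n^{-s} g*(P₄ / n)`. -/
def Kfun (D : ℕ) {p : ℕ} (ψ : DirichletCharacter ℂ p) (s : ℂ) : ℂ :=
  ∑' n : ℕ, ψ (n : ZMod p) * (n : ℂ) ^ (-s) * ((gstar D (P4 D / n) : ℝ) : ℂ)

/-- `N(1 - s, ψ̄) = ∑_n conj(ψ(n)) n^{s-1} g*(T² / n)`, as a function of `s`. -/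
def Nfun (D : ℕ) {p : ℕ} (ψ : DirichletCharacter ℂ p) (s : ℂ) : ℂ :=
  ∑' n : ℕ,
    (starRingEnd ℂ) (ψ (n : ZMod p)) * (n : ℂ) ^ (s - 1) * ((gstar D (bigT D ^ 2 / n) : ℝ) : ℂ)

/-- `𝔞 = (6/π²) L'(1,χ)² ∏_{q ∣ D} q/(q+1)`. -/
def fraka (D : ℕ) (χ : DirichletCharacter ℂ D) : ℂ :=
  6 / (Real.pi : ℂ) ^ 2 * deriv (Lfun χ) 1 ^ 2 * ∏ q ∈ D.primeFactors, (q : ℂ) / ((q : ℂ) + 1)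

section
open Filter Topology

def GG (z : ℂ) : ℂ := (z - 1/2) * Complex.log z - z
def dlt (z : ℂ) : ℂ := (z + 1/2) * (Complex.log (z+1) - Complex.log z) - 1

lemma re_pos_slit {z : ℂ} (h : 0 < z.re) : z ∈ Complex.slitPlane := Or.inl h
lemma re_pos_ne {z : ℂ} (h : 0 < z.re) : z ≠ 0 := by rintro rfl; simp at h

lemma norm_le_add_real {z : ℂ} (h : 0 < z.re) {x : ℝ} (hx : 0 ≤ x) : ‖z‖ ≤ ‖z + x‖ := by
  rw [Complex.norm_def, Complex.norm_def]
  apply Real.sqrt_le_sqrt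
  simp only [Complex.normSq_apply, Complex.add_re, Complex.add_im, Complex.ofReal_re, Complex.ofReal_im]
  nlinarith

lemma dlt_bound {z : ℂ} (h : 0 < z.re) : ‖dlt z‖ ≤ 1/4 / ‖z‖^2 := by
  have hz := norm_pos_iff.2 (re_pos_ne h)
  have hne : ∀ x : ℝ, 0 ≤ x → z + x ≠ 0 := fun x hx => by
    apply re_pos_ne; simp; linarith
  have hne2 : z + 1/2 ≠ 0 := by
    have := hne (1/2) (by norm_num); simpa using this
  -- antiderivative
  have key : dlt z = ∫ x in (0:ℝ)..1, (1/2 - (x:ℂ))^2 / ((z + x) * (z + 1/2)) := by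
    have hd : ∀ x ∈ Set.uIcc (0:ℝ) 1, HasDerivAt (fun x : ℝ => (z+1/2) * Complex.log (z + x) - x - ((1/2:ℂ) * x - (x:ℂ)^2/2) / (z+1/2)) ((1/2 - (x:ℂ))^2 / ((z + x) * (z + 1/2))) x := by
      intro x hx
      rw [Set.uIcc_of_le zero_le_one] at hx
      have h0 : HasDerivAt (fun x : ℝ => (x:ℂ)) 1 x := Complex.ofRealCLM.hasDerivAt
      have h1 : HasDerivAt (fun x : ℝ => Complex.log (z + x)) (1/(z+x)) x :=
        (h0.const_add z).clog_real (re_pos_slit (by simp; linarith [hx.1]))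
      have h2 := ((h1.const_mul (z+1/2)).sub h0).sub (((h0.const_mul (1/2:ℂ)).sub ((h0.pow 2).div_const 2)).div_const (z+1/2))
      refine h2.congr_deriv ?_
      have := hne x hx.1
      have h3 : z * 2 + 1 ≠ 0 := by
        intro h; apply hne2; linear_combination h / 2
      rw [show z + 1/2 = (z*2+1)/2 by ring]
      field_simp
      push_cast
      ring
    rw [intervalIntegral.integral_eq_sub_of_hasDerivAt hd]
    · simp [dlt]; ring
    · apply ContinuousOn.intervalIntegrable
      intro x hx
      rw [Set.uIcc_of_le zero_le_one] at hx
      apply ContinuousAt.continuousWithinAt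
      have := hne x hx.1
      have h3 : (z + x) * (z+1/2) ≠ 0 := mul_ne_zero this hne2
      fun_prop (disch := assumption)
  rw [key]
  have := intervalIntegral.norm_integral_le_of_norm_le_const (a := (0:ℝ)) (b := 1) (C := 1/4 / ‖z‖^2) (f := fun x : ℝ => (1/2 - (x:ℂ))^2 / ((z + x) * (z + 1/2))) ?_
  · simpa using this
  · intro x hx
    rw [Set.uIoc_of_le zero_le_one] at hx
    rw [norm_div, norm_mul, norm_pow, pow_two ‖z‖]
    have e1 : ‖(1/2:ℂ) - x‖ = |1/2 - x| := by
      rw [← Real.norm_eq_abs, ← Complex.norm_real]; push_cast; rfl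
    have e2 := norm_le_add_real h hx.1.le
    have e3 := norm_le_add_real h (x := 1/2) (by norm_num)
    push_cast at e3
    rw [e1, sq_abs]
    gcongr
    nlinarith [hx.1, hx.2]

lemma GG_succ {z : ℂ} : GG (z+1) - GG z - Complex.log z = dlt z := by
  simp [GG, dlt]; ring

lemma Gamma_step {z : ℂ} (h : 0 < z.re) :
    Complex.Gamma z * Complex.exp (-GG z) = Complex.Gamma (z+1) * Complex.exp (-GG (z+1)) * Complex.exp (dlt z) := by
  rw [Complex.Gamma_add_one _ (re_pos_ne h), mul_assoc, ← Complex.exp_add, ← GG_succ]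
  have : z * Complex.Gamma z * Complex.exp (-GG (z+1) + (GG (z+1) - GG z - Complex.log z)) = z * Complex.Gamma z * (Complex.exp (-GG z) * Complex.exp (- Complex.log z)) := by
    rw [← Complex.exp_add]; congr 2; ring
  rw [this, Complex.exp_neg (Complex.log z), Complex.exp_log (re_pos_ne h)]
  have := re_pos_ne h
  field_simp

lemma Gamma_steps {z : ℂ} (h : 0 < z.re) (n : ℕ) :
    Complex.Gamma z * Complex.exp (-GG z) = Complex.Gamma (z+n) * Complex.exp (-GG (z+n)) * Complex.exp (∑ j ∈ Finset.range n, dlt (z+j)) := by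
  induction n with
  | zero => simp
  | succ n ih =>
    rw [ih, Gamma_step (z := z+n) (by simp; positivity), Finset.sum_range_succ, Complex.exp_add]
    push_cast
    rw [add_assoc]
    ring

lemma dlt_sum_bound {z : ℂ} (h : 0 < z.re) (hz : 1/4 ≤ ‖z‖) :
    Summable (fun j : ℕ => dlt (z + j)) ∧ ‖∑' j : ℕ, dlt (z+j)‖ ≤ 3 / ‖z‖ := by
  have hz0 : 0 < ‖z‖ := by linarith
  set r := ‖z‖ with hr
  have b1 : ∀ j : ℕ, ‖dlt (z+j)‖ ≤ 5/2 * (1/(r + j) - 1/(r+(j+1:ℕ))) := by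
    intro j
    refine (dlt_bound (z := z+j) (by simp; positivity)).trans ?_
    have e : r^2 + (j:ℝ)^2 ≤ ‖z + j‖^2 := by
      rw [hr, Complex.sq_norm, Complex.sq_norm]
      simp only [Complex.normSq_apply, Complex.add_re, Complex.add_im, Complex.natCast_re, Complex.natCast_im]
      have : (0:ℝ) ≤ j := by positivity
      nlinarith [mul_nonneg this h.le]
    have hj : (0:ℝ) ≤ j := by positivity
    have e2 : 1/(r + j) - 1/(r+(j+1:ℕ)) = 1/((r+j)*(r+j+1)) := by
      push_cast; field_simp; ring
    rw [e2]
    have : 0 < ‖z + j‖^2 := by nlinarith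
    rw [mul_one_div, div_le_div_iff₀ this (by positivity)]
    nlinarith [sq_nonneg (r - j)]
  have hs : HasSum (fun j : ℕ => 5/2 * (1/(r + j) - 1/(r+(j+1:ℕ)))) (5/2 * (1/r)) := by
    apply HasSum.mul_left
    rw [hasSum_iff_tendsto_nat_of_nonneg]
    · have : ∀ n : ℕ, ∑ i ∈ Finset.range n, (1/(r + (i:ℝ)) - 1/(r+((i+1:ℕ):ℝ))) = 1/r - 1/(r+n) := by
        intro n
        rw [Finset.sum_range_sub' (fun i : ℕ => 1/(r+(i:ℝ)))]; simp
      simp_rw [this]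
      have t : Tendsto (fun n : ℕ => 1/(r+(n:ℝ))) atTop (𝓝 0) := by
        simp only [one_div]
        exact tendsto_inv_atTop_zero.comp (tendsto_atTop_add_const_left _ _ tendsto_natCast_atTop_atTop)
      simpa using t.const_sub (1/r)
    · intro i
      have : (0:ℝ) ≤ i := by positivity
      rw [sub_nonneg]
      apply one_div_le_one_div_of_le <;> push_cast <;> linarith
  refine ⟨Summable.of_norm_bounded hs.summable b1, ?_⟩
  refine (tsum_of_norm_bounded hs b1).trans ?_
  rw [mul_one_div]
  gcongr
  norm_num

lemma Gamma_prod {z : ℂ} (h : 0 < z.re) (n : ℕ) :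
    Complex.Gamma (z + n) = Complex.Gamma z * ∏ j ∈ Finset.range n, (z + j) := by
  induction n with
  | zero => simp
  | succ n ih =>
    rw [Finset.prod_range_succ, ← mul_assoc, ← ih]
    push_cast
    rw [← add_assoc, Complex.Gamma_add_one _ (re_pos_ne (by simp; positivity)), mul_comm]

lemma GG_limit {z : ℂ} (h : 0 < z.re) :
    Tendsto (fun n : ℕ => Complex.Gamma (z+(n+1:ℕ)) * Complex.exp (-GG (z+(n+1:ℕ)))) atTop (𝓝 (Real.sqrt (2*Real.pi) : ℂ)) := by
  have hG0 : Complex.Gamma z ≠ 0 := Complex.Gamma_ne_zero_of_re_pos h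
  have t1 : Tendsto (fun n : ℕ => Complex.Gamma z / Complex.GammaSeq z n) atTop (𝓝 1) := by
    have := (tendsto_const_nhds (x := Complex.Gamma z)).div (Complex.GammaSeq_tendsto_Gamma z) hG0
    rwa [div_self hG0] at this
  have t2 : Tendsto (fun n : ℕ => ((Stirling.stirlingSeq n : ℝ) : ℂ) * (Real.sqrt 2 : ℂ)) atTop (𝓝 ((Real.sqrt Real.pi : ℂ) * (Real.sqrt 2 : ℂ))) :=
    ((Complex.continuous_ofReal.tendsto _).comp Stirling.tendsto_stirlingSeq_sqrt_pi).mul_const _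
  have t3 : Tendsto (fun n : ℕ => (n:ℂ) * Complex.log (1 + (z+1)/n)) atTop (𝓝 (z+1)) := by
    apply Complex.tendsto_nat_mul_log_one_add_of_tendsto
    apply tendsto_const_nhds.congr'
    filter_upwards [eventually_ne_atTop 0] with n hn
    field_simp
  have t4 : Tendsto (fun n : ℕ => Complex.log (1 + (z+1)/n)) atTop (𝓝 0) := by
    have i : Tendsto (fun n : ℕ => ((n:ℂ))⁻¹) atTop (𝓝 0) := tendsto_inv_atTop_nhds_zero_nat (𝕜 := ℂ)
    have := t3.mul i
    rw [mul_zero] at this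
    apply this.congr'
    filter_upwards [eventually_ne_atTop 0] with n hn
    field_simp
  have t5 : Tendsto (fun n : ℕ => Complex.exp ((z+1) - ((n:ℂ) * Complex.log (1 + (z+1)/n) + (z+1/2) * Complex.log (1 + (z+1)/n)))) atTop (𝓝 1) := by
    have := (Complex.continuous_exp.tendsto _).comp ((t3.add (t4.const_mul (z+1/2))).const_sub (z+1))
    simpa [Function.comp_def] using this
  have t6 := (t1.mul t2).mul t5
  have e : (1 * ((Real.sqrt Real.pi : ℂ) * (Real.sqrt 2 : ℂ)) * 1) = (Real.sqrt (2*Real.pi) : ℂ) := by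
    rw [Real.sqrt_mul (by norm_num)]; push_cast; ring
  rw [e] at t6
  apply t6.congr'
  filter_upwards [eventually_ne_atTop 0] with n hn
  have hn0 : (0:ℝ) < n := by positivity
  have hnc : (n:ℂ) ≠ 0 := by exact_mod_cast hn
  have hprod : ∏ j ∈ Finset.range (n + 1), (z + j) ≠ 0 := by
    rw [Finset.prod_ne_zero_iff]; intro j _; apply re_pos_ne; simp; positivity
  have hGam : Complex.Gamma (z + (n+1:ℕ)) = Complex.Gamma z * ∏ j ∈ Finset.range (n + 1), (z + j) := by
    exact Gamma_prod h (n+1)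
  have hlog : Complex.log (z + (n+1:ℕ)) = Real.log n + Complex.log (1 + (z+1)/n) := by
    rw [← Complex.log_ofReal_mul hn0]
    · congr 1; push_cast; field_simp; ring
    · intro h0
      have : z + (n+1:ℕ) = 0 := by
        have : (n:ℂ) * (1 + (z+1)/n) = 0 := by rw [h0, mul_zero]
        field_simp at this
        rw [← this]; push_cast; ring
      have h2 := congrArg Complex.re this
      simp at h2; linarith
  have hst : (n.factorial : ℂ) = (Stirling.stirlingSeq n : ℂ) * (Real.sqrt 2 : ℂ) * Complex.exp (1/2 * Real.log n + n * Real.log n - n) := by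
    have : (n.factorial : ℝ) = (Stirling.stirlingSeq n : ℝ) * Real.sqrt 2 * Real.exp (1/2 * Real.log n + n * Real.log n - n) := by
      rw [Stirling.stirlingSeq, Real.exp_sub, Real.exp_add]
      have e1 : Real.exp (1/2 * Real.log n) = Real.sqrt n := by
        rw [Real.sqrt_eq_rpow, Real.rpow_def_of_pos hn0]; ring_nf
      have e2 : Real.exp (n * Real.log n) = (n:ℝ)^n := by
        rw [← Real.log_pow, Real.exp_log (by positivity)]
      rw [e1, e2, div_pow, Real.sqrt_mul (by norm_num), ← Real.exp_nat_mul, mul_one]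
      have : Real.sqrt 2 ≠ 0 := by positivity
      have : Real.sqrt n ≠ 0 := by positivity
      field_simp
    have h' := congrArg (fun x : ℝ => (x:ℂ)) this
    simpa only [Complex.ofReal_mul, Complex.ofReal_exp, Complex.ofReal_add, Complex.ofReal_sub, Complex.ofReal_natCast, Complex.ofReal_div, Complex.ofReal_one, Complex.ofReal_ofNat] using h'
  rw [hGam, Complex.GammaSeq, hst, Complex.cpow_def_of_ne_zero hnc, GG, hlog, ← Complex.natCast_log]
  have hs0 : (Stirling.stirlingSeq n : ℂ) ≠ 0 := by
    intro h0; rw [h0] at hst; simp [Nat.factorial_ne_zero] at hst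
  have h2 : (Real.sqrt 2 : ℂ) ≠ 0 := by
    have : Real.sqrt 2 ≠ 0 := by positivity
    exact_mod_cast this
  have hx : ∀ a b c : ℂ, c = a + b → Complex.exp c = Complex.exp a * Complex.exp b := by
    rintro a b c rfl; exact Complex.exp_add a b
  have f1 := hx ((Real.log n : ℂ) * z + (1/2 * Real.log n + n * Real.log n - n)) (-((z + (n+1:ℕ) - 1/2) * ((Real.log n : ℂ) + Complex.log (1 + (z+1)/n)) - (z + (n+1:ℕ)))) ((z+1) - ((n:ℂ) * Complex.log (1 + (z+1)/n) + (z+1/2) * Complex.log (1 + (z+1)/n))) (by push_cast; ring)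
  rw [f1, Complex.exp_add]
  have g1 := Complex.exp_ne_zero ((Real.log n : ℂ) * z)
  have g2 := Complex.exp_ne_zero (1/2 * (Real.log n : ℂ) + n * Real.log n - n)
  field_simp

theorem stirling {z : ℂ} (h : 0 < z.re) (hz : 1/4 ≤ ‖z‖) :
    ∃ E : ℂ, ‖E‖ ≤ 3 / ‖z‖ ∧ Complex.Gamma z = Real.sqrt (2*Real.pi) * Complex.exp (GG z + E) := by
  obtain ⟨h1, h2⟩ := dlt_sum_bound h hz
  refine ⟨_, h2, ?_⟩
  have t1 := (GG_limit h).mul ((Complex.continuous_exp.tendsto _).comp (h1.hasSum.tendsto_sum_nat.comp (tendsto_add_atTop_nat 1)))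
  have t2 : Tendsto (fun n : ℕ => Complex.Gamma z * Complex.exp (-GG z)) atTop (𝓝 (Complex.Gamma z * Complex.exp (-GG z))) := tendsto_const_nhds
  have := tendsto_nhds_unique (t2.congr (fun n => ?_)) t1
  · rw [Complex.exp_add, mul_left_comm, ← this, mul_left_comm, ← Complex.exp_add]; simp
  · rw [Gamma_steps h (n+1)]; rfl
end

section
open Filter Topology

def Zt (κ ε : ℂ) (lam : ℝ) (u : ℂ) : ℂ :=
  κ * Complex.exp (u * lam) * Complex.Gamma (1 - u) * Complex.exp (-(Real.pi * Complex.I * u / 2)) *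
    (1 + ε * Complex.exp (Real.pi * Complex.I * u))

lemma tauSum_eq {p : ℕ} [NeZero p] (ψ : DirichletCharacter ℂ p) :
    tauSum ψ = gaussSum ψ ZMod.stdAddChar := by
  unfold tauSum gaussSum
  refine Finset.sum_bij (fun a _ => (a : ZMod p)) (fun _ _ => Finset.mem_univ _) ?_ ?_ ?_
  · intro a ha b hb h
    rw [ZMod.natCast_eq_natCast_iff] at h
    exact Nat.ModEq.eq_of_lt_of_lt h (Finset.mem_range.1 ha) (Finset.mem_range.1 hb)
  · intro b _
    exact ⟨b.val, Finset.mem_range.2 (ZMod.val_lt b), by simp⟩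
  · intro a _
    have := ZMod.stdAddChar_coe (N := p) (a : ℤ)
    push_cast at this
    rw [this]

lemma norm_tauSum {p : ℕ} (hp : p.Prime) (ψ : DirichletCharacter ℂ p) (hψ : ψ ≠ 1) :
    ‖tauSum ψ‖ = Real.sqrt p := by
  have : Fact p.Prime := ⟨hp⟩
  rw [tauSum_eq]
  have h1 := gaussSum_mul_gaussSum_eq_card hψ (ZMod.isPrimitive_stdAddChar p)
  have h2 : gaussSum ψ⁻¹ (ZMod.stdAddChar (N := p))⁻¹ = (starRingEnd ℂ) (gaussSum ψ ZMod.stdAddChar) := by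
    unfold gaussSum
    rw [map_sum]
    refine Finset.sum_congr rfl fun a _ => ?_
    rw [map_mul, ← MulChar.star_apply', RCLike.star_def, AddChar.starComp_apply]
    rw [ZMod.ringChar_zmod_n]; exact hp.pos
  rw [h2, Complex.mul_conj, ZMod.card] at h1
  have h3 : Complex.normSq (gaussSum ψ (ZMod.stdAddChar (N := p))) = p := by exact_mod_cast h1
  rw [Complex.norm_def, h3]

lemma cpow_exp_aux {x : ℝ} (hx : 0 < x) (u : ℂ) : (x : ℂ) ^ u = Complex.exp (Real.log x * u) := by
  rw [Complex.cpow_def_of_ne_zero (by exact_mod_cast hx.ne'), Complex.ofReal_log hx.le]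

lemma sin_exp (x : ℂ) : Complex.sin x = Complex.I / 2 * (Complex.exp (-(Complex.I * x)) * (1 + (-1) * Complex.exp (2 * (Complex.I * x)))) := by
  rw [mul_add, mul_left_comm (Complex.exp _) (-1), ← Complex.exp_add, Complex.sin]
  ring_nf

lemma cos_exp (x : ℂ) : Complex.cos x = 1 / 2 * (Complex.exp (-(Complex.I * x)) * (1 + 1 * Complex.exp (2 * (Complex.I * x)))) := by
  rw [mul_add, one_mul, ← Complex.exp_add, Complex.cos]
  ring_nf

lemma Z_pre {p : ℕ} (hp : p.Prime) (u : ℂ) :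
    (Real.pi : ℂ) ^ (u - 1/2) * (p : ℂ) ^ (-u) * (2:ℂ)^u * (Real.sqrt Real.pi : ℂ) = Complex.exp (u * (Real.log (2 * Real.pi / p) : ℝ)) := by
  have hp0 : (0:ℝ) < p := by exact_mod_cast hp.pos
  have e1 := cpow_exp_aux Real.pi_pos (u - 1/2)
  have e2 := cpow_exp_aux hp0 (-u)
  have e3 := cpow_exp_aux (x := 2) (by norm_num) u
  have e4 : (Real.sqrt Real.pi : ℂ) = Complex.exp (Real.log Real.pi * (1/2)) := by
    rw [← cpow_exp_aux Real.pi_pos, Real.sqrt_eq_rpow, Complex.ofReal_cpow Real.pi_pos.le]; push_cast; rfl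
  push_cast at e2 e3
  rw [e1, e2, e3, e4, ← Complex.exp_add, ← Complex.exp_add, ← Complex.exp_add, Real.log_div (by positivity) hp0.ne', Real.log_mul (by norm_num) (by positivity)]
  congr 1
  push_cast
  ring

lemma exists_Z {p : ℕ} (hp : p.Prime) (ψ : DirichletCharacter ℂ p) (hψ : ψ.IsPrimitive) :
    ∃ κ ε : ℂ, (ε = 1 ∨ ε = -1) ∧ ‖κ‖ = Real.sqrt p / (2 * Real.pi) ∧
      (∀ u : ℂ, 0 < u.re → u.re < 1 → Zfun ψ u = Zt κ ε (Real.log (2 * Real.pi / p)) u) ∧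
      (∀ u : ℂ, u.re < 1 → Lfun ψ u = Zt κ ε (Real.log (2 * Real.pi / p)) u * Lfun ψ⁻¹ (1 - u)) := by
  have : Fact p.Prime := ⟨hp⟩
  have hp0 : (0:ℝ) < p := by exact_mod_cast hp.pos
  have hne : ψ ≠ 1 := by
    rintro rfl
    rw [DirichletCharacter.IsPrimitive, DirichletCharacter.conductor_one] at hψ
    exact hp.one_lt.ne hψ
  have hnorm := norm_tauSum hp ψ hne
  have hL : ∀ (χ : DirichletCharacter ℂ p) u, Lfun χ u = DirichletCharacter.LFunction χ u := by
    intro χ u; simp [Lfun, hp.ne_zero]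
  have hpi : (Real.pi : ℂ) ≠ 0 := by exact_mod_cast Real.pi_ne_zero
  have hfe : ∀ u : ℂ, u.re < 1 → Lfun ψ u = (p:ℂ) ^ (-u) * (2 * Real.pi : ℂ) ^ (-(1-u)) * Complex.Gamma (1-u) * (Complex.exp (Real.pi * Complex.I * (1-u) / 2) + ψ (-1) * Complex.exp (-Real.pi * Complex.I * (1-u) / 2)) * ψ (-1) * tauSum ψ * Lfun ψ⁻¹ (1-u) := by
    intro u hu
    have := ZMod.LFunction_one_sub ψ (s := 1 - u) (fun n hn => by
      have := congrArg Complex.re hn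
      simp at this; linarith [(Nat.cast_nonneg n : (0:ℝ) ≤ n)]) (Or.inl (ψ.map_zero' hp.ne_one))
    rw [sub_sub_cancel] at this
    rw [hL, DirichletCharacter.LFunction, this, hL, DirichletCharacter.LFunction]
    have i1 : ψ⁻¹ (-1) = ψ (-1) := by
      rcases ψ.even_or_odd with h | h
      · rw [MulChar.inv_apply', inv_neg_one]
      · rw [MulChar.inv_apply', inv_neg_one]
    have f1 : (ZMod.dft (ψ : ZMod p → ℂ)) = fun k => (ψ (-1) * tauSum ψ) * ψ⁻¹ k := by
      ext k
      rw [hψ.fourierTransform_eq_inv_mul_gaussSum, ← tauSum_eq, ← neg_one_mul, map_mul, i1]; ring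
    have f2 : (fun x : ZMod p => ψ (-x)) = fun x => ψ (-1) * ψ x := by
      ext x; rw [← neg_one_mul, map_mul]
    have f3 : (ZMod.dft (fun x => ψ (-x) : ZMod p → ℂ)) = fun k => (ψ (-1) * (ψ (-1) * tauSum ψ)) * ψ⁻¹ k := by
      rw [f2]
      have : (fun x => ψ (-1) * ψ x) = ψ (-1) • (ψ : ZMod p → ℂ) := by ext; simp
      rw [this, map_smul, f1]
      ext; simp; ring
    rw [f3, f1]
    have hc : ∀ (c : ℂ) (v : ℂ), ZMod.LFunction (fun k => c * ψ⁻¹ k) v = c * ZMod.LFunction ((ψ⁻¹ : DirichletCharacter ℂ p) : ZMod p → ℂ) v := by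
      intro c v
      simp only [ZMod.LFunction, mul_assoc, ← Finset.mul_sum]
      ring
    rw [hc, hc]
    rw [show 1 - u - 1 = -u by ring]
    ring
  have hpow : ∀ u : ℂ, (p:ℂ) ^ (-u) * (2 * Real.pi : ℂ) ^ (-(1-u)) = 1/(2*Real.pi) * Complex.exp (u * (Real.log (2 * Real.pi / p) : ℝ)) := by
    intro u
    have e2 := cpow_exp_aux hp0 (-u)
    have e3 := cpow_exp_aux (x := 2 * Real.pi) (by positivity) u
    push_cast at e2 e3
    have : (2 * Real.pi : ℂ) ≠ 0 := mul_ne_zero two_ne_zero hpi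
    rw [show -(1-u) = u - 1 by ring, Complex.cpow_sub _ _ this, Complex.cpow_one, e2, e3, Real.log_div (by positivity) hp0.ne', Real.log_mul (by norm_num) (by positivity)]
    rw [mul_div_assoc', ← Complex.exp_add, one_div, div_eq_inv_mul]
    congr 2
    push_cast
    ring
  have hx1 : ∀ u : ℂ, Complex.exp (Real.pi * Complex.I * (1-u) / 2) = Complex.I * Complex.exp (-(Real.pi * Complex.I * u / 2)) := by
    intro u
    rw [show (Real.pi * Complex.I * (1-u) / 2 : ℂ) = (Real.pi / 2 * Complex.I) + (-(Real.pi * Complex.I * u / 2)) by ring, Complex.exp_add, Complex.exp_pi_div_two_mul_I]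
  have hx2 : ∀ u : ℂ, Complex.exp (-Real.pi * Complex.I * (1-u) / 2) = -Complex.I * (Complex.exp (-(Real.pi * Complex.I * u / 2)) * Complex.exp (Real.pi * Complex.I * u)) := by
    intro u
    rw [← Complex.exp_add, show (-Real.pi * Complex.I * (1-u) / 2 : ℂ) = (-Real.pi / 2 * Complex.I) + (-(Real.pi * Complex.I * u / 2) + Real.pi * Complex.I * u) by ring, Complex.exp_add]
    congr 1
    rw [neg_div, neg_mul, Complex.exp_neg, Complex.exp_pi_div_two_mul_I, Complex.inv_I]
  rcases ψ.even_or_odd with h | h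
  · refine ⟨Complex.I / (2 * Real.pi) * tauSum ψ, -1, Or.inr rfl, ?_, ?_, ?_⟩
    · rw [norm_mul, hnorm, norm_div]; simp [abs_of_pos Real.pi_pos]; ring
    · intro u h0 h1
      have hev : ψ (-1) = 1 := h
      have r1 := Complex.Gamma_mul_Gamma_one_sub (u/2)
      have r2 := Complex.Gamma_mul_Gamma_add_half ((1-u)/2)
      have hg1 : Complex.Gamma (u/2) ≠ 0 := Complex.Gamma_ne_zero_of_re_pos (by simp; linarith)
      have hg2 : Complex.Gamma (1-u/2) ≠ 0 := Complex.Gamma_ne_zero_of_re_pos (by simp; linarith)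
      have hs : Complex.sin (Real.pi * (u/2)) ≠ 0 := by
        intro h; rw [h, div_zero] at r1; exact mul_ne_zero hg1 hg2 r1
      rw [show (1-u)/2 + 1/2 = 1 - u/2 by ring, show 2 * ((1-u)/2) = 1 - u by ring, sub_sub_cancel] at r2
      have r3 : Complex.Gamma ((1-u)/2) / Complex.Gamma (u/2) = Complex.Gamma (1-u) * 2^u * (Real.sqrt Real.pi : ℂ) * Complex.sin (Real.pi * (u/2)) / Real.pi := by
        rw [← r2]
        rw [eq_div_iff hs] at r1
        rw [div_eq_div_iff hg1 hpi]
        linear_combination (-Complex.Gamma ((1-u)/2)) * r1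
      rw [Zfun, if_pos hev, mul_div_assoc, r3, sin_exp, Zt, ← Z_pre hp u]
      rw [show -(Complex.I * (Real.pi * (u/2))) = -(Real.pi * Complex.I * u / 2) by ring, show 2 * (Complex.I * (Real.pi * (u/2))) = Real.pi * Complex.I * u by ring]
      field_simp
    · intro u hu
      have hev : ψ (-1) = 1 := h
      rw [hfe u hu, hpow, hx1, hx2, hev, Zt]
      ring
  · refine ⟨-Complex.I / (2 * Real.pi) * tauSum ψ, 1, Or.inl rfl, ?_, ?_, ?_⟩
    · rw [norm_mul, hnorm, norm_div]; simp [abs_of_pos Real.pi_pos]; ring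
    · intro u h0 h1
      have hev : ψ (-1) ≠ 1 := by rw [show ψ (-1) = -1 from h]; norm_num
      have r1 := Complex.Gamma_mul_Gamma_one_sub ((1+u)/2)
      have r2 := Complex.Gamma_mul_Gamma_add_half ((1-u)/2)
      rw [show 1 - (1+u)/2 = (1-u)/2 by ring, show Real.pi * ((1+u)/2) = Real.pi * (u/2) + Real.pi/2 by ring, Complex.sin_add_pi_div_two] at r1
      have hg1 : Complex.Gamma ((1+u)/2) ≠ 0 := Complex.Gamma_ne_zero_of_re_pos (by simp; linarith)
      have hg2 : Complex.Gamma ((1-u)/2) ≠ 0 := Complex.Gamma_ne_zero_of_re_pos (by simp; linarith)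
      have hs : Complex.cos (Real.pi * (u/2)) ≠ 0 := by
        intro h; rw [h, div_zero] at r1; exact mul_ne_zero hg1 hg2 r1
      rw [show (1-u)/2 + 1/2 = (2-u)/2 by ring, show 2 * ((1-u)/2) = 1 - u by ring, sub_sub_cancel] at r2
      have r3 : Complex.Gamma ((2-u)/2) / Complex.Gamma ((1+u)/2) = Complex.Gamma (1-u) * 2^u * (Real.sqrt Real.pi : ℂ) * Complex.cos (Real.pi * (u/2)) / Real.pi := by
        rw [← r2]
        rw [eq_div_iff hs] at r1
        rw [div_eq_div_iff hg1 hpi]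
        linear_combination (-Complex.Gamma ((2-u)/2)) * r1
      rw [Zfun, if_neg hev, mul_div_assoc, r3, cos_exp, Zt, ← Z_pre hp u]
      rw [show -(Complex.I * (Real.pi * (u/2))) = -(Real.pi * Complex.I * u / 2) by ring, show 2 * (Complex.I * (Real.pi * (u/2))) = Real.pi * Complex.I * u by ring]
      field_simp
    · intro u hu
      have hev : ψ (-1) = -1 := h
      rw [hfe u hu, hpow, hx1, hx2, hev, Zt]
      ring
end

section
open Filter Topology

/-- analytic of exponential growth on a vertical strip -/
def Nice (a b : ℝ) (F : ℂ → ℂ) : Prop :=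
  (∀ w : ℂ, a ≤ w.re → w.re ≤ b → DifferentiableAt ℂ F w) ∧
  ∃ C B : ℝ, 0 ≤ C ∧ 0 ≤ B ∧ ∀ w : ℂ, a ≤ w.re → w.re ≤ b → ‖F w‖ ≤ C * Real.exp (B * |w.im|)

/-- Gaussian weighted line integral -/
def JJ (Λ : ℝ) (F : ℂ → ℂ) (c : ℝ) : ℂ :=
  ∫ v : ℝ, F (c + v * Complex.I) * Complex.exp ((c + v * Complex.I) ^ 2 / (4 * Λ))

lemma Nice.mono {a b a' b' : ℝ} {F : ℂ → ℂ} (h : Nice a b F) (ha : a ≤ a') (hb : b' ≤ b) : Nice a' b' F := by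
  obtain ⟨h1, C, B, hC, hB, h2⟩ := h
  exact ⟨fun w h3 h4 => h1 w (ha.trans h3) (h4.trans hb), C, B, hC, hB, fun w h3 h4 => h2 w (ha.trans h3) (h4.trans hb)⟩

lemma Nice.add {a b : ℝ} {F G : ℂ → ℂ} (h : Nice a b F) (h' : Nice a b G) : Nice a b (fun w => F w + G w) := by
  obtain ⟨h1, C, B, hC, hB, h2⟩ := h
  obtain ⟨h1', C', B', hC', hB', h2'⟩ := h'
  refine ⟨fun w h3 h4 => (h1 w h3 h4).add (h1' w h3 h4), C + C', B + B', by positivity, by positivity, fun w h3 h4 => ?_⟩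
  refine (norm_add_le _ _).trans ?_
  rw [add_mul]
  refine add_le_add ((h2 w h3 h4).trans ?_) ((h2' w h3 h4).trans ?_)
  · gcongr; linarith
  · gcongr; linarith

lemma Nice.mul {a b : ℝ} {F G : ℂ → ℂ} (h : Nice a b F) (h' : Nice a b G) : Nice a b (fun w => F w * G w) := by
  obtain ⟨h1, C, B, hC, hB, h2⟩ := h
  obtain ⟨h1', C', B', hC', hB', h2'⟩ := h'
  refine ⟨fun w h3 h4 => (h1 w h3 h4).mul (h1' w h3 h4), C * C', B + B', by positivity, by positivity, fun w h3 h4 => ?_⟩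
  rw [norm_mul, add_mul, Real.exp_add, mul_mul_mul_comm]
  exact mul_le_mul (h2 w h3 h4) (h2' w h3 h4) (norm_nonneg _) (by positivity)

lemma Nice.const {a b : ℝ} (c : ℂ) : Nice a b (fun _ => c) :=
  ⟨fun w _ _ => differentiableAt_const _, ‖c‖, 0, norm_nonneg _, le_rfl, fun w _ _ => by simp⟩

lemma Nice.sub {a b : ℝ} {F G : ℂ → ℂ} (h : Nice a b F) (h' : Nice a b G) : Nice a b (fun w => F w - G w) := by
  have := h.add ((Nice.const (-1)).mul h')
  simpa [sub_eq_add_neg] using this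

lemma Nice.sum {a b : ℝ} {ι : Type*} (s : Finset ι) {F : ι → ℂ → ℂ} (h : ∀ i ∈ s, Nice a b (F i)) : Nice a b (fun w => ∑ i ∈ s, F i w) := by
  induction s using Finset.induction_on with
  | empty => simpa using Nice.const 0
  | insert i s hi ih =>
    simp only [Finset.sum_insert hi]
    exact (h i (Finset.mem_insert_self _ _)).add (ih fun j hj => h j (Finset.mem_insert_of_mem hj))

lemma Nice.congr {a b : ℝ} {F G : ℂ → ℂ} (h : Nice a b F) (hd : ∀ w : ℂ, a ≤ w.re → w.re ≤ b → DifferentiableAt ℂ G w) (hFG : ∀ w : ℂ, a ≤ w.re → w.re ≤ b → G w = F w) : Nice a b G := by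
  obtain ⟨h1, C, B, hC, hB, h2⟩ := h
  exact ⟨hd, C, B, hC, hB, fun w h3 h4 => by rw [hFG w h3 h4]; exact h2 w h3 h4⟩

lemma Nice.neg_arg {a b : ℝ} {F : ℂ → ℂ} (h : Nice a b F) : Nice (-b) (-a) (fun w => F (-w)) := by
  obtain ⟨h1, C, B, hC, hB, h2⟩ := h
  refine ⟨fun w h3 h4 => ?_, C, B, hC, hB, fun w h3 h4 => ?_⟩
  · exact (h1 (-w) (by simp; linarith) (by simp; linarith)).comp w (differentiableAt_id.neg)
  · simpa using h2 (-w) (by simp; linarith) (by simp; linarith)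

lemma Nice.shift {a b : ℝ} {F : ℂ → ℂ} (s : ℂ) (h : Nice (a + s.re) (b + s.re) F) : Nice a b (fun w => F (s + w)) := by
  obtain ⟨h1, C, B, hC, hB, h2⟩ := h
  refine ⟨fun w h3 h4 => ?_, C * Real.exp (B * |s.im|), B, by positivity, hB, fun w h3 h4 => ?_⟩
  · exact (h1 (s+w) (by simp; linarith) (by simp; linarith)).comp w (by fun_prop)
  · refine (h2 (s+w) (by simp; linarith) (by simp; linarith)).trans ?_
    rw [mul_assoc, ← Real.exp_add, ← mul_add]
    gcongr
    simpa using abs_add_le s.im w.im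

lemma Nice.exp {a b : ℝ} (c : ℂ) : Nice a b (fun w => Complex.exp (c * w)) := by
  refine ⟨fun w _ _ => by fun_prop, Real.exp (|c.re| * (|a| + |b|)), |c.im|, by positivity, abs_nonneg _, fun w h3 h4 => ?_⟩
  rw [Complex.norm_exp, ← Real.exp_add, Complex.mul_re]
  apply Real.exp_le_exp.2
  have h5 : |w.re| ≤ |a| + |b| := by
    rw [abs_le]; constructor
    · linarith [neg_abs_le a, abs_nonneg b]
    · linarith [le_abs_self b, abs_nonneg a]
  have : c.re * w.re ≤ |c.re| * (|a|+|b|) := (le_abs_self _).trans (by rw [abs_mul]; gcongr)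
  have : -(c.im * w.im) ≤ |c.im| * |w.im| := by rw [← abs_mul]; exact neg_le_abs _
  linarith

lemma Nice.cpow {a b x : ℝ} (hx : 0 < x) : Nice a b (fun w => (x:ℂ) ^ w) := by
  simp only [cpow_exp_aux hx]; exact Nice.exp _

lemma Nice.inv {a b : ℝ} (ha : 0 < a) : Nice a b (fun w => w⁻¹) := by
  refine ⟨fun w h3 h4 => differentiableAt_inv (by rintro rfl; simp at h3; linarith), a⁻¹, 0, by positivity, le_rfl, fun w h3 h4 => ?_⟩
  rw [norm_inv]
  simp
  gcongr
  exact h3.trans ((le_abs_self _).trans (Complex.abs_re_le_norm w))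

lemma Nice.dslope {a b : ℝ} {F : ℂ → ℂ} (h : Nice a b F) (hF : DifferentiableOn ℂ F {w | a < w.re ∧ w.re < b}) (ha : a < 0) (hb : 0 < b) :
    Nice a b (dslope F 0) := by
  obtain ⟨h1, C, B, hC, hB, h2⟩ := h
  have ho : IsOpen {w : ℂ | a < w.re ∧ w.re < b} :=
    (isOpen_lt continuous_const Complex.continuous_re).inter (isOpen_lt Complex.continuous_re continuous_const)
  have h0 : (0:ℂ) ∈ {w : ℂ | a < w.re ∧ w.re < b} := ⟨by simpa, by simpa⟩
  have hd : ∀ w : ℂ, a ≤ w.re → w.re ≤ b → DifferentiableAt ℂ (_root_.dslope F 0) w := by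
    intro w h3 h4
    by_cases hw : w = 0
    · subst hw
      exact ((Complex.differentiableOn_dslope (ho.mem_nhds h0)).2 hF).differentiableAt (ho.mem_nhds h0)
    · exact (differentiableAt_dslope_of_ne hw).2 (h1 w h3 h4)
  refine ⟨hd, ?_⟩
  -- bounded on a small ball
  obtain ⟨K, hK⟩ : ∃ K, ∀ w ∈ {w : ℂ | ‖w‖ ≤ min (-a) b}, ‖_root_.dslope F 0 w‖ ≤ K := by
    have hc : IsCompact {w : ℂ | ‖w‖ ≤ min (-a) b} := by
      have : {w : ℂ | ‖w‖ ≤ min (-a) b} = Metric.closedBall 0 (min (-a) b) := by ext; simp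
      rw [this]; exact isCompact_closedBall _ _
    refine hc.exists_bound_of_continuousOn fun w hw => (hd w ?_ ?_).continuousAt.continuousWithinAt
    · have := (abs_le.1 (Complex.abs_re_le_norm w)).1
      have := le_trans (show ‖w‖ ≤ min (-a) b from hw) (min_le_left _ _); linarith
    · have := (abs_le.1 (Complex.abs_re_le_norm w)).2
      have := le_trans (show ‖w‖ ≤ min (-a) b from hw) (min_le_right _ _); linarith
  set r := min (-a) b with hr
  have hr0 : 0 < r := lt_min (by linarith) hb
  refine ⟨|K| + (C + ‖F 0‖) / r, B, by positivity, hB, fun w h3 h4 => ?_⟩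
  have e1 : (1:ℝ) ≤ Real.exp (B * |w.im|) := Real.one_le_exp (by positivity)
  by_cases hw : ‖w‖ ≤ r
  · calc _ ≤ K := hK w hw
      _ ≤ |K| * 1 := by rw [mul_one]; exact le_abs_self _
      _ ≤ _ := by gcongr; linarith [show 0 ≤ (C + ‖F 0‖) / r by positivity]
  · push Not at hw
    have hw0 : w ≠ 0 := by rintro rfl; simp at hw; linarith
    rw [dslope_of_ne _ hw0, slope_def_module, norm_smul, sub_zero, norm_inv]
    calc ‖w‖⁻¹ * ‖F w - F 0‖ ≤ r⁻¹ * (C * Real.exp (B * |w.im|) + ‖F 0‖ * Real.exp (B * |w.im|)) := by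
          gcongr
          refine (norm_sub_le _ _).trans (add_le_add (h2 w h3 h4) ?_)
          exact le_mul_of_one_le_right (norm_nonneg _) e1
      _ = (C + ‖F 0‖) / r * Real.exp (B * |w.im|) := by ring
      _ ≤ _ := by gcongr; linarith [abs_nonneg K]

lemma norm_gauss {Λ : ℝ} (c v : ℝ) : ‖Complex.exp ((c + v * Complex.I) ^ 2 / (4 * Λ))‖ = Real.exp (c^2/(4*Λ)) * Real.exp (- v^2/(4*Λ)) := by
  rw [Complex.norm_exp, ← Real.exp_add]
  congr 1
  have : ((c + v * Complex.I) ^ 2 / (4 * Λ) : ℂ) = ((c^2/(4*Λ) + -v^2/(4*Λ) : ℝ) : ℂ) + ((2*c*v/(4*Λ) : ℝ) : ℂ) * Complex.I := by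
    push_cast
    have : (c + v * Complex.I : ℂ)^2 = c^2 - v^2 + 2*c*v*Complex.I := by
      ring_nf; rw [Complex.I_sq]; ring
    rw [this]; ring
  rw [this, Complex.add_re, Complex.ofReal_re, Complex.re_ofReal_mul]; simp

lemma Nice.bound {a b Λ : ℝ} (hΛ : 0 < Λ) {F : ℂ → ℂ} (h : Nice a b F) : ∃ K, 0 ≤ K ∧ ∀ c v : ℝ, a ≤ c → c ≤ b →
    ‖F (c + v * Complex.I) * Complex.exp ((c + v * Complex.I) ^ 2 / (4 * Λ))‖ ≤ K * Real.exp (-(1/(8*Λ)) * v^2) := by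
  obtain ⟨h1, C, B, hC, hB, h2⟩ := h
  refine ⟨C * Real.exp (2*Λ*B^2) * Real.exp ((|a|+|b|)^2/(4*Λ)), by positivity, fun c v h3 h4 => ?_⟩
  rw [norm_mul, norm_gauss]
  have := h2 (c + v * Complex.I) (by simpa) (by simpa)
  simp only [Complex.add_im, Complex.ofReal_im, Complex.mul_im, Complex.ofReal_re, Complex.I_im, Complex.I_re, mul_one, mul_zero, zero_add, add_zero] at this
  have h5 : |c| ≤ |a| + |b| := by
    rw [abs_le]; constructor
    · linarith [neg_abs_le a, abs_nonneg b]
    · linarith [le_abs_self b, abs_nonneg a]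
  have h6 : c^2 ≤ (|a|+|b|)^2 := by rw [← sq_abs c]; gcongr
  calc _ ≤ (C * Real.exp (B * |v|)) * (Real.exp ((|a|+|b|)^2/(4*Λ)) * Real.exp (-v^2/(4*Λ))) := by gcongr
    _ = C * Real.exp ((|a|+|b|)^2/(4*Λ)) * Real.exp (B * |v| + -v^2/(4*Λ)) := by rw [Real.exp_add]; ring
    _ ≤ C * Real.exp ((|a|+|b|)^2/(4*Λ)) * Real.exp (2*Λ*B^2 + -(1/(8*Λ)) * v^2) := by
        refine mul_le_mul_of_nonneg_left (Real.exp_le_exp.2 ?_) (by positivity)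
        have h7 : 0 ≤ (|v| - 4*Λ*B)^2/(8*Λ) := by positivity
        have h8 : (|v| - 4*Λ*B)^2/(8*Λ) = v^2/(8*Λ) - B*|v| + 2*Λ*B^2 := by
          rw [← sq_abs v]; field_simp; ring
        have h9 : -v^2/(4*Λ) = -(1/(8*Λ))*v^2 - v^2/(8*Λ) := by field_simp; ring
        linarith
    _ = _ := by rw [Real.exp_add]; ring

lemma Nice.cont {a b c : ℝ} {F : ℂ → ℂ} (h : Nice a b F) (h3 : a ≤ c) (h4 : c ≤ b) : Continuous (fun v : ℝ => F (c + v * Complex.I)) := by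
  rw [continuous_iff_continuousAt]
  intro v
  have : ContinuousAt F (c + v * Complex.I) := (h.1 _ (by simpa) (by simpa)).continuousAt
  exact this.comp (f := fun v : ℝ => (c + v * Complex.I : ℂ)) (by fun_prop)

lemma Nice.integrable {a b c Λ : ℝ} (hΛ : 0 < Λ) {F : ℂ → ℂ} (h : Nice a b F) (h3 : a ≤ c) (h4 : c ≤ b) :
    MeasureTheory.Integrable (fun v : ℝ => F (c + v * Complex.I) * Complex.exp ((c + v * Complex.I) ^ 2 / (4 * Λ))) := by
  obtain ⟨K, hK, hb⟩ := h.bound hΛ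
  have hg : MeasureTheory.Integrable (fun v : ℝ => K * Real.exp (-(1/(8*Λ)) * v^2)) :=
    (integrable_exp_neg_mul_sq (by positivity)).const_mul K
  refine hg.mono' ?_ (Eventually.of_forall fun v => hb c v h3 h4)
  exact ((h.cont h3 h4).mul (by fun_prop)).aestronglyMeasurable

theorem Nice.shiftJ {a b Λ : ℝ} (hΛ : 0 < Λ) (hab : a ≤ b) {F : ℂ → ℂ} (h : Nice a b F) : JJ Λ F a = JJ Λ F b := by
  obtain ⟨K, hK, hb⟩ := h.bound hΛ
  set G : ℂ → ℂ := fun w => F w * Complex.exp (w ^ 2 / (4 * Λ)) with hG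
  have hrect : ∀ R : ℝ, (Complex.I • ∫ y in (-R)..R, G (b + y * Complex.I)) - Complex.I • ∫ y in (-R)..R, G (a + y * Complex.I)
      = (∫ x in a..b, G (x + R * Complex.I)) - ∫ x in a..b, G (x + (-R : ℝ) * Complex.I) := by
    intro R
    have := Complex.integral_boundary_rect_eq_zero_of_differentiableOn G (a + (-R:ℝ) * Complex.I) (b + R * Complex.I) ?_
    · simp at this
      simp
      linear_combination this
    · intro w hw
      have hw1 : a ≤ w.re ∧ w.re ≤ b := by
        have := hw.1; simp [Set.uIcc_of_le hab] at this; exact this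
      exact ((h.1 w hw1.1 hw1.2).mul (by fun_prop)).differentiableWithinAt
  have hlim : ∀ c, a ≤ c → c ≤ b → Tendsto (fun R : ℝ => ∫ y in (-R)..R, G (c + y * Complex.I)) atTop (𝓝 (JJ Λ F c)) := by
    intro c h3 h4
    exact MeasureTheory.intervalIntegral_tendsto_integral (h.integrable hΛ h3 h4) tendsto_neg_atTop_atBot tendsto_id
  have hz : Tendsto (fun R : ℝ => K * Real.exp (-(1/(8*Λ)) * R^2) * |b - a|) atTop (𝓝 0) := by
    have t1 : Tendsto (fun R : ℝ => (1/(8*Λ)) * R^2) atTop atTop :=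
      (tendsto_pow_atTop (by norm_num)).const_mul_atTop (by positivity)
    have := (Real.tendsto_exp_neg_atTop_nhds_zero.comp t1)
    have := (this.const_mul K).mul_const |b - a|
    simpa [Function.comp_def] using this
  have hside : ∀ R : ℝ, ‖∫ x in a..b, G (x + R * Complex.I)‖ ≤ K * Real.exp (-(1/(8*Λ)) * R^2) * |b - a| := by
    intro R
    refine intervalIntegral.norm_integral_le_of_norm_le_const fun x hx => ?_
    rw [Set.uIoc_of_le hab] at hx
    exact hb x R hx.1.le hx.2
  have l1 : Tendsto (fun R : ℝ => ∫ x in a..b, G (x + R * Complex.I)) atTop (𝓝 0) :=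
    squeeze_zero_norm hside hz
  have l2 : Tendsto (fun R : ℝ => ∫ x in a..b, G (x + (-R:ℝ) * Complex.I)) atTop (𝓝 0) :=
    squeeze_zero_norm (fun R => by simpa using hside (-R)) hz
  have l3 := ((hlim b hab le_rfl).const_smul Complex.I).sub ((hlim a le_rfl hab).const_smul Complex.I)
  have l4 := l1.sub l2
  simp only [← hrect] at l4
  have := tendsto_nhds_unique l3 l4
  simp only [smul_eq_mul, sub_zero, ← mul_sub] at this
  have h5 := (mul_eq_zero.1 this).resolve_left Complex.I_ne_zero
  exact (sub_eq_zero.1 h5).symm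
end

section
open Filter Topology

lemma char_partial {p : ℕ} [NeZero p] (χ : DirichletCharacter ℂ p) (hχ : χ ≠ 1) (n : ℕ) :
    ‖∑ k ∈ Finset.range n, χ (k : ZMod p)‖ ≤ p := by
  have hsum : ∑ k ∈ Finset.range p, χ (k : ZMod p) = 0 := by
    rw [← MulChar.sum_eq_zero_of_ne_one hχ]
    refine Finset.sum_bij (fun a _ => (a : ZMod p)) (fun _ _ => Finset.mem_univ _) ?_ ?_ ?_
    · intro a ha b hb h
      rw [ZMod.natCast_eq_natCast_iff] at h
      exact Nat.ModEq.eq_of_lt_of_lt h (Finset.mem_range.1 ha) (Finset.mem_range.1 hb)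
    · intro b _
      exact ⟨b.val, Finset.mem_range.2 (ZMod.val_lt b), by simp⟩
    · intro a _; rfl
  induction n using Nat.strong_induction_on with
  | _ n ih =>
    by_cases hn : n < p
    · refine (norm_sum_le _ _).trans ?_
      calc _ ≤ ∑ k ∈ Finset.range n, (1:ℝ) := Finset.sum_le_sum fun k _ => DirichletCharacter.norm_le_one χ _
        _ = n := by simp
        _ ≤ p := by exact_mod_cast hn.le
    · obtain ⟨m, rfl⟩ := Nat.exists_eq_add_of_le (not_lt.1 hn)
      rw [Finset.sum_range_add, hsum, zero_add]
      simp only [Nat.cast_add, ZMod.natCast_self, zero_add]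
      exact ih m (by have := NeZero.pos p; omega)

lemma char_partial' {p : ℕ} [NeZero p] (χ : DirichletCharacter ℂ p) (hχ : χ ≠ 1) (n : ℕ) :
    ‖∑ k ∈ Finset.Icc 1 n, χ (k : ZMod p)‖ ≤ p + 1 := by
  have : ∑ k ∈ Finset.Icc 1 n, χ (k : ZMod p) = ∑ k ∈ Finset.range (n+1), χ (k : ZMod p) - χ ((0:ℕ) : ZMod p) := by
    rw [Finset.range_eq_Ico, Finset.sum_eq_sum_Ico_succ_bot (Nat.succ_pos n), add_sub_cancel_left]
    rfl
  rw [this]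
  refine (norm_sub_le _ _).trans (add_le_add (char_partial χ hχ _) (DirichletCharacter.norm_le_one χ _))

lemma L_right {p : ℕ} (hp : p.Prime) (χ : DirichletCharacter ℂ p) (hχ : χ ≠ 1) :
    ∃ C : ℝ, 0 ≤ C ∧ ∀ u : ℂ, 1/4 ≤ u.re → ‖Lfun χ u‖ ≤ C * ‖u‖ := by
  have : NeZero p := ⟨hp.ne_zero⟩
  set S : ℝ → ℂ := fun t => ∑ k ∈ Finset.Icc 1 ⌊t⌋₊, χ (k : ZMod p) with hS
  have hSb : ∀ t, ‖S t‖ ≤ p + 1 := fun t => char_partial' χ hχ _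
  have hS0 : ∀ t, t < 1 → S t = 0 := by
    intro t ht; simp only [hS]; rw [Nat.floor_eq_zero.2 ht]; simp
  have hmeas : Measurable S := by
    have : S = (fun n : ℕ => ∑ k ∈ Finset.Icc 1 n, χ (k : ZMod p)) ∘ (fun t : ℝ => ⌊t⌋₊) := rfl
    rw [this]
    exact (measurable_from_nat).comp Nat.measurable_floor
  have hloc : MeasureTheory.LocallyIntegrableOn S (Set.Ioi 0) := by
    have h1 : MeasureTheory.LocallyIntegrable (fun _ : ℝ => ((p:ℝ) + 1)) := MeasureTheory.locallyIntegrable_const _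
    exact (h1.mono hmeas.aestronglyMeasurable (Eventually.of_forall fun t => (hSb t).trans (le_abs_self _))).locallyIntegrableOn _
  have htop : S =O[atTop] (fun x : ℝ => x ^ (-(0:ℝ))) := by
    refine Asymptotics.IsBigO.of_bound (p+1) (Eventually.of_forall fun t => ?_)
    simpa using hSb t
  have hbot : ∀ b : ℝ, S =O[𝓝[>] 0] (fun x : ℝ => x ^ (-b)) := by
    intro b
    refine Asymptotics.IsBigO.of_bound 1 ?_
    have : ∀ᶠ t : ℝ in 𝓝[>] 0, t < 1 := nhdsWithin_le_nhds (Iio_mem_nhds one_pos)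
    filter_upwards [this] with t ht
    rw [hS0 t ht]; simp
  have hmd : ∀ u : ℂ, 0 < u.re → DifferentiableAt ℂ (fun u => u * mellin S (-u)) u := by
    intro u hu
    have : DifferentiableAt ℂ (mellin S) (-u) :=
      mellin_differentiableAt_of_isBigO_rpow (a := 0) (b := -u.re - 1) hloc htop (by simpa) (hbot _) (by simp)
    exact differentiableAt_id.mul (this.comp u differentiableAt_id.neg)
  have hmell : ∀ u : ℂ, mellin S (-u) = ∫ t in Set.Ioi (1:ℝ), S t * (t:ℂ) ^ (-(u + 1)) := by
    intro u
    rw [mellin]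
    have : Set.Ioi (0:ℝ) = Set.Ioc 0 1 ∪ Set.Ioi 1 := (Set.Ioc_union_Ioi_eq_Ioi (by norm_num)).symm
    have h0 : ∀ t ∈ Set.Ioi (0:ℝ) \ Set.Ici 1, (t:ℂ) ^ (-u - 1) • S t = 0 := by
      intro t ht
      rw [hS0 t (not_le.1 ht.2)]; simp
    have h9 := MeasureTheory.setIntegral_eq_of_subset_of_forall_sdiff_eq_zero (μ := MeasureTheory.volume) measurableSet_Ioi (Set.Ici_subset_Ioi.2 one_pos) h0
    rw [h9, MeasureTheory.integral_Ici_eq_integral_Ioi]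
    refine MeasureTheory.setIntegral_congr_fun measurableSet_Ioi fun t _ => ?_
    simp only [smul_eq_mul]
    rw [show -u - 1 = -(u+1) by ring, mul_comm]
  have hL : ∀ u, Lfun χ u = DirichletCharacter.LFunction χ u := by
    intro u; simp [Lfun, hp.ne_zero]
  have heq : ∀ u : ℂ, 0 < u.re → DirichletCharacter.LFunction χ u = u * mellin S (-u) := by
    have ho : IsOpen {u : ℂ | 0 < u.re} := isOpen_lt continuous_const Complex.continuous_re
    have a1 : AnalyticOnNhd ℂ (DirichletCharacter.LFunction χ) {u : ℂ | 0 < u.re} :=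
      (DirichletCharacter.differentiable_LFunction hχ).differentiableOn.analyticOnNhd ho
    have a2 : AnalyticOnNhd ℂ (fun u => u * mellin S (-u)) {u : ℂ | 0 < u.re} :=
      DifferentiableOn.analyticOnNhd (fun u hu => (hmd u hu).differentiableWithinAt) ho
    have hconv : IsPreconnected {u : ℂ | 0 < u.re} := (convex_halfSpace_re_gt 0).isPreconnected
    refine fun u hu => a1.eqOn_of_preconnected_of_eventuallyEq a2 hconv (z₀ := 2) (by simp) ?_ hu
    have : ∀ᶠ u : ℂ in 𝓝 2, 1 < u.re := (isOpen_lt continuous_const Complex.continuous_re).mem_nhds (by simp)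
    filter_upwards [this] with v hv
    rw [DirichletCharacter.LFunction_eq_LSeries χ hv, hmell]
    exact LSeries_eq_mul_integral (r := 0) _ le_rfl (by linarith) (DirichletCharacter.LSeriesSummable_of_one_lt_re χ hv) (by
      refine Asymptotics.IsBigO.of_bound (p+1) (Eventually.of_forall fun n => ?_)
      simpa using char_partial' χ hχ n)
  refine ⟨(p+1) * 4, by positivity, fun u hu => ?_⟩
  rw [hL, heq u (by linarith), hmell, norm_mul, mul_comm]
  gcongr
  have hIntg : MeasureTheory.IntegrableOn (fun t : ℝ => t ^ (-(5/4):ℝ)) (Set.Ioi 1) := integrableOn_Ioi_rpow_of_lt (by norm_num) one_pos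
  calc _ ≤ ∫ t in Set.Ioi (1:ℝ), ((p:ℝ)+1) * t ^ (-(5/4):ℝ) := by
        refine MeasureTheory.norm_integral_le_of_norm_le (hIntg.const_mul _) ?_
        filter_upwards [MeasureTheory.ae_restrict_mem measurableSet_Ioi] with t ht
        rw [norm_mul, Complex.norm_cpow_eq_rpow_re_of_pos (lt_trans one_pos ht)]
        have ht1 : (1:ℝ) ≤ t := le_of_lt ht
        refine mul_le_mul (hSb t) (Real.rpow_le_rpow_of_exponent_le ht1 ?_) (by positivity) (by positivity)
        simp; linarith
    _ = (p+1)*4 := by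
        rw [MeasureTheory.integral_const_mul, integral_Ioi_rpow_of_lt (by norm_num) one_pos]
        norm_num

lemma norm_Gamma_le {z : ℂ} (hz : 0 < z.re) : ‖Complex.Gamma z‖ ≤ Real.Gamma z.re := by
  rw [Complex.Gamma_eq_integral hz, Real.Gamma_eq_integral hz, Complex.GammaIntegral]
  refine MeasureTheory.norm_integral_le_of_norm_le (Real.GammaIntegral_convergent hz) ?_
  filter_upwards [MeasureTheory.ae_restrict_mem measurableSet_Ioi] with t ht
  rw [norm_mul, Complex.norm_cpow_eq_rpow_re_of_pos ht, Complex.norm_real, Real.norm_eq_abs, Real.abs_exp]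
  simp

lemma Nice.id {a b : ℝ} : Nice a b (fun w => w) := by
  refine ⟨fun w _ _ => differentiableAt_id, |a| + |b| + 1, 1, by positivity, by norm_num, fun w h3 h4 => ?_⟩
  have h5 : |w.re| ≤ |a| + |b| := by
    rw [abs_le]; constructor
    · linarith [neg_abs_le a, abs_nonneg b]
    · linarith [le_abs_self b, abs_nonneg a]
  have := Complex.norm_le_abs_re_add_abs_im w
  have h6 := Real.add_one_le_exp |w.im|
  rw [one_mul]
  nlinarith [abs_nonneg a, abs_nonneg b, abs_nonneg w.im, abs_nonneg w.re]

lemma Nice.Gamma {a b : ℝ} (ha : 0 < a) : Nice a b Complex.Gamma := by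
  have hd : ∀ w : ℂ, a ≤ w.re → DifferentiableAt ℂ Complex.Gamma w := by
    intro w hw
    exact Complex.differentiableAt_Gamma w fun m hm => by
      rw [hm] at hw; simp at hw; linarith [(Nat.cast_nonneg m : (0:ℝ) ≤ m)]
  obtain ⟨K, hK⟩ : ∃ K, ∀ x ∈ Set.Icc a b, ‖Real.Gamma x‖ ≤ K :=
    isCompact_Icc.exists_bound_of_continuousOn fun x hx =>
      (Real.differentiableAt_Gamma fun m => by have := hx.1; linarith [(Nat.cast_nonneg m : (0:ℝ) ≤ m)]).continuousAt.continuousWithinAt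
  refine ⟨fun w h _ => hd w h, |K|, 0, abs_nonneg _, le_rfl, fun w h3 h4 => ?_⟩
  simp only [zero_mul, Real.exp_zero, mul_one]
  exact (norm_Gamma_le (by linarith)).trans ((le_abs_self _).trans ((hK _ ⟨h3, h4⟩).trans (le_abs_self _)))

lemma Nice.Zt {a b : ℝ} (hb : b < 1) (κ ε : ℂ) (lam : ℝ) : Nice a b (Zt κ ε lam) := by
  unfold _root_.Zt
  have g : Nice a b (fun u => Complex.Gamma (1 - u)) := by
    have h1 : Nice (1 - b) (1 - a) Complex.Gamma := Nice.Gamma (by linarith)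
    have h2 := Nice.shift (a := -b) (b := -a) (F := Complex.Gamma) 1 (h1.mono (le_of_eq (by simp; ring)) (le_of_eq (by simp; ring)))
    have := h2.neg_arg
    simpa [sub_eq_add_neg] using this
  have e1 : Nice a b (fun u => Complex.exp (u * lam)) := by
    simpa [mul_comm] using Nice.exp (a := a) (b := b) (lam : ℂ)
  have e2 : Nice a b (fun u => Complex.exp (-(Real.pi * Complex.I * u / 2))) := by
    have := Nice.exp (a := a) (b := b) (-(Real.pi * Complex.I / 2))
    convert this using 3; ring
  have e3 : Nice a b (fun u => Complex.exp (Real.pi * Complex.I * u)) := Nice.exp _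
  exact ((((Nice.const κ).mul e1).mul g).mul e2).mul ((Nice.const 1).add ((Nice.const ε).mul e3))

lemma prim_ne_one {p : ℕ} (hp : p.Prime) (ψ : DirichletCharacter ℂ p) (hψ : ψ.IsPrimitive) : ψ ≠ 1 := by
  rintro rfl
  have : NeZero p := ⟨hp.ne_zero⟩
  rw [DirichletCharacter.IsPrimitive, DirichletCharacter.conductor_one] at hψ
  exact hp.one_lt.ne hψ

lemma Lfun_diff {p : ℕ} (hp : p.Prime) (χ : DirichletCharacter ℂ p) (hχ : χ ≠ 1) : Differentiable ℂ (Lfun χ) := by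
  have : NeZero p := ⟨hp.ne_zero⟩
  have hL : Lfun χ = DirichletCharacter.LFunction χ := by
    ext u; simp [Lfun, hp.ne_zero]
  rw [hL]; exact DirichletCharacter.differentiable_LFunction hχ

lemma Nice.L_right {p : ℕ} (hp : p.Prime) (χ : DirichletCharacter ℂ p) (hχ : χ ≠ 1) {a b : ℝ} (ha : 1/4 ≤ a) : Nice a b (Lfun χ) := by
  obtain ⟨C, hC, h⟩ := _root_.L_right hp χ hχ
  obtain ⟨_, C', B, hC', hB, h'⟩ := Nice.id (a := a) (b := b)
  refine ⟨fun w _ _ => (Lfun_diff hp χ hχ) w, C * C', B, by positivity, hB, fun w h3 h4 => ?_⟩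
  refine (h w (by linarith)).trans ?_
  rw [mul_assoc]
  gcongr
  exact h' w h3 h4

lemma Nice.L {p : ℕ} (hp : p.Prime) (ψ : DirichletCharacter ℂ p) (hψ : ψ.IsPrimitive) {a b : ℝ} : Nice a b (Lfun ψ) := by
  have hne := prim_ne_one hp ψ hψ
  have hne' : ψ⁻¹ ≠ 1 := by simpa using hne
  have n1 : Nice (1/4) (max b 1) (Lfun ψ) := Nice.L_right hp ψ hne le_rfl
  obtain ⟨κ, ε, _, _, _, hfe⟩ := exists_Z hp ψ hψ
  have n2 : Nice (3/4) (max (1-a) 1) (Lfun ψ⁻¹) := Nice.L_right hp _ hne' (by norm_num)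
  have n3 : Nice a (1/4) (fun u => Lfun ψ⁻¹ (1 - u)) := by
    have h2 := Nice.shift (a := -(1/4)) (b := -a) (F := Lfun ψ⁻¹) 1 (n2.mono (by norm_num) (le_trans (le_of_eq (by simp; ring)) (le_max_left _ _)))
    have := h2.neg_arg
    simpa [sub_eq_add_neg] using this
  have n4 := (Nice.Zt (a := a) (b := 1/4) (by norm_num) κ ε (Real.log (2 * Real.pi / p))).mul n3
  obtain ⟨_, C, B, hC, hB, h1⟩ := n1
  obtain ⟨_, C', B', hC', hB', h2⟩ := n4
  refine ⟨fun w _ _ => (Lfun_diff hp ψ hne) w, C + C', B + B', by positivity, by positivity, fun w h3 h4 => ?_⟩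
  by_cases hw : w.re ≤ 1/4
  · rw [hfe w (by linarith)]
    refine (h2 w h3 hw).trans ?_
    gcongr <;> linarith
  · refine (h1 w (by linarith) (h4.trans (le_max_left _ _))).trans ?_
    gcongr <;> linarith
end

section
open Filter Topology

lemma gauss_inner {Λ : ℝ} (hΛ : 0 < Λ) (c u : ℝ) :
    ∫ v : ℝ, Complex.exp ((c + v * Complex.I) * u) * Complex.exp ((c + v * Complex.I) ^ 2 / (4 * Λ)) =
      ((Real.sqrt (4 * Real.pi * Λ) * Real.exp (-Λ * u^2) : ℝ) : ℂ) := by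
  have h := integral_cexp_quadratic (b := ((-(1/(4*Λ)) : ℝ) : ℂ)) (by rw [Complex.ofReal_re]; simpa using hΛ) (Complex.I * (u + c/(2*Λ))) (u * c + c^2/(4*Λ))
  have hΛ' : (Λ : ℂ) ≠ 0 := by exact_mod_cast hΛ.ne'
  have e1 : ∀ v : ℝ, Complex.exp ((c + v * Complex.I) * u) * Complex.exp ((c + v * Complex.I) ^ 2 / (4 * Λ)) =
      Complex.exp (((-(1/(4*Λ)) : ℝ) : ℂ) * v^2 + Complex.I * (u + c/(2*Λ)) * v + (u * c + c^2/(4*Λ))) := by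
    intro v
    rw [← Complex.exp_add]
    congr 1
    have : (c + v * Complex.I : ℂ)^2 = c^2 - v^2 + 2*c*v*Complex.I := by
      ring_nf; rw [Complex.I_sq]; ring
    rw [this]
    push_cast
    field_simp
    ring
  simp_rw [e1]
  rw [h]
  push_cast
  congr 1
  · rw [Real.sqrt_eq_rpow, Complex.ofReal_cpow (by positivity)]
    push_cast
    congr 1
    field_simp
  · congr 1
    rw [mul_pow, Complex.I_sq]
    field_simp
    ring

theorem mellin_g {D : ℕ} (hL : 0 < bigL D) {c X : ℝ} (hc : 0 < c) (hX : 0 < X) :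
    JJ (bigL D ^ 30) (fun w => (X:ℂ) ^ w * w⁻¹) c = ((2 * Real.pi * gfun D X : ℝ) : ℂ) := by
  set Λ := bigL D ^ 30 with hΛd
  have hΛ : 0 < Λ := by positivity
  set y := Real.log X with hy
  have hre : ∀ v : ℝ, 0 < ((c:ℂ) + v * Complex.I).re := by intro v; simpa
  have s1 : JJ Λ (fun w => (X:ℂ) ^ w * w⁻¹) c = ∫ v : ℝ, ∫ u in Set.Iic y, Complex.exp ((c + v * Complex.I) * u) * Complex.exp ((c + v * Complex.I) ^ 2 / (4 * Λ)) := by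
    rw [JJ]
    congr 1
    ext v
    rw [MeasureTheory.integral_mul_const, integral_exp_mul_complex_Iic (hre v), cpow_exp_aux hX, div_eq_mul_inv (Complex.exp _), mul_comm (Real.log X : ℂ)]
  have hIntg : MeasureTheory.Integrable (Function.uncurry fun (v u : ℝ) => Complex.exp ((c + v * Complex.I) * u) * Complex.exp ((c + v * Complex.I) ^ 2 / (4 * Λ))) (MeasureTheory.volume.prod (MeasureTheory.volume.restrict (Set.Iic y))) := by
    have g1 : MeasureTheory.Integrable (fun v : ℝ => Real.exp (c^2/(4*Λ)) * Real.exp (-(1/(4*Λ)) * v^2)) :=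
      (integrable_exp_neg_mul_sq (by positivity)).const_mul _
    have g2 : MeasureTheory.Integrable (fun u : ℝ => Real.exp (c * u)) (MeasureTheory.volume.restrict (Set.Iic y)) :=
      integrableOn_exp_mul_Iic hc y
    refine (g1.mul_prod g2).mono' ?_ (Eventually.of_forall ?_)
    · exact Continuous.aestronglyMeasurable (by unfold Function.uncurry; fun_prop)
    · rintro ⟨v, u⟩
      simp only [Function.uncurry]
      rw [norm_mul, norm_gauss, Complex.norm_exp, mul_comm]
      refine le_of_eq ?_
      congr 2
      · congr 1; ring
      · simp
  rw [s1, MeasureTheory.integral_integral_swap hIntg]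
  simp_rw [gauss_inner hΛ c]
  rw [integral_complex_ofReal]
  congr 1
  rw [MeasureTheory.integral_const_mul, gfun, MeasureTheory.integral_Iic_eq_integral_Iio]
  have hA : 0 < bigL D ^ 15 := by positivity
  have h2 := MeasureTheory.Measure.setIntegral_comp_smul_of_pos MeasureTheory.volume (fun u : ℝ => Real.exp (-u^2)) (Set.Iio y) hA
  rw [LinearOrderedField.smul_Iio hA] at h2
  simp only [smul_eq_mul, Module.finrank_self, pow_one] at h2
  have h3 : ∀ u : ℝ, -(bigL D ^ 15 * u)^2 = -Λ * u^2 := by intro u; rw [hΛd]; ring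
  simp_rw [h3] at h2
  rw [h2, Real.sqrt_mul (by positivity), Real.sqrt_mul (by positivity), hΛd, show bigL D ^ 30 = (bigL D ^ 15)^2 by ring, Real.sqrt_sq hA.le, show Real.sqrt 4 = 2 by rw [show (4:ℝ) = 2^2 by norm_num]; exact Real.sqrt_sq (by norm_num)]
  rw [neg_div, Real.rpow_neg Real.pi_pos.le, ← Real.sqrt_eq_rpow]
  have hpi : 0 < Real.sqrt Real.pi := Real.sqrt_pos.2 Real.pi_pos
  have : Real.pi = Real.sqrt Real.pi * Real.sqrt Real.pi := (Real.mul_self_sqrt Real.pi_pos.le).symm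
  field_simp
  rw [sq, ← this]

lemma JJ_norm_le {Λ B c : ℝ} (hΛ : 0 < Λ) (hB : 0 ≤ B) {F : ℂ → ℂ} (h : ∀ v : ℝ, ‖F (c + v * Complex.I)‖ ≤ B * Real.exp (v^2/(8*Λ))) :
    ‖JJ Λ F c‖ ≤ B * Real.exp (c^2/(4*Λ)) * Real.sqrt (8 * Real.pi * Λ) := by
  have hIntg : MeasureTheory.Integrable (fun v : ℝ => B * Real.exp (c^2/(4*Λ)) * Real.exp (-(1/(8*Λ)) * v^2)) :=
      (integrable_exp_neg_mul_sq (by positivity)).const_mul _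
  have := MeasureTheory.norm_integral_le_of_norm_le hIntg (f := fun v : ℝ => F (c + v * Complex.I) * Complex.exp ((c + v * Complex.I) ^ 2 / (4 * Λ))) (Eventually.of_forall fun v => by
    rw [norm_mul, norm_gauss]
    calc _ ≤ (B * Real.exp (v^2/(8*Λ))) * (Real.exp (c^2/(4*Λ)) * Real.exp (-v^2/(4*Λ))) := by gcongr; exact h v
      _ = B * Real.exp (c^2/(4*Λ)) * (Real.exp (v^2/(8*Λ)) * Real.exp (-v^2/(4*Λ))) := by ring
      _ = _ := by
        rw [← Real.exp_add]; congr 2; field_simp; ring)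
  rw [MeasureTheory.integral_const_mul, integral_gaussian] at this
  refine this.trans (le_of_eq ?_)
  congr 2
  field_simp

lemma gfun_nonneg (D : ℕ) (X : ℝ) : 0 ≤ gfun D X := by
  unfold gfun
  have : 0 ≤ ∫ u in Set.Iio (bigL D ^ 15 * Real.log X), Real.exp (-u ^ 2) := MeasureTheory.integral_nonneg fun u => (Real.exp_pos _).le
  positivity

lemma gfun_le {D : ℕ} (hL : 0 < bigL D) {c X : ℝ} (hc : 0 < c) (hX : 0 < X) :
    gfun D X ≤ X ^ c / c * Real.exp (c^2/(4*bigL D ^ 30)) * Real.sqrt (8 * Real.pi * bigL D ^ 30) := by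
  have h1 := mellin_g hL hc hX
  have h2 := JJ_norm_le (Λ := bigL D ^ 30) (B := X ^ c / c) (c := c) (F := fun w => (X:ℂ) ^ w * w⁻¹) (by positivity) (by positivity) (fun v => by
    rw [norm_mul, norm_inv, Complex.norm_cpow_eq_rpow_re_of_pos hX, div_eq_mul_inv]
    have h3 : c ≤ ‖(c + v * Complex.I : ℂ)‖ := by
      have := (le_abs_self _).trans (Complex.abs_re_le_norm (c + v * Complex.I : ℂ)); simpa using this
    have h4 : (1:ℝ) ≤ Real.exp (v^2/(8*bigL D ^ 30)) := Real.one_le_exp (by positivity)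
    simp only [Complex.add_re, Complex.ofReal_re, Complex.mul_re, Complex.I_re, mul_zero, Complex.ofReal_im, Complex.I_im, mul_one, sub_zero, add_zero]
    calc X ^ c * ‖(c + v * Complex.I : ℂ)‖⁻¹ ≤ X ^ c * c⁻¹ := by gcongr
      _ ≤ _ := le_mul_of_one_le_right (by positivity) h4)
  rw [h1, Complex.norm_real, Real.norm_eq_abs] at h2
  refine le_trans ?_ h2
  rw [abs_of_nonneg (by have := gfun_nonneg D X; positivity)]
  have := gfun_nonneg D X
  nlinarith [Real.pi_gt_three]
end

section
open Filter Topology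

def dpoly (c : ℕ → ℂ) (N : ℕ) (u : ℂ) : ℂ := ∑ n ∈ Finset.range N, c n * (n : ℂ) ^ (-u)

lemma JJ_congr {Λ c : ℝ} {F G : ℂ → ℂ} (h : ∀ v : ℝ, F (c + v * Complex.I) = G (c + v * Complex.I)) : JJ Λ F c = JJ Λ G c := by
  unfold JJ; simp_rw [h]

lemma JJ_add {Λ c : ℝ} (hΛ : 0 < Λ) {F G : ℂ → ℂ} (hF : Nice c c F) (hG : Nice c c G) :
    JJ Λ (fun w => F w + G w) c = JJ Λ F c + JJ Λ G c := by
  unfold JJ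
  rw [← MeasureTheory.integral_add (hF.integrable hΛ le_rfl le_rfl) (hG.integrable hΛ le_rfl le_rfl)]
  simp only [add_mul]

lemma JJ_const_mul {Λ c : ℝ} (k : ℂ) {F : ℂ → ℂ} : JJ Λ (fun w => k * F w) c = k * JJ Λ F c := by
  unfold JJ
  rw [← MeasureTheory.integral_const_mul]
  simp only [mul_assoc]

lemma JJ_sum {Λ c : ℝ} (hΛ : 0 < Λ) {ι : Type*} (s : Finset ι) {F : ι → ℂ → ℂ} (h : ∀ i ∈ s, Nice c c (F i)) :
    JJ Λ (fun w => ∑ i ∈ s, F i w) c = ∑ i ∈ s, JJ Λ (F i) c := by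
  unfold JJ
  rw [← MeasureTheory.integral_finsetSum s fun i hi => (h i hi).integrable hΛ le_rfl le_rfl]
  simp only [Finset.sum_mul]

lemma Nice.comp_sub {a b : ℝ} {F : ℂ → ℂ} (s : ℂ) (h : Nice (s.re - b) (s.re - a) F) : Nice a b (fun w => F (s - w)) := by
  have h2 := Nice.shift (a := -b) (b := -a) (F := F) s (h.mono (by linarith) (by linarith))
  have := h2.neg_arg
  simpa [sub_eq_add_neg] using this

lemma Nice.dpoly {a b : ℝ} (c : ℕ → ℂ) (hc : c 0 = 0) (N : ℕ) (s : ℂ) : Nice a b (fun w => dpoly c N (s + w)) := by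
  unfold _root_.dpoly
  refine Nice.sum _ fun n _ => ?_
  rcases Nat.eq_zero_or_pos n with rfl | hn
  · simpa [hc] using Nice.const 0
  · refine (Nice.const _).mul ?_
    have hn' : (0:ℝ) < n := by exact_mod_cast hn
    have := (Nice.const (a := a) (b := b) (((n:ℝ):ℂ) ^ (-s))).mul (Nice.exp (-(Real.log n : ℂ)))
    convert this using 2 with w
    rw [← Complex.ofReal_natCast, cpow_exp_aux hn', cpow_exp_aux hn', ← Complex.exp_add]
    congr 1; ring

lemma gfun_one {D : ℕ} : gfun D 1 = 1/2 := by
  unfold gfun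
  rw [Real.log_one, mul_zero]
  have h : ∫ u in Set.Iio (0:ℝ), Real.exp (-u^2) = Real.sqrt Real.pi / 2 := by
    have h1 := integral_gaussian_Ioi 1
    have h2 := integral_comp_neg_Ioi (0:ℝ) (fun u : ℝ => Real.exp (-u^2))
    rw [neg_zero, MeasureTheory.integral_Iic_eq_integral_Iio] at h2
    rw [← h2, ← div_one Real.pi, ← h1]
    simp
  rw [h, neg_div, Real.rpow_neg Real.pi_pos.le, ← Real.sqrt_eq_rpow]
  have hpi : 0 < Real.sqrt Real.pi := Real.sqrt_pos.2 Real.pi_pos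
  field_simp

lemma JJ_dpoly {D : ℕ} (hL : 0 < bigL D) (c : ℕ → ℂ) (hc : c 0 = 0) (N : ℕ) (s : ℂ) {A b : ℝ} (hA : 0 < A) (hb : 0 < b) :
    JJ (bigL D ^ 30) (fun w => dpoly c N (s + w) * (A:ℂ)^w * w⁻¹) b =
      2 * Real.pi * ∑ n ∈ Finset.range N, c n * (n:ℂ) ^ (-s) * ((gfun D (A / n) : ℝ) : ℂ) := by
  have hΛ : 0 < bigL D ^ 30 := by positivity
  have e : ∀ w, dpoly c N (s + w) * (A:ℂ)^w * w⁻¹ = ∑ n ∈ Finset.range N, c n * (n:ℂ)^(-s) * (((A / n : ℝ) : ℂ) ^ w * w⁻¹) := by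
    intro w
    rw [dpoly, Finset.sum_mul, Finset.sum_mul]
    refine Finset.sum_congr rfl fun n _ => ?_
    rcases Nat.eq_zero_or_pos n with rfl | hn
    · simp [hc]
    · have hn' : (0:ℝ) < n := by exact_mod_cast hn
      have : ((n:ℝ):ℂ) ^ (-(s+w)) * (A:ℂ)^w = ((n:ℝ):ℂ)^(-s) * ((A / n : ℝ) : ℂ)^w := by
        rw [cpow_exp_aux hn', cpow_exp_aux hn', cpow_exp_aux hA, cpow_exp_aux (div_pos hA hn'), ← Complex.exp_add, ← Complex.exp_add, Real.log_div hA.ne' hn'.ne']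
        congr 1; push_cast; ring
      rw [Complex.ofReal_natCast] at this
      linear_combination c n * w⁻¹ * this
  simp_rw [e]
  rw [JJ_sum hΛ, Finset.mul_sum]
  · refine Finset.sum_congr rfl fun n _ => ?_
    rcases Nat.eq_zero_or_pos n with rfl | hn
    · simp [hc, JJ]
    · have hn' : (0:ℝ) < n := by exact_mod_cast hn
      rw [JJ_const_mul, mellin_g hL hb (div_pos hA hn')]
      push_cast; ring
  · intro n _
    rcases Nat.eq_zero_or_pos n with rfl | hn
    · simpa [hc] using Nice.const 0
    · have hn' : (0:ℝ) < n := by exact_mod_cast hn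
      exact (Nice.const _).mul ((Nice.cpow (div_pos hA hn')).mul (Nice.inv hb))

lemma star_tsum (D : ℕ) (c : ℕ → ℂ) (hc : c 0 = 0) {A : ℝ} (hA : 0 < A) (s : ℂ) :
    ∑' n : ℕ, c n * (n:ℂ)^(-s) * ((gstar D (A / n) : ℝ) : ℂ) = ∑ n ∈ Finset.range ⌈2 * A⌉₊, c n * (n:ℂ)^(-s) * ((gfun D (A / n) : ℝ) : ℂ) := by
  rw [tsum_eq_sum (s := Finset.range ⌈2 * A⌉₊)]
  · refine Finset.sum_congr rfl fun n hn => ?_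
    rcases Nat.eq_zero_or_pos n with rfl | hn0
    · simp [hc]
    · have hn' : (0:ℝ) < n := by exact_mod_cast hn0
      have := Nat.lt_ceil.1 (Finset.mem_range.1 hn)
      rw [gstar, if_pos]
      rw [div_lt_div_iff₀ (by norm_num) hn']; linarith
  · intro n hn
    have h1 : 2 * A ≤ n := by
      by_contra h
      exact hn (Finset.mem_range.2 (Nat.lt_ceil.2 (not_le.1 h)))
    have hn' : (0:ℝ) < n := by linarith
    rw [gstar, if_neg]
    · simp
    · rw [not_lt, div_le_div_iff₀ hn' (by norm_num)]; linarith

lemma L_tail {p : ℕ} (hp : p.Prime) (χ : DirichletCharacter ℂ p) {N : ℕ} (hN : 1 ≤ N) {u : ℂ} (hu : 2 ≤ u.re) :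
    ‖Lfun χ u - dpoly (fun n => χ (n : ZMod p)) N u‖ ≤ 2 * (N:ℝ) ^ (2 - u.re) := by
  have : NeZero p := ⟨hp.ne_zero⟩
  have hL : Lfun χ u = DirichletCharacter.LFunction χ u := by simp [Lfun, hp.ne_zero]
  have hu0 : u ≠ 0 := by rintro rfl; simp at hu; linarith
  have hs := DirichletCharacter.LSeriesSummable_of_one_lt_re χ (s := u) (by linarith)
  have hterm : ∀ n, LSeries.term (fun n => χ (n : ZMod p)) u n = χ (n : ZMod p) * (n:ℂ)^(-u) := by
    intro n
    rcases Nat.eq_zero_or_pos n with rfl | hn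
    · simp [hu0]
    · rw [LSeries.term_of_ne_zero hn.ne', Complex.cpow_neg, div_eq_mul_inv]
  have hs2 : Summable (fun n : ℕ => χ (n : ZMod p) * (n:ℂ)^(-u)) := by
    have : Summable (LSeries.term (fun n => χ (n : ZMod p)) u) := hs
    rwa [funext hterm] at this
  have e : Lfun χ u - dpoly (fun n => χ (n : ZMod p)) N u = ∑' n : ℕ, χ ((n+N : ℕ) : ZMod p) * ((n+N : ℕ):ℂ)^(-u) := by
    rw [hL, DirichletCharacter.LFunction_eq_LSeries χ (by linarith), LSeries, funext hterm, ← hs2.sum_add_tsum_nat_add N, dpoly]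
    ring
  rw [e]
  have hz := hasSum_zeta_two
  have hz2 : Summable (fun n : ℕ => (1:ℝ)/((n+N : ℕ):ℝ)^2) := (summable_nat_add_iff (f := fun n : ℕ => (1:ℝ)/(n:ℝ)^2) N).2 hz.summable
  have hle : ∑' n : ℕ, (1:ℝ)/((n+N : ℕ):ℝ)^2 ≤ 2 := by
    have := hz.summable.sum_add_tsum_nat_add N
    rw [hz.tsum_eq] at this
    have h1 : 0 ≤ ∑ i ∈ Finset.range N, (1:ℝ)/(i:ℝ)^2 := Finset.sum_nonneg fun i _ => by positivity
    have h2 : Real.pi^2/6 ≤ 2 := by nlinarith [Real.pi_lt_d2, Real.pi_pos]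
    linarith
  have hN' : (1:ℝ) ≤ N := by exact_mod_cast hN
  calc _ ≤ ∑' n : ℕ, (N:ℝ)^(2 - u.re) * (1/((n+N : ℕ):ℝ)^2) := by
        refine tsum_of_norm_bounded (hz2.mul_left _).hasSum fun n => ?_
        rw [norm_mul]
        have hpos : 0 < n + N := by omega
        have hpos' : (0:ℝ) < ((n+N : ℕ):ℝ) := by exact_mod_cast hpos
        rw [Complex.norm_natCast_cpow_of_pos hpos, Complex.neg_re]
        calc _ ≤ 1 * ((n+N : ℕ):ℝ)^(-u.re) := by gcongr; exact DirichletCharacter.norm_le_one χ _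
          _ = ((n+N : ℕ):ℝ)^(2-u.re) * (1/((n+N : ℕ):ℝ)^2) := by
            rw [one_mul, show -u.re = (2-u.re) - (2:ℕ) by push_cast; ring, Real.rpow_sub_natCast hpos'.ne']; ring
          _ ≤ _ := by
            gcongr ?_ * _
            refine Real.rpow_le_rpow_of_nonpos (by linarith) ?_ (by linarith)
            push_cast; linarith [(Nat.cast_nonneg n : (0:ℝ) ≤ n)]
    _ = (N:ℝ)^(2 - u.re) * ∑' n : ℕ, (1/((n+N : ℕ):ℝ)^2) := tsum_mul_left
    _ ≤ _ := by rw [mul_comm]; gcongr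
end

section
open Filter Topology

def Qf (κ ε : ℂ) (lam : ℝ) (s : ℂ) (Y : ℝ) (w : ℂ) : ℂ := Zt κ ε lam (s - w) * (Y:ℂ) ^ (-w)

lemma Nice.Qf {a b : ℝ} (κ ε : ℂ) (lam : ℝ) (s : ℂ) {Y : ℝ} (hY : 0 < Y) (ha : s.re - 1 < a) : Nice a b (Qf κ ε lam s Y) := by
  unfold _root_.Qf
  refine (Nice.comp_sub s (Nice.Zt (by linarith) κ ε lam)).mul ?_
  simp only [cpow_exp_aux hY]
  have := Nice.exp (a := a) (b := b) (-(Real.log Y : ℂ))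
  convert this using 3; ring

lemma JJ_neg {Λ c : ℝ} (F : ℂ → ℂ) : JJ Λ F (-c) = JJ Λ (fun w => F (-w)) c := by
  unfold JJ
  rw [← MeasureTheory.integral_neg_eq_self]
  congr 1
  ext v
  have : (((-c : ℝ) : ℂ) + ((-v : ℝ) : ℂ) * Complex.I) = -(c + v * Complex.I) := by push_cast; ring
  rw [this, neg_sq]

lemma L_split {Λ A : ℝ} {D : ℕ} (hL : 0 < bigL D) (hΛ : Λ = bigL D ^ 30) (hA : 0 < A) {p : ℕ} (hp : p.Prime) (ψ : DirichletCharacter ℂ p) (hψ : ψ.IsPrimitive) (s : ℂ) :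
    2 * Real.pi * Lfun ψ s = JJ Λ (fun w => Lfun ψ (s + w) * (A:ℂ)^w * w⁻¹) 2 + JJ Λ (fun w => Lfun ψ (s - w) * (A:ℂ)^(-w) * w⁻¹) 2 := by
  have hΛ0 : 0 < Λ := by rw [hΛ]; positivity
  set F : ℂ → ℂ := fun w => Lfun ψ (s + w) * (A:ℂ)^w with hF
  have nF : ∀ a b, Nice a b F := fun a b => (Nice.shift s (Nice.L hp ψ hψ)).mul (Nice.cpow hA)
  have nH : Nice (-2) 2 (dslope F 0) := (nF _ _).dslope (fun w hw => ((nF w.re w.re).1 w le_rfl le_rfl).differentiableWithinAt) (by norm_num) (by norm_num)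
  have h1 := nH.shiftJ hΛ0 (by norm_num)
  rw [JJ_neg] at h1
  have hF0 : F 0 = Lfun ψ s := by simp [hF]
  have hne : ∀ v : ℝ, (((2:ℝ):ℂ) + v * Complex.I) ≠ 0 := by
    intro v h; have := congrArg Complex.re h; simp at this
  have ninv : Nice 2 2 (fun w : ℂ => w⁻¹) := Nice.inv (by norm_num)
  have e1 : JJ Λ (dslope F 0) 2 = JJ Λ (fun w => F w * w⁻¹) 2 + (-F 0) * JJ Λ (fun w => w⁻¹) 2 := by
    rw [← JJ_const_mul, ← JJ_add hΛ0 ((nF 2 2).mul ninv) ((Nice.const _).mul ninv)]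
    refine JJ_congr fun v => ?_
    rw [dslope_of_ne _ (hne v), slope_def_field]
    simp only [sub_zero]
    rw [div_eq_mul_inv]; ring
  have e2 : JJ Λ (fun w => dslope F 0 (-w)) 2 = (-1) * JJ Λ (fun w => F (-w) * w⁻¹) 2 + (F 0) * JJ Λ (fun w => w⁻¹) 2 := by
    rw [← JJ_const_mul, ← JJ_const_mul]
    have n' : Nice 2 2 (fun w => F (-w)) := (nF (-2) (-2)).neg_arg.mono (by norm_num) (by norm_num)
    rw [← JJ_add hΛ0 ((Nice.const _).mul (n'.mul ninv)) ((Nice.const _).mul ninv)]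
    refine JJ_congr fun v => ?_
    rw [dslope_of_ne _ (neg_ne_zero.2 (hne v)), slope_def_field]
    simp only [sub_zero]
    rw [div_eq_mul_inv, inv_neg]; ring
  have e3 : JJ Λ (fun w => w⁻¹) 2 = Real.pi := by
    have := mellin_g hL (c := 2) (X := 1) (by norm_num) one_pos
    rw [gfun_one, ← hΛ] at this
    simp only [Complex.ofReal_one, Complex.one_cpow, one_mul] at this
    rw [this]; push_cast; ring
  rw [e1, e2, e3, hF0] at h1
  have e4 : JJ Λ (fun w => F (-w) * w⁻¹) 2 = JJ Λ (fun w => Lfun ψ (s - w) * (A:ℂ)^(-w) * w⁻¹) 2 := by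
    simp only [hF, sub_eq_add_neg]
  rw [e4] at h1
  linear_combination h1

theorem exact_identity {D : ℕ} (hL : 0 < bigL D) {Λ A tt Y : ℝ} (hΛ : Λ = bigL D ^ 30) (hA : A = P4 D) (hA0 : 0 < A) (htt : tt = bigT D ^ 2) (htt0 : 0 < tt) (hY : Y = A * tt)
    {p : ℕ} (hp : p.Prime) (ψ : DirichletCharacter ℂ p) (hψ : ψ.IsPrimitive) {κ ε : ℂ} {lam : ℝ}
    (hZ : ∀ u : ℂ, 0 < u.re → u.re < 1 → Zfun ψ u = Zt κ ε lam u)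
    (hfe : ∀ u : ℂ, u.re < 1 → Lfun ψ u = Zt κ ε lam u * Lfun ψ⁻¹ (1 - u)) {s : ℂ} (hs : |s.re - 1/2| ≤ 1/8)
    {N3 : ℕ} (hN3 : ⌈2 * tt⌉₊ ≤ N3) :
    Lfun ψ s - Kfun D ψ s - Zfun ψ s * Nfun D ψ s =
      (2 * (Real.pi:ℂ))⁻¹ * (JJ Λ (fun w => (Lfun ψ (s + w) - dpoly (fun n => ψ (n : ZMod p)) ⌈2 * A⌉₊ (s + w)) * (A:ℂ)^w * w⁻¹) 2
        + JJ Λ (fun w => Qf κ ε lam s Y w * (tt:ℂ)^w * (Lfun ψ⁻¹ (1 - s + w) - dpoly (fun n => ψ⁻¹ (n : ZMod p)) N3 (1 - s + w)) * w⁻¹) 2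
        + JJ Λ (fun w => dslope (Qf κ ε lam s Y) 0 w * ((tt:ℂ)^w * dpoly (fun n => ψ⁻¹ (n : ZMod p)) N3 (1 - s + w))) (2 * s.re - 1))
      + Zfun ψ s * ∑ n ∈ Finset.Ico ⌈2 * tt⌉₊ N3, ψ⁻¹ (n : ZMod p) * (n:ℂ) ^ (-(1 - s)) * ((gfun D (tt / n) : ℝ) : ℂ) := by
  have hΛ0 : 0 < Λ := by rw [hΛ]; positivity
  have hY0 : 0 < Y := by rw [hY]; positivity
  obtain ⟨hs1, hs2⟩ := abs_le.1 hs
  have : Fact p.Prime := ⟨hp⟩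
  have hpsi0 : ψ ((0:ℕ) : ZMod p) = 0 := by rw [Nat.cast_zero]; exact ψ.map_zero' hp.ne_one
  have hpsi0' : ψ⁻¹ ((0:ℕ) : ZMod p) = 0 := by rw [Nat.cast_zero]; exact ψ⁻¹.map_zero' hp.ne_one
  have hne' : ψ⁻¹ ≠ 1 := by simpa using prim_ne_one hp ψ hψ
  have hne : ∀ v : ℝ, (((2:ℝ):ℂ) + v * Complex.I) ≠ 0 := by
    intro v h; have := congrArg Complex.re h; simp at this
  have ninv : Nice 2 2 (fun w : ℂ => w⁻¹) := Nice.inv (by norm_num)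
  -- K and N as finite sums
  have hK : Kfun D ψ s = ∑ n ∈ Finset.range ⌈2 * A⌉₊, ψ (n : ZMod p) * (n:ℂ)^(-s) * ((gfun D (A / n) : ℝ) : ℂ) := by
    rw [← star_tsum D (fun n => ψ (n : ZMod p)) hpsi0 hA0, Kfun, hA]
  have hN : Nfun D ψ s = ∑ n ∈ Finset.range ⌈2 * tt⌉₊, ψ⁻¹ (n : ZMod p) * (n:ℂ)^(-(1-s)) * ((gfun D (tt / n) : ℝ) : ℂ) := by
    rw [← star_tsum D (fun n => ψ⁻¹ (n : ZMod p)) hpsi0' htt0, Nfun, htt]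
    refine tsum_congr fun n => ?_
    rw [← MulChar.star_apply', neg_sub]; rfl
  set dA : ℂ → ℂ := fun u => dpoly (fun n => ψ (n : ZMod p)) ⌈2 * A⌉₊ u with hdA
  set d3 : ℂ → ℂ := fun u => dpoly (fun n => ψ⁻¹ (n : ZMod p)) N3 u with hd3
  set Q := Qf κ ε lam s Y with hQ
  have nQ : ∀ b, Nice (-1/4) b Q := fun b => Nice.Qf κ ε lam s hY0 (by linarith)
  have ndA : ∀ a b, Nice a b (fun w => dA (s + w)) := fun a b => Nice.dpoly _ hpsi0 _ s
  have nd3 : ∀ a b, Nice a b (fun w => d3 (1 - s + w)) := fun a b => Nice.dpoly _ hpsi0' _ (1 - s)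
  have nL : ∀ a b, Nice a b (fun w => Lfun ψ (s + w)) := fun a b => Nice.shift s (Nice.L hp ψ hψ)
  have nL3 : Nice 2 2 (fun w => Lfun ψ⁻¹ (1 - s + w)) := Nice.shift (1 - s) (Nice.L_right hp _ hne' (by simp; linarith))
  have ndQ : Nice (-1/4) 3 (dslope Q 0) := (nQ 3).dslope (fun w hw => ((nQ 3).1 w hw.1.le hw.2.le).differentiableWithinAt) (by norm_num) (by norm_num)
  have hQ0 : Q 0 = Zfun ψ s := by
    rw [hQ, Qf, hZ s (by linarith) (by linarith)]; simp
  have k1 : JJ Λ (fun w => Lfun ψ (s + w) * (A:ℂ)^w * w⁻¹) 2 = 2 * Real.pi * Kfun D ψ s + JJ Λ (fun w => (Lfun ψ (s + w) - dA (s + w)) * (A:ℂ)^w * w⁻¹) 2 := by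
    have := JJ_dpoly hL (fun n => ψ (n : ZMod p)) hpsi0 ⌈2 * A⌉₊ s hA0 (b := 2) (by norm_num)
    rw [hK, ← this, ← hΛ, ← JJ_add hΛ0 (((ndA 2 2).mul (Nice.cpow hA0)).mul ninv) ((((nL 2 2).sub (ndA 2 2)).mul (Nice.cpow hA0)).mul ninv)]
    refine JJ_congr fun v => ?_
    simp only [hdA]; ring
  have k2 : JJ Λ (fun w => Lfun ψ (s - w) * (A:ℂ)^(-w) * w⁻¹) 2 =
      JJ Λ (fun w => Q w * (tt:ℂ)^w * (Lfun ψ⁻¹ (1 - s + w) - d3 (1 - s + w)) * w⁻¹) 2 +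
      (JJ Λ (fun w => dslope Q 0 w * ((tt:ℂ)^w * d3 (1 - s + w))) 2 + JJ Λ (fun w => Q 0 * (d3 (1 - s + w) * (tt:ℂ)^w * w⁻¹)) 2) := by
    have n1 : Nice 2 2 (fun w => dslope Q 0 w * ((tt:ℂ)^w * d3 (1 - s + w))) := (ndQ.mono (by norm_num) (by norm_num)).mul ((Nice.cpow htt0).mul (nd3 2 2))
    have n2 : Nice 2 2 (fun w => Q 0 * (d3 (1 - s + w) * (tt:ℂ)^w * w⁻¹)) := (Nice.const _).mul (((nd3 2 2).mul (Nice.cpow htt0)).mul ninv)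
    rw [← JJ_add hΛ0 n1 n2, ← JJ_add hΛ0 (((((nQ 2).mono (by norm_num) le_rfl).mul (Nice.cpow htt0)).mul (nL3.sub (nd3 2 2))).mul ninv) (n1.add n2)]
    refine JJ_congr fun v => ?_
    set w : ℂ := ((2:ℝ):ℂ) + v * Complex.I with hw
    have hwre : w.re = 2 := by simp [hw]
    have hw0 : w ≠ 0 := hne v
    have f1 : Lfun ψ (s - w) * (A:ℂ)^(-w) = Q w * (tt:ℂ)^w * Lfun ψ⁻¹ (1 - s + w) := by
      rw [hfe (s - w) (by simp [hwre]; linarith), show 1 - (s - w) = 1 - s + w by ring, hQ, Qf]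
      have : (A:ℂ)^(-w) = (Y:ℂ)^(-w) * (tt:ℂ)^w := by
        rw [cpow_exp_aux hA0, cpow_exp_aux hY0, cpow_exp_aux htt0, ← Complex.exp_add, hY, Real.log_mul hA0.ne' htt0.ne']
        congr 1; push_cast; ring
      rw [this]; ring
    rw [f1, dslope_of_ne _ hw0, slope_def_field, sub_zero, div_eq_mul_inv]
    ring
  have k3 : JJ Λ (fun w => dslope Q 0 w * ((tt:ℂ)^w * d3 (1 - s + w))) 2 = JJ Λ (fun w => dslope Q 0 w * ((tt:ℂ)^w * d3 (1 - s + w))) (2 * s.re - 1) := by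
    symm
    exact Nice.shiftJ hΛ0 (by linarith) ((ndQ.mono (by linarith) (by norm_num)).mul ((Nice.cpow htt0).mul (nd3 _ _)))
  have k4 : JJ Λ (fun w => Q 0 * (d3 (1 - s + w) * (tt:ℂ)^w * w⁻¹)) 2 = 2 * Real.pi * (Zfun ψ s * Nfun D ψ s) + 2 * Real.pi * (Zfun ψ s * ∑ n ∈ Finset.Ico ⌈2 * tt⌉₊ N3, ψ⁻¹ (n : ZMod p) * (n:ℂ) ^ (-(1 - s)) * ((gfun D (tt / n) : ℝ) : ℂ)) := by
    have := JJ_dpoly hL (fun n => ψ⁻¹ (n : ZMod p)) hpsi0' N3 (1 - s) htt0 (b := 2) (by norm_num)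
    rw [JJ_const_mul, hΛ, hd3, this, hQ0, hN, ← Finset.sum_range_add_sum_Ico _ hN3]
    ring
  have h0 := L_split hL hΛ hA0 hp ψ hψ s
  rw [k1, k2, k3, k4] at h0
  have hpi : (Real.pi : ℂ) ≠ 0 := by exact_mod_cast Real.pi_ne_zero
  have hpi2 : (2 * Real.pi : ℂ) ≠ 0 := mul_ne_zero two_ne_zero hpi
  have h5 : Lfun ψ s = (2 * (Real.pi:ℂ))⁻¹ * (2 * Real.pi * Lfun ψ s) := (inv_mul_cancel_left₀ hpi2 _).symm
  rw [h5, h0]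
  simp only [hdA, hd3]
  field_simp
  ring
end

section
open Filter Topology

lemma arg_im_bound {z : ℂ} (h : 0 < z.re) : Real.pi / 2 * |z.im| - z.re ≤ z.im * z.arg := by
  have hz : 0 < ‖z‖ := norm_pos_iff.2 (re_pos_ne h)
  have hz0 : z ≠ 0 := re_pos_ne h
  have h1 : |z.arg| < Real.pi / 2 := Complex.abs_arg_lt_pi_div_two_iff.2 (Or.inl h)
  have hs : Real.sin z.arg = z.im / ‖z‖ := Complex.sin_arg z
  have hc : Real.cos z.arg = z.re / ‖z‖ := Complex.cos_arg hz0
  have him : z.im = ‖z‖ * Real.sin z.arg := by rw [hs]; field_simp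
  have hre : z.re = ‖z‖ * Real.cos z.arg := by rw [hc]; field_simp
  have key : ∀ θ : ℝ, 0 ≤ θ → θ < Real.pi / 2 → Real.pi / 2 * Real.sin θ - Real.cos θ ≤ Real.sin θ * θ := by
    intro θ h0 h2
    have hφ := Real.pi_div_two_pos
    rcases h0.eq_or_lt with rfl | h0
    · simp
    have ht := Real.lt_tan (x := Real.pi / 2 - θ) (by linarith) (by linarith)
    rw [Real.tan_pi_div_two_sub, ← one_div, Real.tan_eq_sin_div_cos] at ht
    have hsp : 0 < Real.sin θ := Real.sin_pos_of_pos_of_lt_pi h0 (by linarith)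
    have hcp : 0 < Real.cos θ := Real.cos_pos_of_mem_Ioo ⟨by linarith, by linarith⟩
    rw [one_div, inv_div, lt_div_iff₀ hsp] at ht
    linarith
  have hk := key |z.arg| (abs_nonneg _) h1
  rw [Real.cos_abs] at hk
  have e1 : |z.im| = ‖z‖ * Real.sin |z.arg| := by
    rcases le_total 0 z.arg with h0 | h0
    · rw [abs_of_nonneg h0, ← him, abs_of_nonneg]
      exact Complex.arg_nonneg_iff.1 h0
    · rw [abs_of_nonpos h0, Real.sin_neg, mul_neg, ← him, abs_of_nonpos]
      rw [him]
      exact mul_nonpos_of_nonneg_of_nonpos hz.le (Real.sin_nonpos_of_nonpos_of_neg_pi_le h0 (Complex.neg_pi_lt_arg z).le)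
  have e2 : z.im * z.arg = ‖z‖ * (Real.sin |z.arg| * |z.arg|) := by
    rcases le_total 0 z.arg with h0 | h0
    · rw [abs_of_nonneg h0]; nth_rw 1 [him]; ring
    · rw [abs_of_nonpos h0, Real.sin_neg]; nth_rw 1 [him]; ring
  rw [e1, e2]
  nlinarith [mul_le_mul_of_nonneg_left hk hz.le]

lemma Gamma_bd : ∃ C : ℝ, 0 < C ∧ ∀ z : ℂ, 1/4 ≤ z.re → z.re ≤ 3/4 → ‖Complex.Gamma z‖ ≤ C * ‖z‖ ^ (z.re - 1/2) * Real.exp (-(Real.pi / 2 * |z.im|)) := by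
  refine ⟨Real.sqrt (2 * Real.pi) * Real.exp 12, by positivity, fun z h1 h2 => ?_⟩
  have hz : 0 < z.re := by linarith
  have hn : 1/4 ≤ ‖z‖ := h1.trans (Complex.re_le_norm z)
  obtain ⟨E, hE, h⟩ := stirling hz hn
  have hE' : ‖E‖ ≤ 12 := hE.trans (by rw [div_le_iff₀ (by linarith)]; linarith)
  have hb := arg_im_bound hz
  rw [h, norm_mul, Complex.norm_exp, Complex.norm_real, Real.norm_of_nonneg (Real.sqrt_nonneg _), mul_assoc, mul_assoc]
  gcongr
  rw [Real.rpow_def_of_pos (by linarith), ← Real.exp_add, ← Real.exp_add, Real.exp_le_exp]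
  have : (GG z).re = (z.re - 1/2) * Real.log ‖z‖ - z.im * z.arg - z.re := by
    simp [GG, Complex.mul_re, Complex.log_re, Complex.log_im]
  rw [Complex.add_re, this]
  have := (Complex.re_le_norm E).trans hE'
  nlinarith

/-- the archimedean factor -/
def arch (ε u : ℂ) : ℂ := Complex.Gamma (1 - u) * Complex.exp (-(Real.pi * Complex.I * u / 2)) * (1 + ε * Complex.exp (Real.pi * Complex.I * u))

lemma trig_bd {ε : ℂ} (hε : ε = 1 ∨ ε = -1) (u : ℂ) : ‖Complex.exp (-(Real.pi * Complex.I * u / 2)) * (1 + ε * Complex.exp (Real.pi * Complex.I * u))‖ ≤ 2 * Real.exp (Real.pi / 2 * |u.im|) := by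
  have hε1 : ‖ε‖ = 1 := by rcases hε with rfl | rfl <;> simp
  rw [mul_add, mul_one]
  refine (norm_add_le _ _).trans ?_
  rw [mul_left_comm, ← Complex.exp_add, norm_mul, hε1, one_mul, Complex.norm_exp, Complex.norm_exp]
  have e1 : (-(Real.pi * Complex.I * u / 2)).re = Real.pi / 2 * u.im := by
    simp [Complex.mul_re, Complex.mul_im]; ring
  have e2 : (-(Real.pi * Complex.I * u / 2) + Real.pi * Complex.I * u).re = - (Real.pi / 2 * u.im) := by
    simp [Complex.mul_re, Complex.mul_im]; ring
  rw [e1, e2, two_mul]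
  have := Real.pi_pos
  gcongr
  · exact le_abs_self _
  · rw [← mul_neg]; gcongr; exact neg_le_abs _

lemma arch_bd : ∃ C : ℝ, 0 < C ∧ ∀ ε u : ℂ, (ε = 1 ∨ ε = -1) → 1/4 ≤ u.re → u.re ≤ 3/4 → ‖arch ε u‖ ≤ C * ‖1 - u‖ ^ (1/2 - u.re) := by
  obtain ⟨C, hC, h⟩ := Gamma_bd
  refine ⟨2 * C, by positivity, fun ε u hε h1 h2 => ?_⟩
  have hg := h (1 - u) (by simp; linarith) (by simp; linarith)
  have ht := trig_bd hε u
  rw [arch, mul_assoc, norm_mul]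
  refine (mul_le_mul hg ht (norm_nonneg _) (by positivity)).trans (le_of_eq ?_)
  simp only [Complex.sub_re, Complex.one_re, Complex.sub_im, Complex.one_im, zero_sub, abs_neg]
  rw [show (1 - u.re - 1/2) = 1/2 - u.re by ring]
  rw [Real.exp_neg]
  have := Real.exp_ne_zero (Real.pi / 2 * |u.im|)
  field_simp

lemma Zt_arch (κ ε : ℂ) (lam : ℝ) (u : ℂ) : Zt κ ε lam u = κ * Complex.exp (u * lam) * arch ε u := by
  rw [Zt, arch]; ring

lemma log_near {τ : ℝ} (hτ : 0 < τ) {ζ : ℂ} (h : ζ.im ≤ -τ) {r : ℝ} (hr : ‖ζ - (-(2 * Real.pi * τ : ℝ) * Complex.I)‖ ≤ r) :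
    ‖Complex.log ζ - (Real.log (2 * Real.pi * τ) - Real.pi / 2 * Complex.I)‖ ≤ r / τ := by
  set S : Set ℂ := {u : ℂ | u.im ≤ -τ} with hS
  have hcv : Convex ℝ S := convex_halfSpace_im_le _
  have hpi := Real.pi_gt_three
  have h0 : (-(2 * Real.pi * τ : ℝ) * Complex.I : ℂ) ∈ S := by
    simp [hS]; nlinarith
  have hd : ∀ u ∈ S, HasDerivWithinAt Complex.log u⁻¹ S u := fun u hu => by
    have hu' : u.im ≤ -τ := hu
    exact (Complex.hasDerivAt_log (Or.inr (by linarith : u.im < 0).ne)).hasDerivWithinAt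
  have hb : ∀ u ∈ S, ‖u⁻¹‖ ≤ 1 / τ := fun u hu => by
    have hu' : u.im ≤ -τ := hu
    rw [norm_inv, ← one_div]
    have := Complex.abs_im_le_norm u
    rw [abs_of_nonpos (by linarith)] at this
    exact one_div_le_one_div_of_le hτ (by linarith)
  have := hcv.norm_image_sub_le_of_norm_hasDerivWithin_le hd hb h0 h
  have e : Complex.log (-(2 * Real.pi * τ : ℝ) * Complex.I) = Real.log (2 * Real.pi * τ) - Real.pi / 2 * Complex.I := by
    rw [neg_mul, ← mul_neg, Complex.log_ofReal_mul (by positivity) (by simp), Complex.log_neg_I]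
    ring
  rw [e] at this
  refine this.trans ?_
  rw [one_div, inv_mul_eq_div]
  gcongr

lemma GG_near {τ r : ℝ} (hτ : 0 < τ) {z z' : ℂ} (h : z.im ≤ -τ) (h' : z'.im ≤ -τ)
    (hr : ‖z - (-(2 * Real.pi * τ : ℝ) * Complex.I)‖ ≤ r) (hr' : ‖z' - (-(2 * Real.pi * τ : ℝ) * Complex.I)‖ ≤ r) :
    ‖GG z' - GG z - (z' - z) * (Real.log (2 * Real.pi * τ) - Real.pi / 2 * Complex.I)‖ ≤ (r + 1) / τ * ‖z' - z‖ := by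
  set ζ0 : ℂ := (-(2 * Real.pi * τ : ℝ) * Complex.I) with hζ
  set l : ℂ := (Real.log (2 * Real.pi * τ) - Real.pi / 2 * Complex.I) with hl
  set S : Set ℂ := {u : ℂ | u.im ≤ -τ} ∩ Metric.closedBall ζ0 r with hS
  have hcv : Convex ℝ S := (convex_halfSpace_im_le _).inter (convex_closedBall _ _)
  have hd : ∀ u ∈ S, HasDerivWithinAt (fun u => GG u - u * l) (Complex.log u - 1/2 * u⁻¹ - l) S u := fun u hu => by
    have hu' : u.im ≤ -τ := hu.1
    have hsl : u ∈ Complex.slitPlane := Or.inr (by linarith : u.im < 0).ne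
    have hu0 : u ≠ 0 := Complex.slitPlane_ne_zero hsl
    have h1 : HasDerivAt (fun u => GG u - u * l) (1 * Complex.log u + (u - 1/2) * u⁻¹ - 1 - 1 * l) u :=
      (((((hasDerivAt_id u).sub_const _).mul (Complex.hasDerivAt_log hsl)).sub (hasDerivAt_id u)).sub ((hasDerivAt_id u).mul_const l))
    refine (h1.congr_deriv ?_).hasDerivWithinAt
    field_simp; ring
  have hb : ∀ u ∈ S, ‖Complex.log u - 1/2 * u⁻¹ - l‖ ≤ (r + 1) / τ := fun u hu => by
    have hu' : u.im ≤ -τ := hu.1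
    have h1 := log_near hτ hu' (r := r) (by have := hu.2; rwa [Metric.mem_closedBall, dist_eq_norm] at this)
    have h2 : ‖(1/2 : ℂ) * u⁻¹‖ ≤ 1 / τ := by
      rw [norm_mul, norm_inv]
      have := Complex.abs_im_le_norm u
      rw [abs_of_nonpos (by linarith)] at this
      have := one_div_le_one_div_of_le hτ (show τ ≤ ‖u‖ by linarith)
      rw [← one_div ‖u‖]
      norm_num
      rw [← one_div, ← one_div]
      have := one_div_pos.2 hτ
      linarith
    rw [show Complex.log u - 1/2 * u⁻¹ - l = (Complex.log u - l) - 1/2 * u⁻¹ by ring, add_div]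
    exact (norm_sub_le _ _).trans (add_le_add h1 h2)
  have := hcv.norm_image_sub_le_of_norm_hasDerivWithin_le hd hb (x := z) (y := z') ⟨h, by simpa [dist_eq_norm] using hr⟩ ⟨h', by simpa [dist_eq_norm] using hr'⟩
  refine le_of_eq_of_le (congrArg norm ?_) this
  ring
end

section
open Filter Topology

lemma Q_near {τ r e η lam Y : ℝ} {κ ε s w : ℂ} (hε : ε = 1 ∨ ε = -1) (hτ : 0 < τ) (hY : 0 < Y) (hlam : lam + Real.log Y = Real.log (2 * Real.pi * τ) - η)
    (hη : |η| ≤ e) (he1 : e ≤ 1) (hr1 : (r + 1) / τ ≤ e) (hτe : 24 / τ ≤ e) (hw : 1/4 ≤ ‖w‖) (hew : 3 * e * ‖w‖ ≤ 1)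
    (hz : 0 < (1 - s).re) (hz' : 0 < (1 - s + w).re) (hi : (1 - s).im ≤ -τ) (hi' : (1 - s + w).im ≤ -τ)
    (hr : ‖(1 - s) - (-(2 * Real.pi * τ : ℝ) * Complex.I)‖ ≤ r) (hr' : ‖(1 - s + w) - (-(2 * Real.pi * τ : ℝ) * Complex.I)‖ ≤ r) :
    ‖Qf κ ε lam s Y w - Qf κ ε lam s Y 0‖ ≤ 28 * e * ‖w‖ * ‖Qf κ ε lam s Y 0‖ := by
  have hε1 : ‖ε‖ = 1 := by rcases hε with rfl | rfl <;> simp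
  have he0 : 0 ≤ e := (abs_nonneg _).trans hη
  have hτ24 : 24 ≤ τ := by
    rw [div_le_iff₀ hτ] at hτe; nlinarith
  have nz : τ ≤ ‖1 - s‖ := by
    have := Complex.abs_im_le_norm (1 - s); rw [abs_of_nonpos (by linarith)] at this; linarith
  have nz' : τ ≤ ‖1 - s + w‖ := by
    have := Complex.abs_im_le_norm (1 - s + w); rw [abs_of_nonpos (by linarith)] at this; linarith
  obtain ⟨E, hE, hG⟩ := stirling hz (by linarith)
  obtain ⟨E', hE', hG'⟩ := stirling hz' (by linarith)
  have hEb : ‖E‖ ≤ 3 / τ := hE.trans (by gcongr)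
  have hEb' : ‖E'‖ ≤ 3 / τ := hE'.trans (by gcongr)
  have hgg := GG_near hτ hi hi' hr hr'
  set l : ℂ := (Real.log (2 * Real.pi * τ) - Real.pi / 2 * Complex.I) with hl
  set X := GG (1 - s + w) - GG (1 - s) - (1 - s + w - (1 - s)) * l with hX
  set δ : ℂ := w * η + X + E' - E with hδ
  set q := Complex.exp (Real.pi * Complex.I * s) with hq
  set q' := Complex.exp (Real.pi * Complex.I * (s - w)) with hq'
  set M : ℂ := κ * Complex.exp (s * lam) * (Real.sqrt (2 * Real.pi) * Complex.exp (GG (1 - s) + E)) * Complex.exp (-(Real.pi * Complex.I * s / 2)) with hM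
  have Q0 : Qf κ ε lam s Y 0 = M * (1 + ε * q) := by
    rw [Qf, Zt, sub_zero, hG, neg_zero, Complex.cpow_zero, mul_one, hM]
  have Qw : Qf κ ε lam s Y w = M * (Complex.exp δ * (1 + ε * q')) := by
    rw [Qf, Zt, show 1 - (s - w) = 1 - s + w by ring, hG', cpow_exp_aux hY, hM]
    have : Complex.exp ((s - w) * lam) * Complex.exp (GG (1 - s + w) + E') * Complex.exp (-(Real.pi * Complex.I * (s - w) / 2)) * Complex.exp (Real.log Y * -w)
      = Complex.exp (s * lam) * Complex.exp (GG (1 - s) + E) * Complex.exp (-(Real.pi * Complex.I * s / 2)) * Complex.exp δ := by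
      simp only [← Complex.exp_add]
      congr 1
      have h1 : (Real.log Y : ℂ) = Real.log (2 * Real.pi * τ) - η - lam := by
        rw [eq_sub_of_add_eq' hlam]; push_cast; ring
      rw [h1, hδ, hX, hl]; ring
    linear_combination (κ * Real.sqrt (2 * Real.pi) * (1 + ε * q')) * this
  have hδb : ‖δ‖ ≤ 3 * e * ‖w‖ := by
    have h1 : ‖w * η‖ ≤ e * ‖w‖ := by rw [norm_mul, Complex.norm_real, Real.norm_eq_abs, mul_comm]; gcongr
    have h2 : ‖X‖ ≤ e * ‖w‖ := by
      rw [add_sub_cancel_left] at hgg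
      exact hgg.trans (by gcongr)
    have h3 : 3 / τ + 3 / τ ≤ e * ‖w‖ := by
      rw [← add_div]
      have : (3 + 3) / τ = 24 / τ * (1/4) := by ring
      rw [this]; gcongr
    calc ‖δ‖ ≤ ‖w * η‖ + ‖X‖ + ‖E'‖ + ‖E‖ := (norm_sub_le _ _).trans (by gcongr; exact (norm_add_le _ _).trans (by gcongr; exact norm_add_le _ _))
      _ ≤ _ := by linarith
  have hexp : ‖Complex.exp δ - 1‖ ≤ 2 * ‖δ‖ := Complex.norm_exp_sub_one_le (hδb.trans hew)
  have hqb : ∀ u : ℂ, τ ≤ u.im → ‖Complex.exp (Real.pi * Complex.I * u)‖ ≤ 1 / τ := by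
    intro u hu
    rw [Complex.norm_exp]
    have : (Real.pi * Complex.I * u).re = -(Real.pi * u.im) := by simp [Complex.mul_re, Complex.mul_im]
    rw [this, Real.exp_neg, ← one_div]
    apply one_div_le_one_div_of_le hτ
    have := Real.add_one_le_exp (Real.pi * u.im)
    have := Real.pi_gt_three
    nlinarith
  simp only [Complex.sub_im, Complex.one_im, Complex.add_im] at hi hi'
  have q1 : ‖q‖ ≤ 1 / τ := hqb s (by linarith)
  have q2 : ‖q'‖ ≤ 1 / τ := hqb (s - w) (by simp; linarith)
  have hτi : 1 / τ ≤ e * ‖w‖ / 6 := by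
    have : 1 / τ = 24 / τ * (1/4) / 6 := by ring
    rw [this]; gcongr
  have hτi2 : 1 / τ ≤ 1/2 := by apply one_div_le_one_div_of_le <;> linarith
  have hhalf : 1/2 ≤ ‖1 + ε * q‖ := by
    have := norm_sub_le (1 + ε * q) (ε * q)
    rw [add_sub_cancel_right, norm_mul, hε1, norm_one] at this
    linarith
  have hdiff : ‖Complex.exp δ * (1 + ε * q') - (1 + ε * q)‖ ≤ 14 * e * ‖w‖ := by
    have : Complex.exp δ * (1 + ε * q') - (1 + ε * q) = (Complex.exp δ - 1) * (1 + ε * q') + (ε * q' - ε * q) := by ring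
    rw [this]
    have a1 : ‖1 + ε * q'‖ ≤ 2 := (norm_add_le _ _).trans (by rw [norm_mul, hε1, norm_one]; linarith)
    have a2 : ‖ε * q' - ε * q‖ ≤ 2 * (1 / τ) := (norm_sub_le _ _).trans (by rw [norm_mul, norm_mul, hε1]; linarith)
    refine (norm_add_le _ _).trans ?_
    rw [norm_mul]
    have a3 : ‖Complex.exp δ - 1‖ * ‖1 + ε * q'‖ ≤ (6 * e * ‖w‖) * 2 := by
      apply mul_le_mul (by linarith) a1 (norm_nonneg _) (by positivity)
    nlinarith [mul_nonneg he0 (norm_nonneg w)]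
  rw [Qw, Q0, ← mul_sub, norm_mul M, norm_mul M]
  calc ‖M‖ * _ ≤ ‖M‖ * (14 * e * ‖w‖) := by gcongr
    _ = 28 * e * ‖w‖ * (‖M‖ * (1/2)) := by ring
    _ ≤ _ := by gcongr

lemma Q_slope {τ b V e η lam Y : ℝ} {κ ε s : ℂ} (hε : ε = 1 ∨ ε = -1) (hτ : 0 < τ) (hY : 0 < Y) (hlam : lam + Real.log Y = Real.log (2 * Real.pi * τ) - η)
    (hη : |η| ≤ e) (he1 : e ≤ 1) (hτe : 24 / τ ≤ e) (hs : |s.re - 1/2| ≤ 1/16) (hsi : |s.im - 2 * Real.pi * τ| ≤ b) (hV : 1/4 ≤ V)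
    (hr : b + V + 3 ≤ τ * e) (hV3 : 3 * e * (1 + V) ≤ 1) {w : ℂ} (hwr : |w.re| ≤ 1/4) (hwi : |w.im| ≤ V) :
    ‖dslope (Qf κ ε lam s Y) 0 w‖ ≤ 28 * e * ‖Qf κ ε lam s Y 0‖ := by
  have he0 : 0 ≤ e := (abs_nonneg _).trans hη
  have hpi := Real.pi_gt_three
  have main : ∀ w : ℂ, |w.re| ≤ 1/4 → |w.im| ≤ V → 1/4 ≤ ‖w‖ → ‖dslope (Qf κ ε lam s Y) 0 w‖ ≤ 28 * e * ‖Qf κ ε lam s Y 0‖ := by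
    intro w hwr hwi hw
    have hw0 : w ≠ 0 := by rintro rfl; norm_num at hw
    have hwn : ‖w‖ ≤ 1 + V := (Complex.norm_le_abs_re_add_abs_im w).trans (by linarith)
    obtain ⟨w1, w2⟩ := abs_le.1 hwr
    obtain ⟨w3, w4⟩ := abs_le.1 hwi
    obtain ⟨s1, s2⟩ := abs_le.1 hs
    obtain ⟨s3, s4⟩ := abs_le.1 hsi
    have hτe' : τ * e ≤ τ := by nlinarith
    have := Q_near (r := b + V + 2) (w := w) (κ := κ) (s := s) hε hτ hY hlam hη he1 (by rw [div_le_iff₀ hτ]; linarith) hτe hw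
      (le_trans (by gcongr) hV3) (by simp; linarith) (by simp; linarith) (by simp; nlinarith) (by simp; nlinarith)
      ((Complex.norm_le_abs_re_add_abs_im _).trans (by
        simp
        have : |1 - s.re| ≤ 1 := abs_le.2 ⟨by linarith, by linarith⟩
        have : |-s.im + 2 * Real.pi * τ| ≤ b := abs_le.2 ⟨by linarith, by linarith⟩
        linarith))
      ((Complex.norm_le_abs_re_add_abs_im _).trans (by
        simp
        have : |1 - s.re + w.re| ≤ 1 := abs_le.2 ⟨by linarith, by linarith⟩
        have : |-s.im + w.im + 2 * Real.pi * τ| ≤ b + V := abs_le.2 ⟨by linarith, by linarith⟩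
        linarith))
    rw [dslope_of_ne _ hw0, slope_def_field, sub_zero, norm_div, div_le_iff₀ (by linarith)]
    linarith
  rcases le_total (1/4) ‖w‖ with h | h
  · exact main w hwr hwi h
  have hopen : IsOpen {w : ℂ | s.re - 1 < w.re} := isOpen_lt continuous_const Complex.continuous_re
  obtain ⟨s1, s2⟩ := abs_le.1 hs
  have h0 : {w : ℂ | s.re - 1 < w.re} ∈ 𝓝 (0:ℂ) := hopen.mem_nhds (by simp; linarith)
  have hd : DifferentiableOn ℂ (dslope (Qf κ ε lam s Y) 0) {w : ℂ | s.re - 1 < w.re} := by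
    rw [Complex.differentiableOn_dslope h0]
    intro u hu
    exact ((Nice.Qf κ ε lam s hY (a := u.re) (b := u.re) hu).1 u le_rfl le_rfl).differentiableWithinAt
  have hcl : DiffContOnCl ℂ (dslope (Qf κ ε lam s Y) 0) (Metric.ball 0 (1/4)) := by
    apply DifferentiableOn.diffContOnCl
    refine hd.mono ?_
    rw [closure_ball _ (by norm_num)]
    intro u hu
    have hu' : ‖u‖ ≤ 1/4 := by simpa using hu
    have := (abs_le.1 ((Complex.abs_re_le_norm u).trans hu')).1
    show s.re - 1 < u.re; linarith
  refine Complex.norm_le_of_forall_mem_frontier_norm_le Metric.isBounded_ball hcl ?_ (z := w) ?_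
  · intro u hu
    rw [frontier_ball _ (by norm_num)] at hu
    have hu' : ‖u‖ = 1/4 := by simpa using hu
    exact main u ((Complex.abs_re_le_norm u).trans hu'.le) (((Complex.abs_im_le_norm u).trans hu'.le).trans hV) hu'.ge
  · rw [closure_ball _ (by norm_num)]
    simpa using h
end

section
open Filter Topology

structure Setup (x : ℝ) (p : ℕ) (κ ε s : ℂ) (lam Y : ℝ) : Prop where
  hx : 1000 ≤ x
  hp1 : Real.exp (x^9) < p
  hp2 : (p:ℝ) < Real.exp (x^9) * (1 + x^(-68:ℤ))
  hκ : ‖κ‖ = Real.sqrt p / (2 * Real.pi)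
  hε : ε = 1 ∨ ε = -1
  hlam : lam = Real.log (2 * Real.pi / p)
  hY : Y = Real.exp (x^9) * x^519
  hs : |s.re - 1/2| ≤ 2 * Real.pi / x^9
  ht : |s.im - 2 * Real.pi * x^519| ≤ x^405 + 2

lemma pow_cmp {x : ℝ} (hx : 1000 ≤ x) (m : ℕ) {n : ℕ} (h : m + 1 ≤ n) : 1000 * x^m ≤ x^n := by
  calc 1000 * x^m ≤ x * x^m := by gcongr
    _ = x^(m+1) := by ring
    _ ≤ x^n := pow_le_pow_right₀ (by linarith) h

lemma arch_bd_k : ∃ C : ℝ, 0 < C ∧ ∀ ε u : ℂ, ∀ k : ℕ, (ε = 1 ∨ ε = -1) → 1/4 ≤ u.re → u.re ≤ 3/4 → ‖arch ε (u - k)‖ ≤ C * (1 + |u.im|) * (k + 1 + |u.im|)^k := by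
  obtain ⟨C, hC, h⟩ := Gamma_bd
  refine ⟨10 * C, by positivity, fun ε u k hε h1 h2 => ?_⟩
  have hg := h (1 - u) (by simp; linarith) (by simp; linarith)
  have ht := trig_bd hε (u - k)
  have hz : 0 < (1 - u).re := by simp; linarith
  have hn1 : 1/4 ≤ ‖1 - u‖ := le_trans (by simp; linarith) (Complex.re_le_norm (1 - u))
  have hn2 : ‖1 - u‖ ≤ 1 + |u.im| := (Complex.norm_le_abs_re_add_abs_im _).trans (by
    simp only [Complex.sub_re, Complex.one_re, Complex.sub_im, Complex.one_im, zero_sub, abs_neg]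
    gcongr; exact abs_le.2 ⟨by linarith, by linarith⟩)
  have hpw : ‖1 - u‖ ^ ((1 - u).re - 1/2) ≤ 5 * (1 + |u.im|) := by
    simp only [Complex.sub_re, Complex.one_re]
    have h0 := abs_nonneg u.im
    rcases le_total 1 ‖1 - u‖ with h | h
    · calc _ ≤ ‖1 - u‖ ^ (1:ℝ) := Real.rpow_le_rpow_of_exponent_le h (by linarith)
        _ ≤ _ := by rw [Real.rpow_one]; linarith
    · calc _ ≤ ‖1 - u‖ ^ (-1:ℝ) := Real.rpow_le_rpow_of_exponent_ge (by linarith) h (by linarith)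
        _ ≤ 4 := by rw [Real.rpow_neg_one, inv_le_comm₀ (by linarith) (by norm_num)]; linarith
        _ ≤ _ := by linarith
  have hprod : ‖∏ j ∈ Finset.range k, (1 - u + j)‖ ≤ (k + 1 + |u.im|)^k := by
    rw [norm_prod]
    calc _ ≤ ∏ j ∈ Finset.range k, (k + 1 + |u.im|) := by
          refine Finset.prod_le_prod (fun _ _ => norm_nonneg _) fun j hj => ?_
          have hj' : (j:ℝ) ≤ k := by exact_mod_cast (Finset.mem_range.1 hj).le
          refine (norm_add_le _ _).trans ?_
          rw [Complex.norm_natCast]; linarith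
      _ = _ := by simp
  rw [arch, mul_assoc, show 1 - (u - k) = 1 - u + k by ring, Gamma_prod hz, norm_mul, norm_mul]
  simp only [Complex.sub_im, Complex.natCast_im, sub_zero, Complex.one_im, zero_sub, abs_neg] at ht hg
  calc _ ≤ (C * (5 * (1 + |u.im|)) * Real.exp (-(Real.pi / 2 * |u.im|))) * (k + 1 + |u.im|)^k * (2 * Real.exp (Real.pi / 2 * |u.im|)) := by
        gcongr
        exact hg.trans (by gcongr)
    _ = _ := by
      rw [Real.exp_neg]
      have := Real.exp_ne_zero (Real.pi / 2 * |u.im|)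
      field_simp
      ring

lemma Qf_norm {κ ε s w : ℂ} {lam Y : ℝ} (hY : 0 < Y) : ‖Qf κ ε lam s Y w‖ = ‖κ‖ * Real.exp ((s.re - w.re) * lam) * ‖arch ε (s - w)‖ * Real.exp (-(w.re * Real.log Y)) := by
  rw [Qf, Zt_arch, cpow_exp_aux hY, norm_mul, norm_mul, norm_mul, Complex.norm_exp, Complex.norm_exp]
  congr 3
  · simp [Complex.mul_re]
  · simp [Complex.mul_re]; ring

namespace Setup
variable {x : ℝ} {p : ℕ} {κ ε s : ℂ} {lam Y : ℝ}

lemma x0 (h : Setup x p κ ε s lam Y) : 0 < x := by linarith [h.hx]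
lemma p0 (h : Setup x p κ ε s lam Y) : 0 < (p:ℝ) := (Real.exp_pos _).trans h.hp1
lemma Y0 (h : Setup x p κ ε s lam Y) : 0 < Y := by have := h.x0; rw [h.hY]; positivity
lemma x9 (h : Setup x p κ ε s lam Y) : 1000 * x^8 ≤ x^9 := pow_cmp h.hx 8 (by norm_num)
lemma x9' (h : Setup x p κ ε s lam Y) : 10^9 ≤ x^9 := by
  have := h.hx
  calc (10:ℝ)^9 ≤ 1000^9 := by norm_num
    _ ≤ x^9 := by gcongr
lemma sre (h : Setup x p κ ε s lam Y) : |s.re - 1/2| ≤ 1/32 := by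
  refine h.hs.trans ?_
  have := h.x9'
  have := Real.pi_lt_four
  rw [div_le_iff₀ (by linarith)]; linarith
lemma e1 (h : Setup x p κ ε s lam Y) : x^(-68:ℤ) ≤ 1 := by
  rw [zpow_neg]
  exact inv_le_one_of_one_le₀ (one_le_zpow₀ (by linarith [h.hx]) (by norm_num))
lemma p2 (h : Setup x p κ ε s lam Y) : (p:ℝ) ≤ 2 * Real.exp (x^9) := by
  have := h.hp2; have := h.e1; nlinarith [Real.exp_pos (x^9)]
lemma logx (h : Setup x p κ ε s lam Y) : Real.log (x^519) ≤ x^9 / 100 := by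
  rw [Real.log_pow]
  have := Real.log_le_sub_one_of_pos h.x0
  have h2 := pow_cmp h.hx 1 (n := 2) (by norm_num)
  have h3 := pow_cmp h.hx 2 (n := 9) (by norm_num)
  have := h.x9'
  push_cast
  linarith
lemma logp (h : Setup x p κ ε s lam Y) : Real.log p ≤ x^9 + 1 := by
  calc Real.log p ≤ Real.log (2 * Real.exp (x^9)) := Real.log_le_log h.p0 h.p2
    _ = Real.log 2 + x^9 := by rw [Real.log_mul (by norm_num) (Real.exp_pos _).ne', Real.log_exp]
    _ ≤ _ := by linarith [Real.log_two_lt_d9]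
lemma logY (h : Setup x p κ ε s lam Y) : Real.log Y ≤ 1.01 * x^9 := by
  have := h.x0
  rw [h.hY, Real.log_mul (Real.exp_pos _).ne' (by positivity), Real.log_exp]
  linarith [h.logx]
lemma logY0 (h : Setup x p κ ε s lam Y) : x^9 ≤ Real.log Y := by
  have := h.x0
  rw [h.hY, Real.log_mul (Real.exp_pos _).ne' (by positivity), Real.log_exp]
  linarith [Real.log_nonneg (one_le_pow₀ (by linarith [h.hx]) : 1 ≤ x^519)]
lemma lam_eq (h : Setup x p κ ε s lam Y) : lam = Real.log (2 * Real.pi) - Real.log p := by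
  rw [h.hlam, Real.log_div (by positivity) h.p0.ne']
lemma log2pi : 0 ≤ Real.log (2 * Real.pi) := Real.log_nonneg (by linarith [Real.pi_gt_three])
lemma lam0 (h : Setup x p κ ε s lam Y) : lam ≤ 0 := by
  rw [h.lam_eq]
  have h1 : x^9 ≤ Real.log p := by
    rw [← Real.log_exp (x^9)]; exact Real.log_le_log (Real.exp_pos _) h.hp1.le
  have := h.x9'
  have : Real.log (2 * Real.pi) ≤ 2 * Real.pi - 1 := Real.log_le_sub_one_of_pos (by positivity)
  have := Real.pi_lt_four
  linarith
lemma sim (h : Setup x p κ ε s lam Y) : |s.im| ≤ 6.5 * x^519 := by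
  have h1 := h.ht
  have h2 := pow_cmp h.hx 405 (n := 519) (by norm_num)
  have h3 := pow_cmp h.hx 0 (n := 519) (by norm_num)
  have := Real.pi_lt_d2
  have := Real.pi_pos
  have h5 : 0 < x^519 := pow_pos h.x0 _
  obtain ⟨h4, h5⟩ := abs_le.1 h1
  rw [abs_le]; constructor <;> nlinarith
end Setup

lemma Z_bd : ∃ C : ℝ, 0 < C ∧ ∀ {x : ℝ} {p : ℕ} {κ ε s : ℂ} {lam Y : ℝ}, Setup x p κ ε s lam Y → ‖Qf κ ε lam s Y 0‖ ≤ C := by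
  obtain ⟨C, hC, harch⟩ := arch_bd
  refine ⟨C * Real.exp 20, by positivity, fun {x p κ ε s lam Y} h => ?_⟩
  obtain ⟨s1, s2⟩ := abs_le.1 h.sre
  have ha := harch ε s h.hε (by linarith) (by linarith)
  have hx0 := h.x0
  have hn1 : 1/4 ≤ ‖1 - s‖ := le_trans (by simp; linarith) (Complex.re_le_norm (1 - s))
  have hn2 : ‖1 - s‖ ≤ 8 * x^519 := (Complex.norm_le_abs_re_add_abs_im _).trans (by
    simp only [Complex.sub_re, Complex.one_re, Complex.sub_im, Complex.one_im, zero_sub, abs_neg]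
    have h3 := pow_cmp h.hx 0 (n := 519) (by norm_num)
    have := h.sim
    have : |1 - s.re| ≤ 1 := abs_le.2 ⟨by linarith, by linarith⟩
    linarith)
  rw [Qf_norm h.Y0]
  simp only [Complex.zero_re, sub_zero, zero_mul, neg_zero, Real.exp_zero, mul_one]
  rw [h.hκ]
  have h1 : Real.sqrt p / (2 * Real.pi) * Real.exp (s.re * lam) * ‖arch ε s‖ ≤ Real.sqrt p / (2 * Real.pi) * Real.exp (s.re * lam) * (C * ‖1 - s‖ ^ (1/2 - s.re)) := by gcongr
  refine h1.trans ?_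
  have h2 : Real.sqrt p ≤ Real.exp (1/2 * Real.log p) := by
    rw [Real.sqrt_eq_rpow, Real.rpow_def_of_pos h.p0, mul_comm]
  have h3 : ‖1 - s‖ ^ (1/2 - s.re) = Real.exp (Real.log ‖1 - s‖ * (1/2 - s.re)) := Real.rpow_def_of_pos (by linarith) _
  have hl1 : Real.log ‖1 - s‖ ≤ x^9 / 50 := by
    have : Real.log ‖1 - s‖ ≤ Real.log (8 * x^519) := Real.log_le_log (by linarith) hn2
    rw [Real.log_mul (by norm_num) (by positivity)] at this
    have h8 : Real.log 8 ≤ 8 - 1 := Real.log_le_sub_one_of_pos (by norm_num)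
    have := h.logx; have := h.x9'
    linarith
  have hl2 : -3 ≤ Real.log ‖1 - s‖ := by
    have : Real.log (1/4) ≤ Real.log ‖1 - s‖ := Real.log_le_log (by norm_num) hn1
    rw [one_div, Real.log_inv] at this
    have h8 : Real.log 4 ≤ 4 - 1 := Real.log_le_sub_one_of_pos (by norm_num)
    linarith
  rw [h3]
  calc _ ≤ Real.exp (1/2 * Real.log p) / 1 * Real.exp (s.re * lam) * (C * Real.exp (Real.log ‖1 - s‖ * (1/2 - s.re))) := by
        gcongr; linarith [Real.pi_gt_three]
    _ = C * Real.exp (1/2 * Real.log p + s.re * lam + Real.log ‖1 - s‖ * (1/2 - s.re)) := by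
        rw [Real.exp_add, Real.exp_add]; ring
    _ ≤ _ := by
      gcongr
      rw [h.lam_eq]
      have hs := h.hs
      have hlp : Real.log p + Real.log ‖1 - s‖ ≤ 1.1 * x^9 := by linarith [h.logp, h.x9']
      have hlp0 : 0 ≤ Real.log p + Real.log ‖1 - s‖ := by
        have h1 : x^9 ≤ Real.log p := by
          rw [← Real.log_exp (x^9)]; exact Real.log_le_log (Real.exp_pos _) h.hp1.le
        linarith [h.x9']
      have hs' : |1/2 - s.re| ≤ 2 * Real.pi / x^9 := by rw [abs_sub_comm]; exact hs
      have h5 : (1/2 - s.re) * (Real.log p + Real.log ‖1 - s‖) ≤ 2 * Real.pi / x^9 * (1.1 * x^9) := by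
        apply mul_le_mul ((le_abs_self _).trans hs') hlp hlp0 (by positivity)
      have h6 : 2 * Real.pi / x^9 * (1.1 * x^9) = 2.2 * Real.pi := by field_simp; ring
      have h7 : Real.log (2 * Real.pi) ≤ 2 * Real.pi - 1 := Real.log_le_sub_one_of_pos (by positivity)
      have h8 : s.re * Real.log (2 * Real.pi) ≤ 1 * Real.log (2 * Real.pi) := by
        have := Setup.log2pi
        gcongr; linarith
      have := Real.pi_lt_four
      nlinarith

lemma gauss_absorb {Λ b v : ℝ} (hΛ : 1 ≤ Λ) (hb0 : 0 ≤ b) (hb : b ≤ 1 / (4 * Λ)) : (1 + |v|) * Real.exp (b * |v|) ≤ 54 * Λ * Real.exp (v^2 / (8 * Λ)) := by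
  have h1 : 1 + |v| ≤ 18 * Λ * Real.exp (v^2 / (16 * Λ)) := by
    have := Real.add_one_le_exp (v^2 / (16 * Λ))
    have h2 : |v| ≤ 1 + v^2 := by rw [← sq_abs v]; nlinarith [sq_nonneg (|v| - 1), abs_nonneg v]
    have h3 : v^2 = 16 * Λ * (v^2 / (16 * Λ)) := by field_simp
    have h4 : 0 ≤ v^2 / (16 * Λ) := by positivity
    nlinarith
  have h2 : Real.exp (b * |v|) ≤ 3 * Real.exp (v^2 / (16 * Λ)) := by
    have h3 : b * |v| ≤ 1 + v^2 / (16 * Λ) := by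
      have h4 : b^2 ≤ 1 / (4 * Λ) := by
        have : 1 / (4 * Λ) ≤ 1 := by rw [div_le_one (by linarith)]; linarith
        nlinarith
      have h5 : (b * |v|)^2 / 4 ≤ v^2 / (16 * Λ) := by
        rw [mul_pow, sq_abs]
        calc b^2 * v^2 / 4 ≤ 1 / (4 * Λ) * v^2 / 4 := by gcongr
          _ = _ := by field_simp; ring
      nlinarith [sq_nonneg (b * |v| / 2 - 1)]
    calc _ ≤ Real.exp (1 + v^2 / (16 * Λ)) := Real.exp_le_exp.2 h3
      _ = Real.exp 1 * Real.exp (v^2 / (16 * Λ)) := Real.exp_add _ _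
      _ ≤ _ := by gcongr; linarith [Real.exp_one_lt_d9]
  calc _ ≤ (18 * Λ * Real.exp (v^2 / (16 * Λ))) * (3 * Real.exp (v^2 / (16 * Λ))) := by gcongr
    _ = 54 * Λ * (Real.exp (v^2 / (16 * Λ)) * Real.exp (v^2 / (16 * Λ))) := by ring
    _ = _ := by rw [← Real.exp_add]; congr 2; field_simp; ring

lemma Q_crude : ∃ C : ℝ, 0 < C ∧ ∀ {x : ℝ} {p : ℕ} {κ ε s : ℂ} {lam Y : ℝ}, Setup x p κ ε s lam Y → ∀ k : ℕ, (k:ℝ) ≤ 2 * x^9 → ∀ v : ℝ,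
    ‖Qf κ ε lam s Y (((2 * s.re - 1 + k : ℝ):ℂ) + v * Complex.I)‖ ≤ C * Real.exp (2 * x^9) * 3^k * Real.exp (v^2 / (8 * x^30)) := by
  obtain ⟨C, hC, harch⟩ := arch_bd_k
  refine ⟨54 * 8 * C, by positivity, fun {x p κ ε s lam Y} h k hk v => ?_⟩
  obtain ⟨s1, s2⟩ := abs_le.1 h.sre
  have hx0 := h.x0
  set w : ℂ := ((2 * s.re - 1 + k : ℝ):ℂ) + v * Complex.I with hw
  have hwre : w.re = 2 * s.re - 1 + k := by simp [hw]
  have hu : s - w = (⟨1 - s.re, s.im - v⟩ : ℂ) - k := by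
    apply Complex.ext <;> simp [hw]; ring
  have ha := harch ε ⟨1 - s.re, s.im - v⟩ k h.hε (by simp; linarith) (by simp; linarith)
  rw [← hu] at ha
  simp only at ha
  rw [Qf_norm h.Y0, hwre, h.hκ]
  set τ := x^519 with hτ
  have hτ0 : 0 < τ := by positivity
  have him : |s.im - v| ≤ 6.5 * τ + |v| := (abs_sub _ _).trans (by linarith [h.sim])
  have h1τ : 1000 ≤ τ := by simpa using pow_cmp h.hx 0 (n := 519) (by norm_num)
  have h9τ : 1000 * x^9 ≤ τ := pow_cmp h.hx 9 (n := 519) (by norm_num)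
  have hav := abs_nonneg v
  have hpi := Real.pi_gt_three
  -- power part
  have hpow : (k + 1 + |s.im - v|)^k ≤ (3 * τ)^k * (3^k * Real.exp (k / τ * |v|)) := by
    rw [show Real.exp (k / τ * |v|) = Real.exp (|v| / τ)^k by rw [← Real.exp_nat_mul]; congr 1; field_simp, ← mul_pow, ← mul_pow]
    gcongr
    have := Real.add_one_le_exp (|v| / τ)
    have h5 : |v| = τ * (|v| / τ) := by field_simp
    have h6 : 0 ≤ |v| / τ := by positivity
    nlinarith
  have hlin : 1 + |s.im - v| ≤ 8 * τ * (1 + |v|) := by nlinarith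
  have hfac : Real.sqrt p / (2 * Real.pi) * Real.exp ((s.re - (2 * s.re - 1 + k)) * lam) * Real.exp (-((2 * s.re - 1 + k) * Real.log Y)) * (3 * τ)^k ≤ Real.exp (x^9) := by
    have h2 : Real.sqrt p ≤ Real.exp (1/2 * Real.log p) := by
      rw [Real.sqrt_eq_rpow, Real.rpow_def_of_pos h.p0, mul_comm]
    have h3 : (3 * τ)^k = Real.exp (k * Real.log (3 * τ)) := by
      rw [Real.exp_nat_mul, Real.exp_log (by positivity)]
    rw [h3]
    calc _ ≤ Real.exp (1/2 * Real.log p) / 1 * Real.exp ((s.re - (2 * s.re - 1 + k)) * lam) * Real.exp (-((2 * s.re - 1 + k) * Real.log Y)) * Real.exp (k * Real.log (3 * τ)) := by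
          gcongr; linarith
      _ = Real.exp (1/2 * Real.log p + (s.re - (2 * s.re - 1 + k)) * lam + -((2 * s.re - 1 + k) * Real.log Y) + k * Real.log (3 * τ)) := by
          rw [Real.exp_add, Real.exp_add, Real.exp_add, div_one]
      _ ≤ _ := by
        rw [Real.exp_le_exp]
        have hk' : - lam - Real.log Y + Real.log (3 * τ) ≤ 0 := by
          rw [h.lam_eq, h.hY, Real.log_mul (Real.exp_pos _).ne' hτ0.ne', Real.log_mul (by norm_num) hτ0.ne', Real.log_exp]
          have : Real.log p + Real.log 3 ≤ Real.log (2 * Real.pi) + x^9 := by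
            rw [← Real.log_mul h.p0.ne' (by norm_num)]
            nth_rw 1 [← Real.log_exp (x^9)]
            rw [← Real.log_mul (by positivity) (Real.exp_pos _).ne']
            apply Real.log_le_log (mul_pos h.p0 (by norm_num))
            nlinarith [h.p2, Real.exp_pos (x^9)]
          linarith
        have h5 : (k:ℝ) * (- lam - Real.log Y + Real.log (3 * τ)) ≤ 0 := mul_nonpos_of_nonneg_of_nonpos (by positivity) hk'
        have h6 : (1 - s.re) * lam ≤ 0 := mul_nonpos_of_nonneg_of_nonpos (by linarith) h.lam0
        have h7 : -((2 * s.re - 1) * Real.log Y) ≤ 1/16 * (1.01 * x^9) := by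
          have := h.logY; have := h.logY0; have := h.x9'
          nlinarith
        have := h.logp; have := h.x9'
        nlinarith
  have habs := gauss_absorb (Λ := x^30) (b := k / τ) (v := v) (one_le_pow₀ (by linarith [h.hx])) (by positivity) (by
    rw [div_le_div_iff₀ hτ0 (by positivity)]
    have := pow_cmp h.hx 39 (n := 519) (by norm_num)
    calc (k:ℝ) * (4 * x^30) ≤ 2 * x^9 * (4 * x^30) := by gcongr
      _ = 8 * x^39 := by ring
      _ ≤ _ := by rw [one_mul]; have : 0 ≤ x^39 := by positivity
                  linarith)
  have hττ : τ * x^30 ≤ Real.exp (x^9) := by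
    rw [hτ, ← pow_add, ← Real.exp_log (show 0 < x^(519+30) by positivity), Real.exp_le_exp, Real.log_pow]
    have := Real.log_le_sub_one_of_pos h.x0
    have h2 := pow_cmp h.hx 1 (n := 9) (by norm_num)
    push_cast
    linarith
  set Aa := Real.sqrt p / (2 * Real.pi) * Real.exp ((s.re - (2 * s.re - 1 + k)) * lam) with hAa
  set Bb := Real.exp (-((2 * s.re - 1 + k) * Real.log Y)) with hBb
  calc Aa * ‖arch ε (s - w)‖ * Bb ≤ Aa * (C * (8 * τ * (1 + |v|)) * ((3 * τ)^k * (3^k * Real.exp (k / τ * |v|)))) * Bb := by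
        gcongr
        refine ha.trans ?_
        gcongr
    _ = C * 8 * τ * 3^k * (Aa * Bb * (3 * τ)^k) * ((1 + |v|) * Real.exp (k / τ * |v|)) := by ring
    _ ≤ C * 8 * τ * 3^k * Real.exp (x^9) * (54 * x^30 * Real.exp (v^2 / (8 * x^30))) := by gcongr
    _ = 54 * 8 * C * Real.exp (x^9) * (τ * x^30) * 3^k * Real.exp (v^2 / (8 * x^30)) := by ring
    _ ≤ 54 * 8 * C * Real.exp (x^9) * (Real.exp (x^9)) * 3^k * Real.exp (v^2 / (8 * x^30)) := by gcongr
    _ = _ := by rw [two_mul, Real.exp_add]; ring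
end

section
open Filter Topology

lemma sqrt_exp {x : ℝ} (hx : 1000 ≤ x) : Real.sqrt (8 * Real.pi * x^30) ≤ Real.exp (x^9) := by
  have h0 : 0 < x := by linarith
  rw [Real.sqrt_le_left (Real.exp_pos _).le]
  have h1 : 8 * Real.pi * x^30 ≤ x^31 := by
    have := pow_cmp hx 30 (n := 31) (by norm_num)
    have := Real.pi_lt_four
    have : 0 < x^30 := by positivity
    nlinarith
  refine h1.trans ?_
  rw [← Real.exp_nat_mul, ← Real.exp_log (show 0 < x^31 by positivity), Real.exp_le_exp, Real.log_pow]
  have := Real.log_le_sub_one_of_pos h0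
  have h2 := pow_cmp hx 1 (n := 9) (by norm_num)
  push_cast
  linarith

lemma exp_small {x c : ℝ} (hx : 1000 ≤ x) (hc : |c| ≤ 2 * x^10) : Real.exp (c^2 / (4 * x^30)) ≤ 3 := by
  have h0 : 0 < x := by linarith
  have h1 : c^2 ≤ 4 * x^20 := by
    rw [← sq_abs]
    calc |c|^2 ≤ (2 * x^10)^2 := by gcongr
      _ = _ := by ring
  have h2 : c^2 / (4 * x^30) ≤ 1 := by
    rw [div_le_one (by positivity)]
    have := pow_cmp hx 20 (n := 30) (by norm_num)
    have : 0 < x^20 := by positivity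
    linarith
  calc _ ≤ Real.exp 1 := Real.exp_le_exp.2 h2
    _ ≤ 3 := by linarith [Real.exp_one_lt_d9]

lemma two_rpow {x : ℝ} (hx : 1000 ≤ x) : (2:ℝ)^(-x^10) ≤ Real.exp (-(0.69 * x^10)) := by
  have : 0 < x := by linarith
  rw [Real.rpow_def_of_pos (by norm_num), Real.exp_le_exp]
  have := Real.log_two_gt_d9
  have : 0 < x^10 := by positivity
  nlinarith

lemma term1 {x U A lam Y : ℝ} {p : ℕ} {κ ε s : ℂ} (h : Setup x p κ ε s lam Y) (hU : U ≤ x^2) (hU0 : 0 ≤ U) (hA : A = Real.exp (x^9 - 2 * U) * x^519)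
    (hp : p.Prime) (ψ : DirichletCharacter ℂ p) (hψ : ψ.IsPrimitive) :
    ‖JJ (x^30) (fun w => (Lfun ψ (s + w) - dpoly (fun n => ψ (n : ZMod p)) ⌈2 * A⌉₊ (s + w)) * (A:ℂ)^w * w⁻¹) 2‖ ≤ 24 * Real.exp (-(x^10 / 20)) := by
  have hx := h.hx
  have hx0 := h.x0
  have : Fact p.Prime := ⟨hp⟩
  obtain ⟨s1, s2⟩ := abs_le.1 h.sre
  have hpsi0 : ψ ((0:ℕ) : ZMod p) = 0 := by rw [Nat.cast_zero]; exact ψ.map_zero' hp.ne_one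
  have h29 := pow_cmp hx 2 (n := 9) (by norm_num)
  have h910 := pow_cmp hx 9 (n := 10) (by norm_num)
  have h9 := h.x9'
  have hx2 : 0 < x^2 := by positivity
  have h1τ : 1000 ≤ x^519 := by simpa using pow_cmp h.hx 0 (n := 519) (by norm_num)
  have hA1 : 1 ≤ A := by
    rw [hA]
    have : 1 ≤ Real.exp (x^9 - 2 * U) := Real.one_le_exp (by linarith)
    nlinarith
  have hA0 : 0 < A := by linarith
  have hAY : A ≤ Real.exp (1.01 * x^9) := by
    have e1 : x^519 ≤ Real.exp (x^9 / 100) := by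
      rw [← Real.log_le_iff_le_exp (by positivity)]; exact h.logx
    rw [hA, show 1.01 * x^9 = x^9 + x^9/100 by ring, Real.exp_add]
    gcongr; linarith
  have hΛ : 0 < x^30 := by positivity
  set M := x^10 with hM
  have hM2 : 2 ≤ M := by linarith
  rw [Nice.shiftJ hΛ hM2 ((((Nice.shift s (Nice.L hp ψ hψ)).sub (Nice.dpoly _ hpsi0 _ s)).mul (Nice.cpow hA0)).mul (Nice.inv (by norm_num)))]
  have hB : ∀ v : ℝ, ‖(Lfun ψ (s + (M + v * Complex.I)) - dpoly (fun n => ψ (n : ZMod p)) ⌈2 * A⌉₊ (s + (M + v * Complex.I))) * (A:ℂ)^((M:ℂ) + v * Complex.I) * ((M:ℂ) + v * Complex.I)⁻¹‖ ≤ (8 * A^2 * 2^(-M)) * Real.exp (v^2 / (8 * x^30)) := by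
    intro v
    set w : ℂ := (M:ℂ) + v * Complex.I with hw
    have hwre : w.re = M := by simp [hw]
    have hN : 2 * A ≤ (⌈2 * A⌉₊ : ℝ) := Nat.le_ceil _
    have hN1 : 1 ≤ ⌈2 * A⌉₊ := Nat.one_le_ceil_iff.2 (by linarith)
    have t1 := L_tail hp ψ hN1 (u := s + w) (by simp [hwre]; linarith)
    rw [Complex.add_re, hwre] at t1
    have t2 : ((⌈2 * A⌉₊ : ℕ) : ℝ)^(2 - (s.re + M)) ≤ (2 * A)^(2 - (s.re + M)) := Real.rpow_le_rpow_of_nonpos (by linarith) hN (by linarith)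
    have t3 : ‖(A:ℂ)^w‖ = A^M := by rw [Complex.norm_cpow_eq_rpow_re_of_pos hA0, hwre]
    have t4 : ‖w⁻¹‖ ≤ 1 := by
      rw [norm_inv]
      apply inv_le_one_of_one_le₀
      have := Complex.re_le_norm w
      linarith
    have t5 : (2 * A)^(2 - (s.re + M)) * A^M ≤ 4 * 2^(-M) * A^2 := by
      rw [Real.mul_rpow (by norm_num) hA0.le, mul_assoc, ← Real.rpow_add hA0, show (2 - (s.re + M)) = (2 - s.re) + (-M) by ring, Real.rpow_add (by norm_num : (0:ℝ) < 2)]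
      have u1 : (2:ℝ)^(2 - s.re) ≤ 4 := by
        calc (2:ℝ)^(2 - s.re) ≤ 2^(2:ℝ) := Real.rpow_le_rpow_of_exponent_le (by norm_num) (by linarith)
          _ = 4 := by norm_num
      have u2 : A^(2 - s.re + -M + M) ≤ A^2 := by
        calc A^(2 - s.re + -M + M) ≤ A^(2:ℝ) := Real.rpow_le_rpow_of_exponent_le hA1 (by linarith)
          _ = A^2 := by norm_num
      gcongr
    have t6 : 1 ≤ Real.exp (v^2 / (8 * x^30)) := Real.one_le_exp (by positivity)
    rw [norm_mul, norm_mul, t3]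
    calc _ ≤ (2 * (2 * A)^(2 - (s.re + M))) * A^M * 1 := by
          gcongr
          exact t1.trans (by gcongr)
      _ ≤ 2 * (4 * 2^(-M) * A^2) := by rw [mul_one, mul_assoc]; gcongr
      _ = (8 * A^2 * 2^(-M)) * 1 := by ring
      _ ≤ _ := by gcongr
  refine (JJ_norm_le hΛ (by positivity) hB).trans ?_
  have h2 := two_rpow hx
  calc _ ≤ 8 * (Real.exp (1.01 * x^9))^2 * Real.exp (-(0.69 * x^10)) * 3 * Real.exp (x^9) := by
        gcongr
        · exact exp_small hx (by rw [abs_of_pos (by positivity)]; linarith)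
        · exact sqrt_exp hx
    _ = 24 * Real.exp (2 * (1.01 * x^9) + -(0.69 * x^10) + x^9) := by
        rw [← Real.exp_nat_mul, Real.exp_add, Real.exp_add]; push_cast; ring
    _ ≤ _ := by
        gcongr; linarith

lemma term2 : ∃ C : ℝ, 0 < C ∧ ∀ {x U tt lam Y : ℝ} {p : ℕ} {κ ε s : ℂ}, Setup x p κ ε s lam Y → U ≤ x^2 → x ≤ U → tt = Real.exp (2 * U) → 
    ∀ (_ : p.Prime) (ψ : DirichletCharacter ℂ p) (_ : ψ.IsPrimitive),
    ‖JJ (x^30) (fun w => Qf κ ε lam s Y w * (tt:ℂ)^w * (Lfun ψ⁻¹ (1 - s + w) - dpoly (fun n => ψ⁻¹ (n : ZMod p)) ⌈Real.exp (3 * U)⌉₊ (1 - s + w)) * w⁻¹) 2‖ ≤ C * Real.exp (-(x^10 / 20)) := by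
  obtain ⟨C, hC, hQ⟩ := Q_crude
  refine ⟨6 * C, by positivity, fun {x U tt lam Y p κ ε s} h hU hxU htt hp ψ hψ => ?_⟩
  have hx := h.hx
  have hx0 := h.x0
  have : Fact p.Prime := ⟨hp⟩
  obtain ⟨s1, s2⟩ := abs_le.1 h.sre
  have hpsi0' : ψ⁻¹ ((0:ℕ) : ZMod p) = 0 := by rw [Nat.cast_zero]; exact ψ⁻¹.map_zero' hp.ne_one
  have hne' : ψ⁻¹ ≠ 1 := by simpa using prim_ne_one hp ψ hψ
  have h29 := pow_cmp hx 1 (n := 9) (by norm_num)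
  have h910 := pow_cmp hx 9 (n := 10) (by norm_num)
  have h9 := h.x9'
  have hΛ : 0 < x^30 := by positivity
  have htt0 : 0 < tt := by rw [htt]; positivity
  set k : ℕ := ⌈x^9⌉₊ with hk
  have hk1 : x^9 ≤ k := Nat.le_ceil _
  have hk2 : (k:ℝ) ≤ x^9 + 1 := (Nat.ceil_lt_add_one (by positivity)).le
  have hkk : (k:ℝ) ≤ 2 * x^9 := by linarith
  set c : ℝ := 2 * s.re - 1 + k with hc
  set N3 := ⌈Real.exp (3 * U)⌉₊ with hN3
  rw [Nice.shiftJ hΛ (show 2 ≤ c by linarith) ((((Nice.Qf κ ε lam s h.Y0 (by linarith)).mul (Nice.cpow htt0)).mul ((Nice.shift (1 - s) (Nice.L_right hp _ hne' (by simp; linarith))).sub (Nice.dpoly _ hpsi0' _ (1 - s)))).mul (Nice.inv (by norm_num)))]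
  have hB : ∀ v : ℝ, ‖Qf κ ε lam s Y ((c:ℂ) + v * Complex.I) * (tt:ℂ)^((c:ℂ) + v * Complex.I) * (Lfun ψ⁻¹ (1 - s + ((c:ℂ) + v * Complex.I)) - dpoly (fun n => ψ⁻¹ (n : ZMod p)) N3 (1 - s + ((c:ℂ) + v * Complex.I))) * ((c:ℂ) + v * Complex.I)⁻¹‖ ≤ (2 * C * Real.exp (4 * x^9 - x^10)) * Real.exp (v^2 / (8 * x^30)) := by
    intro v
    have t0 := hQ h k hkk v
    rw [← hc] at t0
    set w : ℂ := (c:ℂ) + v * Complex.I with hw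
    have hwre : w.re = c := by simp [hw]
    have hN : Real.exp (3 * U) ≤ (N3 : ℝ) := Nat.le_ceil _
    have hN1 : 1 ≤ N3 := Nat.one_le_ceil_iff.2 (Real.exp_pos _)
    have hre : (1 - s + w).re = s.re + k := by simp [hwre, hc]; ring
    have t1 := L_tail hp ψ⁻¹ hN1 (u := 1 - s + w) (by rw [hre]; linarith)
    rw [hre] at t1
    have t2 : (N3 : ℝ)^(2 - (s.re + k)) ≤ (Real.exp (3 * U))^(2 - (s.re + k)) := Real.rpow_le_rpow_of_nonpos (Real.exp_pos _) hN (by linarith)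
    rw [← Real.exp_mul] at t2
    have t3 : ‖(tt:ℂ)^w‖ = Real.exp (2 * U * c) := by rw [Complex.norm_cpow_eq_rpow_re_of_pos htt0, hwre, htt, ← Real.exp_mul]
    have t4 : ‖w⁻¹‖ ≤ 1 := by
      rw [norm_inv]
      apply inv_le_one_of_one_le₀
      have := Complex.re_le_norm w
      linarith
    have t5 : (3:ℝ)^k ≤ Real.exp (1.2 * k) := by
      rw [mul_comm, Real.exp_nat_mul]
      gcongr
      have h1 : (1.2:ℝ) = 1 + 0.2 := by norm_num
      rw [h1, Real.exp_add]
      have := Real.exp_one_gt_d9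
      have := Real.add_one_le_exp (0.2:ℝ)
      nlinarith
    rw [norm_mul, norm_mul, norm_mul, t3]
    calc _ ≤ (C * Real.exp (2 * x^9) * Real.exp (1.2 * k) * Real.exp (v^2 / (8 * x^30))) * Real.exp (2 * U * c) * (2 * Real.exp (3 * U * (2 - (s.re + k)))) * 1 := by
          gcongr
          · exact t0.trans (by gcongr)
          · exact t1.trans (by gcongr)
      _ = (2 * C * Real.exp (2 * x^9 + 1.2 * k + 2 * U * c + 3 * U * (2 - (s.re + k)))) * Real.exp (v^2 / (8 * x^30)) := by
          simp only [Real.exp_add]; ring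
      _ ≤ _ := by
          gcongr
          have e1 : 2 * U * c + 3 * U * (2 - (s.re + k)) = U * (4 + s.re - k) := by rw [hc]; ring
          have e2 : U * (4 + s.re - k) ≤ x * (5 - k) := by
            nlinarith
          have e3 : (1.2 - x) * k ≤ (1.2 - x) * x^9 := mul_le_mul_of_nonpos_left hk1 (by linarith)
          nlinarith
  refine (JJ_norm_le hΛ (by positivity) hB).trans ?_
  calc _ ≤ 2 * C * Real.exp (4 * x^9 - x^10) * 3 * Real.exp (x^9) := by
        gcongr
        · exact exp_small hx (by rw [abs_of_pos (by linarith)]; linarith)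
        · exact sqrt_exp hx
    _ = 6 * C * Real.exp (4 * x^9 - x^10 + x^9) := by
        rw [Real.exp_add]; ring
    _ ≤ _ := by
        gcongr; linarith

lemma N3_le {x U : ℝ} (hx : 1000 ≤ x) (hU : U ≤ x^2) : (⌈Real.exp (3 * U)⌉₊ : ℝ) ≤ Real.exp (x^9) := by
  have h29 := pow_cmp hx 2 (n := 9) (by norm_num)
  have h2 := pow_cmp hx 0 (n := 2) (by norm_num)
  refine (Nat.ceil_lt_add_one (by positivity)).le.trans ?_
  have : Real.exp (3 * U) ≤ Real.exp (x^9 - 1) := Real.exp_le_exp.2 (by linarith)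
  have h3 : Real.exp (x^9) = Real.exp (x^9 - 1) * Real.exp 1 := by rw [← Real.exp_add]; ring_nf
  have h4 : 1 ≤ Real.exp (x^9 - 1) := Real.one_le_exp (by linarith)
  have := Real.exp_one_gt_d9
  rw [h3]; nlinarith

lemma term4 {D : ℕ} {x U tt lam Y : ℝ} {p : ℕ} {κ ε s : ℂ} (hL : x = bigL D) (h : Setup x p κ ε s lam Y) (hU : U ≤ x^2) (htt : tt = Real.exp (2 * U)) (χ : DirichletCharacter ℂ p) :
    ‖∑ n ∈ Finset.Ico ⌈2 * tt⌉₊ ⌈Real.exp (3 * U)⌉₊, χ (n : ZMod p) * (n:ℂ) ^ (-(1 - s)) * ((gfun D (tt / n) : ℝ) : ℂ)‖ ≤ 3 * Real.exp (-(x^10 / 20)) := by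
  have hx := h.hx
  have hx0 := h.x0
  obtain ⟨s1, s2⟩ := abs_le.1 h.sre
  have h910 := pow_cmp hx 9 (n := 10) (by norm_num)
  have h9 := h.x9'
  have htt0 : 0 < tt := by rw [htt]; positivity
  have hterm : ∀ n ∈ Finset.Ico ⌈2 * tt⌉₊ ⌈Real.exp (3 * U)⌉₊, ‖χ (n : ZMod p) * (n:ℂ) ^ (-(1 - s)) * ((gfun D (tt / n) : ℝ) : ℂ)‖ ≤ Real.exp (-(0.69 * x^10)) * 3 * Real.exp (x^9) := by
    intro n hn
    have hn1 : 2 * tt ≤ n := (Nat.le_ceil _).trans (by exact_mod_cast (Finset.mem_Ico.1 hn).1)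
    have hn0 : 0 < (n:ℝ) := by linarith
    have hnn : 0 < n := by exact_mod_cast hn0
    have a1 : ‖χ (n : ZMod p)‖ ≤ 1 := DirichletCharacter.norm_le_one _ _
    have a2 : ‖(n:ℂ) ^ (-(1 - s))‖ ≤ 1 := by
      rw [Complex.norm_natCast_cpow_of_pos hnn]
      apply Real.rpow_le_one_of_one_le_of_nonpos
      · exact_mod_cast hnn
      · simp; linarith
    have a3 : ‖((gfun D (tt / n) : ℝ) : ℂ)‖ ≤ Real.exp (-(0.69 * x^10)) * 3 * Real.exp (x^9) := by
      rw [Complex.norm_real, Real.norm_of_nonneg (gfun_nonneg _ _)]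
      refine (gfun_le (c := x^10) (by rw [← hL]; exact hx0) (by positivity) (by positivity)).trans ?_
      rw [← hL]
      gcongr
      · have b1 : tt / n ≤ 1/2 := by rw [div_le_iff₀ hn0]; linarith
        calc (tt / n)^(x^10) / x^10 ≤ (1/2)^(x^10) / 1 := by
              gcongr; linarith
          _ = 2^(-x^10) := by rw [div_one, one_div, Real.inv_rpow (by norm_num), Real.rpow_neg (by norm_num)]
          _ ≤ _ := two_rpow hx
      · exact exp_small hx (by rw [abs_of_pos (by positivity)]; linarith)
      · exact sqrt_exp hx
    rw [norm_mul, norm_mul]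
    calc _ ≤ 1 * 1 * (Real.exp (-(0.69 * x^10)) * 3 * Real.exp (x^9)) := by gcongr
      _ = _ := by ring
  refine (norm_sum_le_of_le _ hterm).trans ?_
  rw [Finset.sum_const, nsmul_eq_mul, Nat.card_Ico]
  calc _ ≤ Real.exp (x^9) * (Real.exp (-(0.69 * x^10)) * 3 * Real.exp (x^9)) := by
        gcongr
        exact le_trans (by exact_mod_cast Nat.sub_le _ _) (N3_le hx hU)
    _ = 3 * Real.exp (x^9 + -(0.69 * x^10) + x^9) := by rw [Real.exp_add, Real.exp_add]; ring
    _ ≤ _ := by gcongr; linarith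
end

section
open Filter Topology

lemma dpoly_conj {p : ℕ} (hp : p.Prime) (ψ : DirichletCharacter ℂ p) (N : ℕ) (s : ℂ) (v : ℝ) :
    ‖dpoly (fun n => ψ⁻¹ (n : ZMod p)) N (1 - s + (((2 * s.re - 1 : ℝ):ℂ) + v * Complex.I))‖ = ‖∑ n ∈ Finset.range N, ψ (n : ZMod p) * (n:ℂ)^(-s - ((-v : ℝ):ℂ) * Complex.I)‖ := by
  have : Fact p.Prime := ⟨hp⟩
  rw [← Complex.norm_conj, dpoly, map_sum]
  congr 1
  refine Finset.sum_congr rfl fun n _ => ?_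
  rw [map_mul, ← MulChar.star_apply']
  have h1 : (starRingEnd ℂ) (star (ψ (n : ZMod p))) = ψ (n : ZMod p) := star_star _
  rw [h1]
  congr 1
  have h2 : (-s - ((-v : ℝ):ℂ) * Complex.I) = (starRingEnd ℂ) (-(1 - s + (((2 * s.re - 1 : ℝ):ℂ) + v * Complex.I))) := by
    apply Complex.ext <;> simp <;> ring
  rw [h2, Complex.cpow_conj _ _ (by rw [Complex.natCast_arg]; exact Real.pi_ne_zero.symm), Complex.conj_natCast]

lemma sum_triv {p : ℕ} (hp : p.Prime) (ψ : DirichletCharacter ℂ p) (N : ℕ) {s : ℂ} (hs : 0 ≤ s.re) (v : ℝ) :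
    ‖∑ n ∈ Finset.range N, ψ (n : ZMod p) * (n:ℂ)^(-s - (v:ℂ) * Complex.I)‖ ≤ N := by
  have : Fact p.Prime := ⟨hp⟩
  have : ∀ n ∈ Finset.range N, ‖ψ (n : ZMod p) * (n:ℂ)^(-s - (v:ℂ) * Complex.I)‖ ≤ 1 := by
    intro n _
    rcases Nat.eq_zero_or_pos n with rfl | hn
    · rw [Nat.cast_zero, ψ.map_zero' hp.ne_one]; simp
    rw [norm_mul, Complex.norm_natCast_cpow_of_pos hn]
    have a1 : ‖ψ (n : ZMod p)‖ ≤ 1 := DirichletCharacter.norm_le_one _ _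
    have a2 : (n:ℝ) ^ (-s - (v:ℂ) * Complex.I).re ≤ 1 := Real.rpow_le_one_of_one_le_of_nonpos (by exact_mod_cast hn) (by simp; linarith)
    exact mul_le_one₀ a1 (by positivity) a2
  refine (norm_sum_le_of_le _ this).trans ?_
  simp

lemma Setup.slope {x : ℝ} {p : ℕ} {κ ε s : ℂ} {lam Y : ℝ} (h : Setup x p κ ε s lam Y) {w : ℂ} (hwr : |w.re| ≤ 1/4) (hwi : |w.im| ≤ x^20) :
    ‖dslope (Qf κ ε lam s Y) 0 w‖ ≤ 28 * x^(-68:ℤ) * ‖Qf κ ε lam s Y 0‖ := by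
  have hx := h.hx
  have hx0 := h.x0
  have hp0 := h.p0
  have hze : x^(-68:ℤ) = (x^68)⁻¹ := by rw [zpow_neg]; norm_cast
  have h68 : 0 < x^68 := by positivity
  have hx20 : 1000 ≤ x^20 := by simpa using pow_cmp hx 0 (n := 20) (by norm_num)
  have hτe : x^519 * x^(-68:ℤ) = x^451 := by
    rw [hze, show x^519 = x^451 * x^68 by ring]; field_simp
  refine Q_slope (τ := x^519) (b := x^405 + 2) (V := x^20) (η := Real.log (p / Real.exp (x^9))) h.hε (by positivity) h.Y0 ?_ ?_ h.e1 ?_ (h.sre.trans (by norm_num)) h.ht (by linarith) ?_ ?_ hwr hwi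
  · rw [h.lam_eq, h.hY, Real.log_mul (Real.exp_pos _).ne' (by positivity : x^519 ≠ 0), Real.log_mul (x := 2 * Real.pi) (y := x^519) (by positivity) (by positivity), Real.log_div hp0.ne' (Real.exp_pos _).ne']
    ring
  · have h1 : 1 ≤ p / Real.exp (x^9) := by rw [one_le_div (Real.exp_pos _)]; exact h.hp1.le
    rw [abs_of_nonneg (Real.log_nonneg h1)]
    refine (Real.log_le_sub_one_of_pos (by linarith)).trans ?_
    rw [sub_le_iff_le_add, div_le_iff₀ (Real.exp_pos _)]
    linarith [h.hp2]
  · rw [hze, div_le_iff₀ (by positivity), inv_mul_eq_div, le_div_iff₀ h68]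
    have := pow_cmp hx 68 (n := 519) (by norm_num)
    linarith
  · rw [hτe]
    have := pow_cmp hx 405 (n := 451) (by norm_num)
    have := pow_cmp hx 20 (n := 405) (by norm_num)
    linarith
  · rw [hze, mul_assoc, inv_mul_eq_div, mul_div_assoc', div_le_one h68]
    have := pow_cmp hx 20 (n := 68) (by norm_num)
    linarith

lemma term3 : ∃ C : ℝ, 0 < C ∧ ∀ {x U tt lam Y : ℝ} {p : ℕ} {κ ε s : ℂ}, Setup x p κ ε s lam Y → U ≤ x^2 → x ≤ U → tt = Real.exp (2 * U) →
    ∀ (_ : p.Prime) (ψ : DirichletCharacter ℂ p) (N3 : ℕ), (N3:ℝ) ≤ Real.exp (x^9) → 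
    ‖JJ (x^30) (fun w => dslope (Qf κ ε lam s Y) 0 w * ((tt:ℂ)^w * dpoly (fun n => ψ⁻¹ (n : ZMod p)) N3 (1 - s + w))) (2 * s.re - 1)‖ ≤
      C * x^(-68:ℤ) * (∫ v in (-(x^20))..(x^20), ‖∑ n ∈ Finset.range N3, ψ (n : ZMod p) * (n:ℂ)^(-s - (v:ℂ) * Complex.I)‖ * Real.exp (-v^2 / (4 * x^30))) + C * Real.exp (-(x^10 / 20)) := by
  obtain ⟨C1, hC1, hZ⟩ := Z_bd
  obtain ⟨C2, hC2, hQ⟩ := Q_crude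
  refine ⟨28 * C1 * 9 + 9 * (C1 + C2) * 2, by positivity, fun {x U tt lam Y p κ ε s} h hU hxU htt hp ψ N3 hN3 => ?_⟩
  have : Fact p.Prime := ⟨hp⟩
  have hx := h.hx
  have hx0 := h.x0
  obtain ⟨s1, s2⟩ := abs_le.1 h.sre
  have hΛ : 0 < x^30 := by positivity
  have htt0 : 0 < tt := by rw [htt]; positivity
  have hx20 : 1000 ≤ x^20 := by simpa using pow_cmp hx 0 (n := 20) (by norm_num)
  have h910 := pow_cmp hx 9 (n := 10) (by norm_num)
  have h9 := h.x9'
  have he0 : 0 < x^(-68:ℤ) := by positivity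
  set a : ℝ := 2 * s.re - 1 with ha
  have haa : |a| ≤ 1/4 := abs_le.2 ⟨by linarith, by linarith⟩
  set S : ℝ → ℝ := fun v => ‖∑ n ∈ Finset.range N3, ψ (n : ZMod p) * (n:ℂ)^(-s - (v:ℂ) * Complex.I)‖ with hS
  have hScont : Continuous S := by
    refine Continuous.norm (continuous_finsetSum _ fun n _ => ?_)
    rcases Nat.eq_zero_or_pos n with rfl | hn
    · rw [Nat.cast_zero, ψ.map_zero' hp.ne_one]; simp only [zero_mul]; exact continuous_const
    refine continuous_const.mul ?_
    have hn' : (n:ℂ) ≠ 0 := by exact_mod_cast hn.ne'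
    exact Continuous.const_cpow (by fun_prop) (Or.inl hn')
  set V := x^20 with hV
  set c1 : ℝ := 28 * C1 * 9 * x^(-68:ℤ) with hc1
  set B : ℝ := 9 * (C1 + C2) * Real.exp (3 * x^9 - x^10 / 16) with hB
  have hc10 : 0 ≤ c1 := by positivity
  have hB0 : 0 ≤ B := by positivity
  have httb : ∀ v : ℝ, ‖(tt:ℂ)^((a:ℂ) + v * Complex.I)‖ ≤ 3 := by
    intro v
    rw [Complex.norm_cpow_eq_rpow_re_of_pos htt0, htt, ← Real.exp_mul]
    have h1 : ((a:ℂ) + v * Complex.I).re = a := by simp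
    rw [h1]
    have h2 : a ≤ 4 * Real.pi / x^9 := by
      have := (abs_le.1 h.hs).2
      have e : 4 * Real.pi / x^9 = 2 * (2 * Real.pi / x^9) := by ring
      rw [e]; linarith
    have hpi := Real.pi_lt_four
    have h3 : 2 * U * a ≤ 1 := by
      have hU0 : 0 ≤ U := by linarith
      calc 2 * U * a ≤ 2 * U * (4 * Real.pi / x^9) := by gcongr
        _ ≤ 2 * x^2 * (4 * 4 / x^9) := by gcongr
        _ = 32 * x^2 / x^9 := by ring
        _ ≤ 1 := by
          rw [div_le_one (by positivity)]
          have := pow_cmp hx 2 (n := 9) (by norm_num)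
          have : 0 < x^2 := by positivity
          linarith
    calc _ ≤ Real.exp 1 := Real.exp_le_exp.2 h3
      _ ≤ 3 := by linarith [Real.exp_one_lt_d9]
  have hga : Real.exp (a^2 / (4 * x^30)) ≤ 3 := exp_small hx (by linarith)
  -- pointwise bound
  have hpt : ∀ v : ℝ, ‖dslope (Qf κ ε lam s Y) 0 ((a:ℂ) + v * Complex.I) * ((tt:ℂ)^((a:ℂ) + v * Complex.I) * dpoly (fun n => ψ⁻¹ (n : ZMod p)) N3 (1 - s + ((a:ℂ) + v * Complex.I))) * Complex.exp (((a:ℂ) + v * Complex.I)^2 / (4 * (x^30 : ℝ)))‖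
      ≤ (Set.Ioc (-V) V).indicator (fun v => c1 * (S (-v) * Real.exp (-v^2 / (4 * x^30)))) v + B * Real.exp (-(1 / (16 * x^30)) * v^2) := by
    intro v
    have hre : ((a:ℂ) + v * Complex.I).re = a := by simp
    have him : ((a:ℂ) + v * Complex.I).im = v := by simp
    have hS' : ‖dpoly (fun n => ψ⁻¹ (n : ZMod p)) N3 (1 - s + ((a:ℂ) + v * Complex.I))‖ = S (-v) := dpoly_conj hp ψ N3 s v
    rw [norm_mul, norm_mul, norm_mul, norm_gauss, hS']
    have hS0 : 0 ≤ S (-v) := norm_nonneg _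
    by_cases hv : v ∈ Set.Ioc (-V) V
    · rw [Set.indicator_of_mem hv]
      have hsl := h.slope (w := (a:ℂ) + v * Complex.I) (by rw [hre]; exact haa) (by rw [him]; exact abs_le.2 ⟨hv.1.le, hv.2⟩)
      have hsl2 : ‖dslope (Qf κ ε lam s Y) 0 ((a:ℂ) + v * Complex.I)‖ ≤ 28 * x^(-68:ℤ) * C1 := hsl.trans (by gcongr; exact hZ h)
      have : 0 ≤ B * Real.exp (-(1 / (16 * x^30)) * v^2) := by positivity
      refine le_trans ?_ (le_add_of_nonneg_right this)
      calc _ ≤ (28 * x^(-68:ℤ) * C1) * (3 * S (-v)) * (3 * Real.exp (-v^2 / (4 * x^30))) := by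
            gcongr
            exact httb v
        _ = _ := by rw [hc1]; ring
    · rw [Set.indicator_of_notMem hv, zero_add]
      have hvV : V ≤ |v| := by
        by_contra hcon
        push Not at hcon
        exact hv ⟨(abs_lt.1 hcon).1, (abs_lt.1 hcon).2.le⟩
      have hv2 : x^40 ≤ v^2 := by
        rw [← sq_abs, show x^40 = V^2 by rw [hV]; ring]; gcongr
      have hwn : 1 ≤ ‖(a:ℂ) + v * Complex.I‖ := by
        have := Complex.abs_im_le_norm ((a:ℂ) + v * Complex.I)
        rw [him] at this; linarith
      have hw0 : (a:ℂ) + v * Complex.I ≠ 0 := by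
        intro h0; rw [h0, norm_zero] at hwn; linarith
      have hq := hQ h 0 (by rw [Nat.cast_zero]; positivity) v
      simp only [Nat.cast_zero, add_zero, pow_zero, mul_one] at hq
      have hq0 := hZ h
      have hg1 : 1 ≤ Real.exp (v^2 / (8 * x^30)) := Real.one_le_exp (by positivity)
      have hg2 : 1 ≤ Real.exp (2 * x^9) := Real.one_le_exp (by positivity)
      have hsl : ‖dslope (Qf κ ε lam s Y) 0 ((a:ℂ) + v * Complex.I)‖ ≤ (C1 + C2) * Real.exp (2 * x^9) * Real.exp (v^2 / (8 * x^30)) := by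
        rw [dslope_of_ne _ hw0, slope_def_field, sub_zero, norm_div]
        refine (div_le_self (norm_nonneg _) hwn).trans ((norm_sub_le _ _).trans ?_)
        have : C1 * 1 * 1 ≤ C1 * Real.exp (2 * x^9) * Real.exp (v^2 / (8 * x^30)) := by gcongr
        linarith
      have hS1 : S (-v) ≤ Real.exp (x^9) := (sum_triv hp ψ N3 (by linarith) (-v)).trans hN3
      calc _ ≤ ((C1 + C2) * Real.exp (2 * x^9) * Real.exp (v^2 / (8 * x^30))) * (3 * Real.exp (x^9)) * (3 * Real.exp (-v^2 / (4 * x^30))) := by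
            gcongr
            exact httb v
        _ = 9 * (C1 + C2) * Real.exp (2 * x^9 + v^2 / (8 * x^30) + x^9 + -v^2 / (4 * x^30)) := by
            simp only [Real.exp_add]; ring
        _ ≤ 9 * (C1 + C2) * Real.exp ((3 * x^9 - x^10 / 16) + -(1 / (16 * x^30)) * v^2) := by
            gcongr 9 * (C1 + C2) * Real.exp ?_
            have e1 : v^2 / (8 * x^30) = 2 * (v^2 / (16 * x^30)) := by field_simp; ring
            have e2 : -v^2 / (4 * x^30) = -4 * (v^2 / (16 * x^30)) := by field_simp; ring
            have e3 : -(1 / (16 * x^30)) * v^2 = - (v^2 / (16 * x^30)) := by ring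
            have e4 : x^10 / 16 ≤ v^2 / (16 * x^30) := by
              rw [div_le_div_iff₀ (by norm_num) (by positivity)]
              nlinarith
            rw [e1, e2, e3]; linarith
        _ = _ := by rw [Real.exp_add, hB]; ring
  have hi1 : MeasureTheory.IntegrableOn (fun v => c1 * (S (-v) * Real.exp (-v^2 / (4 * x^30)))) (Set.Ioc (-V) V) := by
    have : Continuous (fun v => c1 * (S (-v) * Real.exp (-v^2 / (4 * x^30)))) := by fun_prop
    exact this.integrableOn_Ioc
  have hi2 : MeasureTheory.Integrable (fun v : ℝ => B * Real.exp (-(1 / (16 * x^30)) * v^2)) := (integrable_exp_neg_mul_sq (by positivity)).const_mul _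
  have hi1' := (MeasureTheory.integrable_indicator_iff measurableSet_Ioc).2 hi1
  have hmain := MeasureTheory.norm_integral_le_of_norm_le (hi1'.add hi2) (Filter.Eventually.of_forall hpt)
  have hIntg : (∫ v : ℝ, ((Set.Ioc (-V) V).indicator (fun v => c1 * (S (-v) * Real.exp (-v^2 / (4 * x^30)))) + fun v => B * Real.exp (-(1 / (16 * x^30)) * v^2)) v) = c1 * (∫ v in (-V)..V, S v * Real.exp (-v^2 / (4 * x^30))) + B * Real.sqrt (Real.pi / (1 / (16 * x^30))) := by
    simp only [Pi.add_apply]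
    rw [MeasureTheory.integral_add hi1' hi2, MeasureTheory.integral_indicator measurableSet_Ioc, ← intervalIntegral.integral_of_le (by linarith), intervalIntegral.integral_const_mul, MeasureTheory.integral_const_mul, integral_gaussian]
    congr 2
    have := intervalIntegral.integral_comp_neg (a := -V) (b := V) (fun v => S v * Real.exp (-v^2 / (4 * x^30)))
    rw [neg_neg] at this
    rw [← this]
    simp only [neg_sq]
  rw [hIntg] at hmain
  have hJ : ‖JJ (x^30) (fun w => dslope (Qf κ ε lam s Y) 0 w * ((tt:ℂ)^w * dpoly (fun n => ψ⁻¹ (n : ZMod p)) N3 (1 - s + w))) a‖ ≤ c1 * (∫ v in (-V)..V, S v * Real.exp (-v^2 / (4 * x^30))) + B * Real.sqrt (Real.pi / (1 / (16 * x^30))) := hmain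
  refine hJ.trans ?_
  have hI0 : 0 ≤ ∫ v in (-V)..V, S v * Real.exp (-v^2 / (4 * x^30)) :=
    intervalIntegral.integral_nonneg (by linarith) (fun v _ => mul_nonneg (norm_nonneg _) (Real.exp_pos _).le)
  have hsq : Real.sqrt (Real.pi / (1 / (16 * x^30))) ≤ 2 * Real.exp (x^9) := by
    have e1 : Real.pi / (1 / (16 * x^30)) = 2^2 * (4 * Real.pi * x^30) := by field_simp; ring
    have e2 : Real.sqrt (4 * Real.pi * x^30) ≤ Real.sqrt (8 * Real.pi * x^30) := Real.sqrt_le_sqrt (by gcongr; norm_num)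
    rw [e1, Real.sqrt_mul (by norm_num), Real.sqrt_sq (by norm_num)]
    linarith [sqrt_exp hx]
  have hlast : B * Real.sqrt (Real.pi / (1 / (16 * x^30))) ≤ (9 * (C1 + C2) * 2) * Real.exp (-(x^10 / 20)) := by
    calc _ ≤ B * (2 * Real.exp (x^9)) := by gcongr
      _ = 9 * (C1 + C2) * 2 * Real.exp (3 * x^9 - x^10 / 16 + x^9) := by rw [hB, Real.exp_add]; ring
      _ ≤ _ := by gcongr; linarith
  have hE := Real.exp_pos (-(x^10 / 20))
  have f1 : c1 * (∫ v in (-V)..V, S v * Real.exp (-v^2 / (4 * x^30))) ≤ (28 * C1 * 9 + 9 * (C1 + C2) * 2) * x^(-68:ℤ) * (∫ v in (-V)..V, S v * Real.exp (-v^2 / (4 * x^30))) := by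
    gcongr
    rw [hc1]
    gcongr
    have : 0 ≤ 9 * (C1 + C2) * 2 := by positivity
    linarith
  have f2 : 9 * (C1 + C2) * 2 * Real.exp (-(x^10 / 20)) ≤ (28 * C1 * 9 + 9 * (C1 + C2) * 2) * Real.exp (-(x^10 / 20)) := by
    gcongr
    have : 0 ≤ 28 * C1 * 9 := by positivity
    linarith
  linarith
end

/-- Approximate functional equation for `L(s,ψ)`: for every `ψ ∈ Ψ` and `s`
with `|Re s - 1/2| < 2α`, `|Im s - 2πt₀| < 𝓛₁ + 2`,
`|L(s,ψ) - K(s,ψ) - Z(s,ψ) N(1-s,ψ̄)| ≤ C E₁(s,ψ)`. -/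
theorem statement18 :
    ∃ C : ℝ, 0 < C ∧ ∃ D₀ : ℕ, ∀ D : ℕ, D₀ ≤ D →
      ∀ (p : ℕ) (ψ : DirichletCharacter ℂ p), SimP D p → ψ.IsPrimitive →
        ∀ s : ℂ, |s.re - 1 / 2| < 2 * alphaD D → |s.im - 2 * Real.pi * t0 D| < bigL1 D + 2 →
          ‖Lfun ψ s - Kfun D ψ s - Zfun ψ s * Nfun D ψ s‖ ≤
            C * bigL D ^ (-68 : ℤ) *
                (∫ v in (-(bigL D ^ 20))..(bigL D ^ 20),
                  ‖∑ n ∈ Finset.range ⌈bigT D ^ 3⌉₊,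
                      ψ (n : ZMod p) * (n : ℂ) ^ (-s - (v : ℂ) * Complex.I)‖ *
                    Real.exp (-v ^ 2 / (4 * bigL D ^ 30))) +
              Real.exp (-bigL D ^ 9) := by
  obtain ⟨C2, hC2, T2⟩ := term2
  obtain ⟨C3, hC3, T3⟩ := term3
  obtain ⟨CZ, hCZ, TZ⟩ := Z_bd
  refine ⟨C3, hC3, ⌈Real.exp (1000 + (24 + C2 + C3 + 3 * CZ))⌉₊, fun D hD p ψ hP hψ s hs ht => ?_⟩
  obtain ⟨hp, hp1, hp2⟩ := hP
  have hxbig : 1000 + (24 + C2 + C3 + 3 * CZ) ≤ bigL D := by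
    rw [bigL, Real.le_log_iff_exp_le]
    · exact Nat.ceil_le.1 hD
    · exact lt_of_lt_of_le (Real.exp_pos _) (Nat.ceil_le.1 hD)
  obtain ⟨x, hxD⟩ : ∃ x, x = bigL D := ⟨_, rfl⟩
  have hxb : 1000 + (24 + C2 + C3 + 3 * CZ) ≤ x := hxD ▸ hxbig
  have hx : 1000 ≤ x := by linarith
  have hx0 : 0 < x := by linarith
  obtain ⟨U, hUd⟩ : ∃ U, U = x ^ (1.1:ℝ) := ⟨_, rfl⟩
  have hU : U ≤ x^2 := by
    rw [hUd, ← Real.rpow_natCast]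
    exact Real.rpow_le_rpow_of_exponent_le (by linarith) (by norm_num)
  have hxU : x ≤ U := by
    rw [hUd]
    calc x = x ^ (1:ℝ) := (Real.rpow_one x).symm
      _ ≤ _ := Real.rpow_le_rpow_of_exponent_le (by linarith) (by norm_num)
  have hT : bigT D = Real.exp U := by rw [bigT, hUd, hxD]
  have hT3 : bigT D ^ 3 = Real.exp (3 * U) := by rw [hT, ← Real.exp_nat_mul]; norm_num
  have hT2 : bigT D ^ 2 = Real.exp (2 * U) := by rw [hT, ← Real.exp_nat_mul]; norm_num
  have hP4 : P4 D = Real.exp (x^9 - 2 * U) * x^519 := by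
    rw [P4, bigP, t0, zpow_neg, ← hxD, show bigT D ^ (2:ℤ) = bigT D ^ 2 by norm_cast, hT2, Real.exp_sub]
    rfl
  have hal : alphaD D = Real.pi / x^9 := by rw [alphaD, bigP, Real.log_exp, hxD]
  obtain ⟨κ, ε, hε, hκ, hZ, hfe⟩ := exists_Z hp ψ hψ
  have hYA : Real.exp (x^9) * x^519 = P4 D * bigT D ^ 2 := by
    rw [hP4, hT2, Real.exp_sub]; field_simp
  have hS : Setup x p κ ε s (Real.log (2 * Real.pi / p)) (Real.exp (x^9) * x^519) := by
    refine ⟨hx, by rw [hxD]; exact hp1, by rw [hxD]; exact hp2, hκ, hε, rfl, rfl, ?_, ?_⟩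
    · rw [hal] at hs; refine hs.le.trans (le_of_eq (by ring))
    · rw [t0, bigL1, ← hxD] at ht; exact ht.le
  have hN3 : ⌈2 * bigT D ^ 2⌉₊ ≤ ⌈Real.exp (3 * U)⌉₊ := by
    apply Nat.ceil_le_ceil
    rw [hT2, show 3 * U = U + 2 * U by ring, Real.exp_add]
    gcongr
    linarith [Real.add_one_le_exp U]
  obtain ⟨s1, s2⟩ := abs_le.1 hS.sre
  have hid := exact_identity (D := D) (by rw [← hxD]; exact hx0) (Λ := x^30) (by rw [hxD]) (A := P4 D) rfl (by rw [hP4]; positivity) (tt := bigT D ^ 2) rfl (by rw [hT2]; positivity) hYA hp ψ hψ hZ hfe (s := s) (hS.sre.trans (by norm_num)) hN3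
  have b1 := term1 hS hU (by linarith) hP4 hp ψ hψ
  have b2 := T2 hS hU hxU hT2 hp ψ hψ
  have b3 := T3 hS hU hxU hT2 hp ψ _ (N3_le hx hU)
  have b4 := term4 hxD hS hU hT2 ψ⁻¹
  have b0 : ‖Zfun ψ s‖ ≤ CZ := by
    have := TZ hS
    rw [Qf, sub_zero, neg_zero, Complex.cpow_zero, mul_one, ← hZ s (by linarith) (by linarith)] at this
    exact this
  rw [hid, hT3, ← hxD]
  have hpi : ‖(2 * (Real.pi:ℂ))⁻¹‖ ≤ 1 := by
    rw [norm_inv, norm_mul, Complex.norm_real, Real.norm_of_nonneg Real.pi_pos.le]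
    apply inv_le_one_of_one_le₀
    simp
    linarith [Real.pi_gt_three]
  have hfin : (24 + C2 + C3 + 3 * CZ) * Real.exp (-(x^10/20)) ≤ Real.exp (-x^9) := by
    have e1 : 24 + C2 + C3 + 3 * CZ ≤ Real.exp (x^10/20 - x^9) := by
      refine le_trans ?_ ((Real.add_one_le_exp _))
      have h10 : x^10 = x^9 * x := by ring
      have h9 : x ≤ x^9 := by
        have := pow_cmp hx 1 (n := 9) (by norm_num)
        linarith [pow_one x]
      nlinarith
    calc _ ≤ Real.exp (x^10/20 - x^9) * Real.exp (-(x^10/20)) := by gcongr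
      _ = _ := by rw [← Real.exp_add]; congr 1; ring
  refine (norm_add_le _ _).trans ?_
  rw [norm_mul, norm_mul]
  have c1 : ∀ {a b : ℝ}, 0 ≤ b → a ≤ 1 → a * b ≤ b := fun hb ha => mul_le_of_le_one_left hb ha
  have c2 := mul_le_mul b0 b4 (norm_nonneg _) hCZ.le
  refine (add_le_add (c1 (norm_nonneg _) hpi) c2).trans ?_
  refine (add_le_add_left (norm_add₃_le.trans (add_le_add (add_le_add b1 b2) b3)) _).trans ?_
  linarith

end
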